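/- arXiv:1112.4892 — 2 statements merged into one kernel-verified Lean document; each statement's English description precedes it below -/
import Mathlib

section
/- Let φ: ℝ → ℝ be a continuous function with φ(t+2π) − φ(t) ∈ 2πℤ for all t ∈ ℝ (so that φ induces a continuous mapping of the circle 𝕋 = ℝ/2πℤ into itself). Suppose that for all sufficiently large |n| the 2π-periodic function t ↦ e^{inφ(t)} has absolutely convergent Fourier series, and that ‖e^{inφ}‖_{A(𝕋)} · (log log log |n| / log log |n|)^{1/12} → 0 as |n| → ∞, n ∈ ℤ. Then φ is linear with integer slope: there exists ν ∈ ℤ such that φ(t) = νt + φ(0) for all t ∈ ℝ. -/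
open scoped Real
open Complex MeasureTheory Filter

/-- The `k`-th Fourier coefficient of a `2π`-periodic function `f : ℝ → ℂ`. -/
noncomputable def fourierCoeffT (f : ℝ → ℂ) (k : ℤ) : ℂ :=
  (1 / (2 * (π : ℂ))) * ∫ t in (0 : ℝ)..(2 * π), f t * Complex.exp (-Complex.I * (k : ℂ) * (t : ℂ))

/-- The `A(𝕋)` norm: the sum of absolute values of the Fourier coefficients. -/
noncomputable def normAT (f : ℝ → ℂ) : ℝ :=
  ∑' k : ℤ, ‖fourierCoeffT f k‖

/-- The character `(x, y, z) ↦ exp (i (k₁ x + k₂ y + k₃ z))` of the three-dimensional torus. -/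
noncomputable def torusChar (k : ℤ × ℤ × ℤ) (x : ℝ × ℝ × ℝ) : ℂ :=
  Complex.exp (Complex.I * (k.1 * x.1 + k.2.1 * x.2.1 + k.2.2 * x.2.2))

/-- Normalized Lebesgue measure on a period of the circle. -/
noncomputable def circleMeas : Measure ℝ :=
  ENNReal.ofReal (1 / (2 * π)) • volume.restrict (Set.Ioc 0 (2 * π))

/-- Normalized Lebesgue measure on a period of the three-dimensional torus. -/
noncomputable def torusMeas : Measure (ℝ × ℝ × ℝ) :=
  circleMeas.prod (circleMeas.prod circleMeas)

instance : IsProbabilityMeasure circleMeas := by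
  constructor
  have h : (0 : ℝ) < 2 * π := by positivity
  simp only [circleMeas, Measure.smul_apply, Measure.restrict_apply MeasurableSet.univ,
    Set.univ_inter, Real.volume_Ioc, sub_zero, smul_eq_mul]
  rw [← ENNReal.ofReal_mul (by positivity), one_div, inv_mul_cancel₀ h.ne', ENNReal.ofReal_one]

instance : IsProbabilityMeasure torusMeas := by
  unfold torusMeas; infer_instance

lemma integral_circleMeas (f : ℝ → ℂ) :
    ∫ t, f t ∂circleMeas = (1 / (2 * (π : ℂ))) * ∫ t in (0 : ℝ)..(2 * π), f t := by
  have h : (0 : ℝ) ≤ 1 / (2 * π) := by positivity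
  rw [circleMeas, integral_smul_measure, ENNReal.toReal_ofReal h,
    intervalIntegral.integral_of_le (by positivity), Complex.real_smul]
  push_cast
  rfl

lemma integral_circleMeas_exp (k : ℤ) :
    ∫ t : ℝ, Complex.exp (Complex.I * (k * t)) ∂circleMeas = if k = 0 then 1 else 0 := by
  split_ifs with h
  · simp [h]
  · rw [integral_circleMeas]
    have hk : Complex.I * k ≠ 0 := mul_ne_zero I_ne_zero (Int.cast_ne_zero.mpr h)
    simp_rw [← mul_assoc]
    rw [integral_exp_mul_complex hk]
    have : Complex.exp (Complex.I * k * ((2 * π : ℝ) : ℂ)) = 1 := by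
      rw [Complex.exp_eq_one_iff]
      exact ⟨k, by push_cast; ring⟩
    rw [this]; simp

lemma torusChar_zero (x : ℝ × ℝ × ℝ) : torusChar 0 x = 1 := by simp [torusChar]

lemma torusChar_add (k l : ℤ × ℤ × ℤ) (x : ℝ × ℝ × ℝ) :
    torusChar (k + l) x = torusChar k x * torusChar l x := by
  simp only [torusChar, ← Complex.exp_add, Prod.fst_add, Prod.snd_add]
  congr 1; push_cast; ring

lemma conj_torusChar (k : ℤ × ℤ × ℤ) (x : ℝ × ℝ × ℝ) :
    (starRingEnd ℂ) (torusChar k x) = torusChar (-k) x := by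
  simp only [torusChar, ← Complex.exp_conj, Prod.fst_neg, Prod.snd_neg]
  congr 1; simp; ring

lemma norm_torusChar (k : ℤ × ℤ × ℤ) (x : ℝ × ℝ × ℝ) : ‖torusChar k x‖ = 1 := by
  rw [torusChar, mul_comm]
  have : ((k.1 * x.1 + k.2.1 * x.2.1 + k.2.2 * x.2.2 : ℂ)) =
      ((k.1 * x.1 + k.2.1 * x.2.1 + k.2.2 * x.2.2 : ℝ) : ℂ) := by push_cast; ring
  rw [this, Complex.norm_exp_ofReal_mul_I]

lemma continuous_torusChar (k : ℤ × ℤ × ℤ) : Continuous (torusChar k) := by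
  unfold torusChar; fun_prop

lemma integral_torusChar (k : ℤ × ℤ × ℤ) :
    ∫ x, torusChar k x ∂torusMeas = if k = 0 then 1 else 0 := by
  have : ∀ x, torusChar k x = Complex.exp (Complex.I * (k.1 * x.1)) *
      (Complex.exp (Complex.I * (k.2.1 * x.2.1)) * Complex.exp (Complex.I * (k.2.2 * x.2.2))) := by
    intro x
    simp only [torusChar, ← Complex.exp_add]
    congr 1; ring
  simp_rw [this]
  rw [torusMeas, integral_prod_mul (fun t : ℝ => Complex.exp (Complex.I * (k.1 * t)))
    (fun p : ℝ × ℝ => Complex.exp (Complex.I * (k.2.1 * p.1)) *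
      Complex.exp (Complex.I * (k.2.2 * p.2))),
    integral_prod_mul (fun t : ℝ => Complex.exp (Complex.I * (k.2.1 * t)))
    (fun t : ℝ => Complex.exp (Complex.I * (k.2.2 * t)))]
  simp_rw [integral_circleMeas_exp]
  obtain ⟨a, b, c⟩ := k
  by_cases ha : a = 0 <;> by_cases hb : b = 0 <;> by_cases hc : c = 0 <;> simp [ha, hb, hc]

/-- `f` has the absolutely convergent expansion `∑ i, c i • torusChar (l i)`. -/
structure HasExpansion {ι : Type} (c : ι → ℂ) (l : ι → ℤ × ℤ × ℤ) (f : ℝ × ℝ × ℝ → ℂ) : Prop where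
  summable : Summable fun i => ‖c i‖
  hasSum : ∀ x, HasSum (fun i => c i * torusChar (l i) x) (f x)

namespace HasExpansion

variable {ι κ : Type} {c : ι → ℂ} {l : ι → ℤ × ℤ × ℤ} {f : ℝ × ℝ × ℝ → ℂ}
  {d : κ → ℂ} {m : κ → ℤ × ℤ × ℤ} {g : ℝ × ℝ × ℝ → ℂ}

lemma continuous (h : HasExpansion c l f) : Continuous f := by
  have : f = fun x => ∑' i, c i * torusChar (l i) x := funext fun x => (h.hasSum x).tsum_eq.symm
  rw [this]
  refine continuous_tsum (fun i => continuous_const.mul (continuous_torusChar _)) h.summable ?_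
  intro i x
  rw [norm_mul, norm_torusChar, mul_one]

lemma norm_le (h : HasExpansion c l f) (x : ℝ × ℝ × ℝ) : ‖f x‖ ≤ ∑' i, ‖c i‖ := by
  rw [← (h.hasSum x).tsum_eq]
  have : ∀ i, ‖c i * torusChar (l i) x‖ = ‖c i‖ := fun i => by
    rw [norm_mul, norm_torusChar, mul_one]
  refine (norm_tsum_le_tsum_norm ?_).trans_eq (tsum_congr this)
  simpa only [this] using h.summable

lemma integrable (h : HasExpansion c l f) : Integrable f torusMeas :=
  Integrable.of_bound h.continuous.aestronglyMeasurable (∑' i, ‖c i‖)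
    (Eventually.of_forall h.norm_le)

lemma hasSum_integral [Countable ι] (h : HasExpansion c l f) :
    HasSum (fun i => if l i = 0 then c i else 0) (∫ x, f x ∂torusMeas) := by
  have hi : ∀ i, Integrable (fun x => c i * torusChar (l i) x) torusMeas := fun i =>
    Integrable.of_bound
      (continuous_const.mul (continuous_torusChar _)).aestronglyMeasurable ‖c i‖
      (Eventually.of_forall fun x => by rw [norm_mul, norm_torusChar, mul_one])
  have := hasSum_integral_of_summable_integral_norm hi
    (by simpa [norm_torusChar] using h.summable)
  convert! this using 1
  · funext i
    rw [integral_const_mul, integral_torusChar]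
    simp
  · exact integral_congr_ae (Eventually.of_forall fun x => (h.hasSum x).tsum_eq.symm)

lemma mul (hf : HasExpansion c l f) (hg : HasExpansion d m g) :
    HasExpansion (fun p : ι × κ => c p.1 * d p.2) (fun p => l p.1 + m p.2)
      (fun x => f x * g x) := by
  refine ⟨?_, fun x => ?_⟩
  · simp_rw [norm_mul]
    exact hf.summable.mul_of_nonneg hg.summable (fun _ => norm_nonneg _) fun _ => norm_nonneg _
  · have h1 : Summable fun i => ‖c i * torusChar (l i) x‖ := by
      simpa [norm_torusChar] using hf.summable
    have h2 : Summable fun i => ‖d i * torusChar (m i) x‖ := by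
      simpa [norm_torusChar] using hg.summable
    have h3 := (hf.hasSum x).mul (hg.hasSum x) 
      (summable_mul_of_summable_norm (f := fun i => c i * torusChar (l i) x)
        (g := fun i => d i * torusChar (m i) x) h1 h2)
    have e : (fun p : ι × κ => c p.1 * d p.2 * torusChar (l p.1 + m p.2) x) =
        fun p => c p.1 * torusChar (l p.1) x * (d p.2 * torusChar (m p.2) x) := by
      funext p
      rw [torusChar_add]
      ring
    rw [e]
    exact h3

lemma tsum_norm_mul (hf : HasExpansion c l f) (hg : HasExpansion d m g) :
    ∑' p : ι × κ, ‖c p.1 * d p.2‖ = (∑' i, ‖c i‖) * ∑' i, ‖d i‖ := by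
  simp_rw [norm_mul]
  exact (hf.summable.tsum_mul_tsum hg.summable
    (hf.summable.mul_of_nonneg hg.summable (fun _ => norm_nonneg _) fun _ => norm_nonneg _)).symm

lemma conj (hf : HasExpansion c l f) :
    HasExpansion (fun i => (starRingEnd ℂ) (c i)) (fun i => - l i)
      (fun x => (starRingEnd ℂ) (f x)) where
  summable := by simpa using hf.summable
  hasSum x := by
    have := (hf.hasSum x).mapL (Complex.conjCLE : ℂ →L[ℝ] ℂ)
    simpa [conj_torusChar] using this

lemma const_mul (a : ℂ) (hf : HasExpansion c l f) :
    HasExpansion (fun i => a * c i) l (fun x => a * f x) where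
  summable := by simpa using hf.summable.mul_left ‖a‖
  hasSum x := by simpa [mul_assoc] using (hf.hasSum x).mul_left a

lemma add (hf : HasExpansion c l f) (hg : HasExpansion d m g) :
    HasExpansion (Sum.elim c d) (Sum.elim l m) (fun x => f x + g x) where
  summable := by
    have := (hf.summable.hasSum.sum (f := fun i => ‖Sum.elim c d i‖)) hg.summable.hasSum
    exact this.summable
  hasSum x := HasSum.sum (f := fun i => Sum.elim c d i * torusChar (Sum.elim l m i) x)
    (hf.hasSum x) (hg.hasSum x)

end HasExpansion

/-- Positivity for the lexicographic order on `ℤ × ℤ × ℤ`. -/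
def LexPos (k : ℤ × ℤ × ℤ) : Prop :=
  0 < k.1 ∨ k.1 = 0 ∧ (0 < k.2.1 ∨ k.2.1 = 0 ∧ 0 < k.2.2)

lemma LexPos.add {k l : ℤ × ℤ × ℤ} (hk : LexPos k) (hl : LexPos l) : LexPos (k + l) := by
  simp only [LexPos, Prod.fst_add, Prod.snd_add] at *
  omega

lemma LexPos.ne_zero {k : ℤ × ℤ × ℤ} (hk : LexPos k) : k ≠ 0 := by
  rintro rfl
  simp [LexPos] at hk

lemma LexPos.neg_of_not {k : ℤ × ℤ × ℤ} (hk : ¬ LexPos k) (h0 : k ≠ 0) : LexPos (-k) := by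
  obtain ⟨a, b, c⟩ := k
  simp only [LexPos, Prod.fst_neg, Prod.snd_neg, ne_eq, Prod.mk_eq_zero] at *
  omega

namespace HasExpansion

variable {ι : Type} {c : ι → ℂ} {l : ι → ℤ × ℤ × ℤ} {f : ℝ × ℝ × ℝ → ℂ}

lemma integral_eq_zero_of_lexPos [Countable ι] (h : HasExpansion c l f)
    (hl : ∀ i, LexPos (l i)) : ∫ x, f x ∂torusMeas = 0 := by
  have := h.hasSum_integral
  simp only [(hl _).ne_zero, if_false] at this
  exact this.unique hasSum_zero

lemma exists_pow [Countable ι] (h : HasExpansion c l f) (hl : ∀ i, LexPos (l i)) (n : ℕ) :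
    ∃ (κ : Type) (_ : Countable κ) (d : κ → ℂ) (m : κ → ℤ × ℤ × ℤ),
      HasExpansion d m (fun x => f x ^ (n + 1)) ∧ ∀ i, LexPos (m i) := by
  induction n with
  | zero => exact ⟨ι, ‹_›, c, l, by simpa using h, hl⟩
  | succ n ih =>
    obtain ⟨κ, hκ, d, m, hd, hm⟩ := ih
    have e : (fun x => f x ^ (n + 1 + 1)) = fun x => f x ^ (n + 1) * f x :=
      funext fun x => pow_succ _ _
    rw [e]
    exact ⟨κ × ι, inferInstance, _, _, hd.mul h, fun p => (hm p.1).add (hl p.2)⟩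

/-- The exponential of a function with lexicographically positive spectrum has mean `1`. -/
lemma integral_exp_of_lexPos [Countable ι] (h : HasExpansion c l f) (hl : ∀ i, LexPos (l i)) :
    ∫ x, Complex.exp (f x) ∂torusMeas = 1 := by
  set S := ∑' i, ‖c i‖ with hS
  have hb : ∀ (n : ℕ) x, ‖f x ^ n / (n.factorial : ℂ)‖ ≤ S ^ n / n.factorial := by
    intro n x
    rw [norm_div, norm_pow, Complex.norm_natCast]
    gcongr
    exact h.norm_le x
  have hi : ∀ n : ℕ, Integrable (fun x => f x ^ n / (n.factorial : ℂ)) torusMeas := fun n =>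
    Integrable.of_bound ((h.continuous.pow n).div_const _).aestronglyMeasurable _
      (Eventually.of_forall (hb n))
  have hsum : Summable fun n : ℕ => ∫ x, ‖f x ^ n / (n.factorial : ℂ)‖ ∂torusMeas := by
    refine (Real.summable_pow_div_factorial S).of_nonneg_of_le
      (fun n => integral_nonneg fun x => norm_nonneg _) fun n => ?_
    calc _ ≤ ∫ _, S ^ n / n.factorial ∂torusMeas :=
          integral_mono (hi n).norm (integrable_const _) (hb n)
      _ = _ := by simp
  have key := hasSum_integral_of_summable_integral_norm hi hsum
  have hexp : ∀ x, ∑' n : ℕ, f x ^ n / (n.factorial : ℂ) = Complex.exp (f x) := fun x => by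
    rw [Complex.exp_eq_exp_ℂ, NormedSpace.exp_eq_tsum_div]
  simp_rw [hexp] at key
  refine key.unique ?_
  have h0 : ∀ n : ℕ, n ≠ 0 → ∫ x, f x ^ n / (n.factorial : ℂ) ∂torusMeas = 0 := by
    intro n hn
    obtain ⟨k, rfl⟩ := Nat.exists_eq_succ_of_ne_zero hn
    obtain ⟨κ, _, d, m, hd, hm⟩ := h.exists_pow hl k
    rw [integral_div, Nat.succ_eq_add_one, hd.integral_eq_zero_of_lexPos hm, zero_div]
  simpa using hasSum_single 0 h0

/-- A `[0, 1]`-valued function on the torus whose Fourier coefficients sum up to at most `L` can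
be close in mean to `{0, 1}`-valued functions only if its mean is close to `0` or `1`. -/
lemma sin_integral_le [Countable ι] {f : ℝ × ℝ × ℝ → ℝ}
    (h : HasExpansion c l (fun x => (f x : ℂ))) {L : ℝ} (hL : ∑' i, ‖c i‖ ≤ L)
    (h0 : ∀ x, 0 ≤ f x) (h1 : ∀ x, f x ≤ 1) :
    Real.sin (π * ∫ x, f x ∂torusMeas) ≤
      Real.exp (π * L) * ∫ x, Real.sin (π * f x) ∂torusMeas := by
  classical
  set d : ι → ℂ := fun i => if LexPos (l i) then c i else
    if l i = 0 then 0 else (starRingEnd ℂ) (c i) with hd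
  set m : ι → ℤ × ℤ × ℤ := fun i => if LexPos (l i) then l i else
    if l i = 0 then (1, 0, 0) else - l i with hm
  set a : ι → ℂ := fun i => if l i = 0 then c i else 0 with ha
  have hmpos : ∀ i, LexPos (m i) := by
    intro i
    simp only [hm]
    split_ifs with h2 h3
    · exact h2
    · simp [LexPos]
    · exact LexPos.neg_of_not h2 h3
  have hdc : ∀ i, ‖d i‖ ≤ ‖c i‖ := by
    intro i
    simp only [hd]
    split_ifs <;> simp
  have hds : Summable fun i => ‖d i‖ := h.summable.of_nonneg_of_le (fun _ => norm_nonneg _) hdc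
  have hac : ∀ i, ‖a i‖ ≤ ‖c i‖ := by
    intro i
    simp only [ha]
    split_ifs <;> simp
  have has : Summable a := Summable.of_norm
    (h.summable.of_nonneg_of_le (fun _ => norm_nonneg _) hac)
  set P : ℝ × ℝ × ℝ → ℂ := fun x => ∑' i, d i * torusChar (m i) x with hP
  have hPe : HasExpansion d m P := by
    refine ⟨hds, fun x => ?_⟩
    refine (Summable.of_norm ?_).hasSum
    simpa [norm_torusChar] using hds
  have hre : ∀ i x, (c i * torusChar (l i) x).re = (a i).re + (d i * torusChar (m i) x).re := by
    intro i x
    simp only [ha, hd, hm]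
    by_cases h2 : LexPos (l i)
    · simp [h2, h2.ne_zero]
    · by_cases h3 : l i = 0
      · rw [h3] at h2
        simp [h2, h3, torusChar_zero]
      · simp only [h2, h3, if_false, ← conj_torusChar, ← map_mul, Complex.conj_re]
        simp
  set A : ℝ := (∑' i, a i).re with hA
  have hf : ∀ x, f x = A + (P x).re := by
    intro x
    have e1 := Complex.hasSum_re (h.hasSum x)
    have e2 := (Complex.hasSum_re has.hasSum).add (Complex.hasSum_re (hPe.hasSum x))
    simp_rw [hre] at e1
    simpa using e1.unique e2
  have hIP : ∫ x, P x ∂torusMeas = 0 := hPe.integral_eq_zero_of_lexPos hmpos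
  have hIPre : ∫ x, (P x).re ∂torusMeas = 0 := by
    have := integral_re hPe.integrable
    simp only [RCLike.re_eq_complex_re] at this
    rw [this, hIP, Complex.zero_re]
  have hIf : ∫ x, f x ∂torusMeas = A := by
    simp_rw [hf]
    have hr : Integrable (fun x => (P x).re) torusMeas := hPe.integrable.re
    rw [integral_add (integrable_const _) hr, hIPre]
    simp
  have hexp : ∫ x, Complex.exp (π * I * P x) ∂torusMeas = 1 :=
    (hPe.const_mul (π * I)).integral_exp_of_lexPos hmpos
  have hPim : ∀ x, |(P x).im| ≤ L := fun x =>
    (Complex.abs_im_le_norm _).trans ((hPe.norm_le x).trans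
      ((hds.tsum_le_tsum hdc h.summable).trans hL))
  have hcont : Continuous f := by
    have : f = fun x => A + (P x).re := funext hf
    rw [this]
    exact continuous_const.add (Complex.continuous_re.comp hPe.continuous)
  have hG : ∀ x, (Complex.exp (π * I * (A + P x))).im =
      Real.exp (- π * (P x).im) * Real.sin (π * f x) := by
    intro x
    rw [Complex.exp_im]
    congr 2
    · simp
    · simp [hf x]
  have hGi : Integrable (fun x => Complex.exp (π * I * (A + P x))) torusMeas := by
    refine Integrable.of_bound (C := Real.exp (π * L)) ?_ (Eventually.of_forall fun x => ?_)
    · have := hPe.continuous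
      exact Continuous.aestronglyMeasurable (by fun_prop)
    · rw [Complex.norm_exp]
      refine Real.exp_le_exp.mpr ?_
      have := hPim x
      have h3 : (π * I * (A + P x)).re = π * (-(P x).im) := by simp
      rw [h3]
      exact mul_le_mul_of_nonneg_left ((neg_le_abs _).trans this) Real.pi_pos.le
  have hGI : ∫ x, Complex.exp (π * I * (A + P x)) ∂torusMeas = Complex.exp (π * I * A) := by
    simp_rw [mul_add, Complex.exp_add]
    rw [integral_const_mul, hexp, mul_one]
  have hGI2 : ∫ x, Real.exp (- π * (P x).im) * Real.sin (π * f x) ∂torusMeas =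
      Real.sin (π * A) := by
    simp_rw [← hG]
    have := integral_im hGi
    simp only [RCLike.im_eq_complex_im] at this
    rw [this, hGI, Complex.exp_im]
    simp
  rw [hIf, ← hGI2, ← integral_const_mul]
  have hs0 : ∀ x, 0 ≤ Real.sin (π * f x) := fun x =>
    Real.sin_nonneg_of_nonneg_of_le_pi (mul_nonneg Real.pi_pos.le (h0 x))
      (mul_le_of_le_one_right Real.pi_pos.le (h1 x))
  refine integral_mono ?_ ?_ fun x => ?_
  · simp_rw [← hG]
    exact hGi.im
  · refine Integrable.of_bound (C := Real.exp (π * L)) ?_ (Eventually.of_forall fun x => ?_)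
    · exact Continuous.aestronglyMeasurable (by fun_prop)
    · rw [norm_mul, Real.norm_eq_abs, Real.norm_eq_abs, abs_of_pos (Real.exp_pos _)]
      exact mul_le_of_le_one_right (Real.exp_pos _).le (Real.abs_sin_le_one _)
  · refine mul_le_mul_of_nonneg_right (Real.exp_le_exp.mpr ?_) (hs0 x)
    have := (neg_le_abs _).trans (hPim x)
    have := mul_le_mul_of_nonneg_left this Real.pi_pos.le
    linarith

end HasExpansion

/-- `f` is a sum of multiples of characters with coefficients adding up to at most `L` in absolute
value. -/
def WienerBound (L : ℝ) (f : ℝ × ℝ × ℝ → ℂ) : Prop :=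
  ∃ (ι : Type) (_ : Countable ι) (c : ι → ℂ) (l : ι → ℤ × ℤ × ℤ),
    HasExpansion c l f ∧ ∑' i, ‖c i‖ ≤ L

namespace WienerBound

variable {L M : ℝ} {f g : ℝ × ℝ × ℝ → ℂ}

lemma zero : WienerBound 0 (fun _ => 0) :=
  ⟨Empty, inferInstance, Empty.elim, Empty.elim,
    ⟨(hasSum_empty : HasSum _ (0 : ℝ)).summable, fun _ => hasSum_empty⟩, by simp⟩

lemma const_mul (a : ℂ) (hf : WienerBound L f) : WienerBound (‖a‖ * L) (fun x => a * f x) := by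
  obtain ⟨ι, _, c, l, h, hL⟩ := hf
  refine ⟨ι, ‹_›, _, _, h.const_mul a, ?_⟩
  simp_rw [norm_mul]
  rw [tsum_mul_left]
  exact mul_le_mul_of_nonneg_left hL (norm_nonneg a)

lemma add (hf : WienerBound L f) (hg : WienerBound M g) :
    WienerBound (L + M) (fun x => f x + g x) := by
  obtain ⟨ι, _, c, l, h, hL⟩ := hf
  obtain ⟨κ, _, d, m, h', hM⟩ := hg
  refine ⟨ι ⊕ κ, inferInstance, _, _, h.add h', ?_⟩
  have : HasSum (fun i => ‖Sum.elim c d i‖) (∑' i, ‖c i‖ + ∑' i, ‖d i‖) :=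
    HasSum.sum (f := fun i => ‖Sum.elim c d i‖) h.summable.hasSum h'.summable.hasSum
  rw [this.tsum_eq]
  exact add_le_add hL hM

lemma sum {α : Type*} (s : Finset α) {L : α → ℝ} {f : α → ℝ × ℝ × ℝ → ℂ}
    (h : ∀ a ∈ s, WienerBound (L a) (f a)) :
    WienerBound (∑ a ∈ s, L a) (fun x => ∑ a ∈ s, f a x) := by
  classical
  induction s using Finset.induction_on with
  | empty => simpa using zero
  | insert a s ha ih =>
    simp_rw [Finset.sum_insert ha]
    exact (h a (Finset.mem_insert_self a s)).add
      (ih fun b hb => h b (Finset.mem_insert_of_mem hb))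

lemma mono (hf : WienerBound L f) (hLM : L ≤ M) : WienerBound M f := by
  obtain ⟨ι, _, c, l, h, hL⟩ := hf
  exact ⟨ι, ‹_›, c, l, h, hL.trans hLM⟩

end WienerBound

/-- The second difference of `ψ` at `x` with steps `y` and `z`. -/
def secondDiff (ψ : ℝ → ℝ) (x : ℝ × ℝ × ℝ) : ℝ :=
  ψ x.1 - ψ (x.1 + x.2.1) - ψ (x.1 + x.2.2) + ψ (x.1 + x.2.1 + x.2.2)

lemma Continuous.secondDiff {ψ : ℝ → ℝ} (h : Continuous ψ) : Continuous (secondDiff ψ) := by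
  unfold _root_.secondDiff; fun_prop

lemma HasExpansion.of_circle {u : ℝ → ℂ} {c : ℤ → ℂ} (hs : Summable fun k => ‖c k‖)
    (hu : ∀ t : ℝ, HasSum (fun k : ℤ => c k * Complex.exp (Complex.I * (k * t))) (u t))
    (α : ℤ × ℤ × ℤ) :
    HasExpansion c (fun k => k • α)
      (fun x => u (α.1 * x.1 + α.2.1 * x.2.1 + α.2.2 * x.2.2)) := by
  refine ⟨hs, fun x => ?_⟩
  convert! hu (α.1 * x.1 + α.2.1 * x.2.1 + α.2.2 * x.2.2) using 3 with k
  simp only [torusChar, Prod.smul_fst, Prod.smul_snd, smul_eq_mul]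
  congr 1
  push_cast
  ring

lemma exists_expansion_secondDiff {u : ℝ → ℂ} {c : ℤ → ℂ} {K : ℝ} (hK : 0 < K)
    (hs : Summable fun k => ‖c k‖) (hcK : ∑' k, ‖c k‖ ≤ K) (hc : ∃ k, 1 / (2 * K) ≤ ‖c k‖)
    (hu : ∀ t : ℝ, HasSum (fun k : ℤ => c k * Complex.exp (Complex.I * (k * t))) (u t)) :
    ∀ U : ℝ × ℝ × ℝ → ℂ, (∀ x, U x = u x.1 * (starRingEnd ℂ) (u (x.1 + x.2.1)) *
      ((starRingEnd ℂ) (u (x.1 + x.2.2)) * u (x.1 + x.2.1 + x.2.2))) →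
    WienerBound (K ^ 4) U ∧ (1 / (2 * K)) ^ 4 ≤ (∫ x, U x ∂torusMeas).re := by
  intro U hU
  have e1 := HasExpansion.of_circle hs hu (1, 0, 0)
  have e2 := (HasExpansion.of_circle hs hu (1, 1, 0)).conj
  have e3 := (HasExpansion.of_circle hs hu (1, 0, 1)).conj
  have e4 := HasExpansion.of_circle hs hu (1, 1, 1)
  have e := (e1.mul e2).mul (e3.mul e4)
  have hn := (e1.mul e2).tsum_norm_mul (e3.mul e4)
  rw [e1.tsum_norm_mul e2, e3.tsum_norm_mul e4] at hn
  simp only [RCLike.norm_conj] at hn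
  have hUe : U = fun x => _ := funext hU
  have he : HasExpansion (fun p : (ℤ × ℤ) × (ℤ × ℤ) =>
      c p.1.1 * (starRingEnd ℂ) (c p.1.2) * ((starRingEnd ℂ) (c p.2.1) * c p.2.2))
      (fun p => p.1.1 • ((1, 0, 0) : ℤ × ℤ × ℤ) + - p.1.2 • ((1, 1, 0) : ℤ × ℤ × ℤ) +
        (- p.2.1 • ((1, 0, 1) : ℤ × ℤ × ℤ) + p.2.2 • ((1, 1, 1) : ℤ × ℤ × ℤ))) U := by
    rw [hUe]
    convert! e using 3 <;> simp
  have h0 : 0 ≤ ∑' k, ‖c k‖ := tsum_nonneg fun _ => norm_nonneg _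
  refine ⟨⟨_, inferInstance, _, _, he, ?_⟩, ?_⟩
  · rw [hn]
    calc _ = (∑' k, ‖c k‖) ^ 4 := by ring
      _ ≤ K ^ 4 := pow_le_pow_left₀ h0 hcK 4
  · obtain ⟨k, hk⟩ := hc
    have hsum := Complex.hasSum_re he.hasSum_integral
    have hdiag : ∀ a : ℤ, c a * (starRingEnd ℂ) (c a) * ((starRingEnd ℂ) (c a) * c a) =
        ((‖c a‖ ^ 4 : ℝ) : ℂ) := by
      intro a
      rw [mul_comm ((starRingEnd ℂ) (c a)) (c a), Complex.mul_conj, Complex.normSq_eq_norm_sq]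
      push_cast
      ring
    have hkk := le_hasSum hsum ((k, k), (k, k)) ?_
    · rw [if_pos (by simp), hdiag, Complex.ofReal_re] at hkk
      exact (pow_le_pow_left₀ (by positivity) hk 4).trans hkk
    · rintro ⟨⟨p, q⟩, r, s⟩ -
      dsimp only
      split_ifs with h
      · simp only [Prod.smul_mk, Prod.mk_add_mk, Prod.mk_eq_zero, smul_eq_mul, mul_one,
          mul_zero] at h
        obtain rfl : q = p := by omega
        obtain rfl : r = q := by omega
        obtain rfl : s = r := by omega
        rw [hdiag, Complex.ofReal_re]
        positivity
      · simp

lemma cos_pow_eq_sum (N : ℕ) (θ : ℝ) :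
    ((((1 + Real.cos θ) / 2) ^ N : ℝ) : ℂ) = ∑ j ∈ Finset.range (2 * N + 1),
      (((2 * N).choose j / 4 ^ N : ℝ) : ℂ) * Complex.exp (Complex.I * (((j : ℤ) - N : ℤ) * θ)) := by
  have h1 : (((1 + Real.cos θ) / 2 : ℝ) : ℂ) =
      Complex.exp (-(Complex.I * θ)) * (Complex.exp (Complex.I * θ) + 1) ^ 2 / 4 := by
    push_cast
    rw [Complex.cos, Complex.exp_neg, mul_comm (θ : ℂ) Complex.I, neg_mul,
      mul_comm (θ : ℂ) Complex.I, Complex.exp_neg]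
    have := Complex.exp_ne_zero (Complex.I * θ)
    field_simp
    ring
  rw [Complex.ofReal_pow, h1, div_pow, mul_pow, ← pow_mul, add_pow, ← Complex.exp_nat_mul,
    Finset.mul_sum, Finset.sum_div]
  refine Finset.sum_congr rfl fun j _ => ?_
  have : Complex.exp (Complex.I * (((j : ℤ) - N : ℤ) * θ)) =
      Complex.exp (N * -(Complex.I * θ)) * Complex.exp (Complex.I * θ) ^ j := by
    rw [← Complex.exp_nat_mul, ← Complex.exp_add]
    congr 1
    push_cast
    ring
  rw [this]
  push_cast
  ring

lemma sin_pi_mul_le {a : ℝ} (h0 : 0 ≤ a) (h1 : a ≤ 1) :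
    Real.sin (π * a) ≤ 2 * π * (a - a ^ 2) := by
  have hpi := Real.pi_pos
  rcases le_total a (1 / 2) with h | h
  · have := Real.sin_le (mul_nonneg hpi.le h0)
    nlinarith [mul_nonneg h0 (sub_nonneg.mpr h), mul_nonneg hpi.le (mul_nonneg h0 (sub_nonneg.mpr h))]
  · have := Real.sin_le (mul_nonneg hpi.le (sub_nonneg.mpr h1))
    rw [mul_sub, mul_one, Real.sin_pi_sub] at this
    nlinarith [mul_nonneg hpi.le (mul_nonneg (sub_nonneg.mpr h1) (sub_nonneg.mpr h))]

lemma le_sin_pi_mul {a : ℝ} (h0 : 0 ≤ a) (h1 : a ≤ 1) :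
    2 * min a (1 - a) ≤ Real.sin (π * a) := by
  have hpi := Real.pi_pos
  have key : ∀ b : ℝ, 0 ≤ b → b ≤ 1 / 2 → 2 * b ≤ Real.sin (π * b) := by
    intro b hb hb'
    have := Real.mul_le_sin (mul_nonneg hpi.le hb) (by nlinarith)
    calc 2 * b = 2 / π * (π * b) := by field_simp
      _ ≤ _ := this
  rcases le_total a (1 / 2) with h | h
  · exact (mul_le_mul_of_nonneg_left (min_le_left _ _) zero_le_two).trans (key a h0 h)
  · have := key (1 - a) (by linarith) (by linarith)
    rw [mul_sub π, mul_one, Real.sin_pi_sub] at this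
    exact (mul_le_mul_of_nonneg_left (min_le_right _ _) zero_le_two).trans (by linarith)

/-- `u` is a sum of multiples of characters of the circle with coefficients adding up to at most
`K` in absolute value, and one coefficient is at least `1 / (2 * K)`. -/
def CircleBound (K : ℝ) (u : ℝ → ℂ) : Prop :=
  ∃ c : ℤ → ℂ, (Summable fun k => ‖c k‖) ∧ ∑' k, ‖c k‖ ≤ K ∧ (∃ k, 1 / (2 * K) ≤ ‖c k‖) ∧
    ∀ t : ℝ, HasSum (fun k : ℤ => c k * Complex.exp (Complex.I * (k * t))) (u t)

lemma circleBound_one {K : ℝ} (hK : 1 ≤ K) : CircleBound K fun _ => 1 := by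
  have h : HasSum (fun k : ℤ => ‖(Pi.single 0 1 : ℤ → ℂ) k‖) 1 := by
    convert hasSum_single (0 : ℤ) ?_ using 1
    · simp
    · intro k hk
      simp [hk]
  refine ⟨Pi.single 0 1, h.summable, h.tsum_eq.trans_le hK, ⟨0, ?_⟩, fun t => ?_⟩
  · rw [Pi.single_eq_same, norm_one, div_le_one (by positivity)]
    linarith
  · convert hasSum_single (0 : ℤ) ?_ using 1
    · simp
    · intro k hk
      simp [hk]

lemma exp_secondDiff (ψ : ℝ → ℝ) (n : ℤ) (x : ℝ × ℝ × ℝ) :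
    Complex.exp (Complex.I * (n * secondDiff ψ x)) =
      Complex.exp (Complex.I * n * ψ x.1) *
        (starRingEnd ℂ) (Complex.exp (Complex.I * n * ψ (x.1 + x.2.1))) *
      ((starRingEnd ℂ) (Complex.exp (Complex.I * n * ψ (x.1 + x.2.2))) *
        Complex.exp (Complex.I * n * ψ (x.1 + x.2.1 + x.2.2))) := by
  simp only [← Complex.exp_conj, ← Complex.exp_add]
  congr 1
  simp [secondDiff]
  ring

lemma sum_choose_div (N : ℕ) :
    ∑ j ∈ Finset.range (2 * N + 1), ((2 * N).choose j / 4 ^ N : ℝ) = 1 := by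
  rw [← Finset.sum_div, div_eq_one_iff_eq (by positivity)]
  have := Nat.sum_range_choose (2 * N)
  rw [pow_mul] at this
  exact_mod_cast this

lemma cos_pow_secondDiff {ψ : ℝ → ℝ} {K : ℝ} (hK : 0 < K) {N : ℕ}
    (h : ∀ n : ℤ, |n| ≤ N → CircleBound K fun t => Complex.exp (Complex.I * n * ψ t)) :
    WienerBound (K ^ 4) (fun x => ((((1 + Real.cos (secondDiff ψ x)) / 2) ^ N : ℝ) : ℂ)) ∧
    (1 / (2 * K)) ^ 4 ≤ ∫ x, ((1 + Real.cos (secondDiff ψ x)) / 2) ^ N ∂torusMeas := by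
  have hU : ∀ n : ℤ, |n| ≤ N →
      WienerBound (K ^ 4) (fun x => Complex.exp (Complex.I * (n * secondDiff ψ x))) ∧
      (1 / (2 * K)) ^ 4 ≤
        (∫ x, Complex.exp (Complex.I * (n * secondDiff ψ x)) ∂torusMeas).re := by
    intro n hn
    obtain ⟨c, hs, hcK, hc, hu⟩ := h n hn
    exact exists_expansion_secondDiff hK hs hcK hc hu _ (exp_secondDiff ψ n)
  have hj : ∀ j ∈ Finset.range (2 * N + 1), |((j : ℤ) - N)| ≤ N := by
    intro j hj
    rw [Finset.mem_range] at hj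
    rw [abs_le]
    omega
  have hpos : ∀ j : ℕ, (0 : ℝ) ≤ (2 * N).choose j / 4 ^ N := fun j => by positivity
  have e : ∀ x, ((((1 + Real.cos (secondDiff ψ x)) / 2) ^ N : ℝ) : ℂ) = _ :=
    fun x => cos_pow_eq_sum N (secondDiff ψ x)
  constructor
  · simp_rw [e]
    refine (WienerBound.sum _ fun j hjm => ((hU _ (hj j hjm)).1.const_mul _)).mono (le_of_eq ?_)
    rw [← Finset.sum_mul]
    simp_rw [Complex.norm_real, Real.norm_of_nonneg (hpos _)]
    rw [sum_choose_div, one_mul]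
  · have hintegrable : ∀ j ∈ Finset.range (2 * N + 1), Integrable (fun x =>
        (((2 * N).choose j / 4 ^ N : ℝ) : ℂ) *
          Complex.exp (Complex.I * (((j : ℤ) - N : ℤ) * secondDiff ψ x))) torusMeas := by
      intro j hjm
      obtain ⟨ι, _, c, l, hexp, -⟩ := (hU _ (hj j hjm)).1
      exact hexp.integrable.const_mul _
    have h1 := integral_ofReal (μ := torusMeas) (𝕜 := ℂ)
      (f := fun x => ((1 + Real.cos (secondDiff ψ x)) / 2) ^ N)
    have h2 : ∫ x, ((1 + Real.cos (secondDiff ψ x)) / 2) ^ N ∂torusMeas =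
        (∫ x, ((((1 + Real.cos (secondDiff ψ x)) / 2) ^ N : ℝ) : ℂ) ∂torusMeas).re := by
      have h3 := congrArg Complex.re h1
      exact h3.symm
    rw [h2]
    simp_rw [e]
    rw [integral_finsetSum _ hintegrable, Complex.re_sum]
    calc (1 / (2 * K)) ^ 4
        = ∑ j ∈ Finset.range (2 * N + 1), ((2 * N).choose j / 4 ^ N : ℝ) * (1 / (2 * K)) ^ 4 := by
          rw [← Finset.sum_mul, sum_choose_div, one_mul]
      _ ≤ _ := by
          refine Finset.sum_le_sum fun j hjm => ?_
          rw [integral_const_mul, Complex.re_ofReal_mul]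
          exact mul_le_mul_of_nonneg_left (hU _ (hj j hjm)).2 (hpos j)

lemma exists_mean_bound {ψ : ℝ → ℝ} (hψ : Continuous ψ) {K : ℝ} (hK : 0 < K) {J : ℕ} (hJ : 0 < J)
    (h : ∀ n : ℤ, |n| ≤ 2 ^ J → CircleBound K fun t => Complex.exp (Complex.I * n * ψ t)) :
    ∃ m : ℝ, (1 / (2 * K)) ^ 4 ≤ m ∧
      m ≤ ∫ x, (1 + Real.cos (secondDiff ψ x)) / 2 ∂torusMeas ∧
      Real.sin (π * m) ≤ Real.exp (π * K ^ 4) * (2 * π / J) := by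
  set w : ℝ × ℝ × ℝ → ℝ := fun x => (1 + Real.cos (secondDiff ψ x)) / 2 with hw
  have hw0 : ∀ x, 0 ≤ w x := fun x => by
    have := Real.neg_one_le_cos (secondDiff ψ x)
    simp only [hw]; linarith
  have hw1 : ∀ x, w x ≤ 1 := fun x => by
    have := Real.cos_le_one (secondDiff ψ x)
    simp only [hw]; linarith
  have hwc : Continuous w := by
    have := hψ.secondDiff
    fun_prop
  have hp0 : ∀ N x, 0 ≤ w x ^ N := fun N x => pow_nonneg (hw0 x) N
  have hp1 : ∀ N x, w x ^ N ≤ 1 := fun N x => pow_le_one₀ (hw0 x) (hw1 x)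
  have hintegrable : ∀ N : ℕ, Integrable (fun x => w x ^ N) torusMeas := fun N =>
    Integrable.of_bound (hwc.pow N).aestronglyMeasurable 1
      (Eventually.of_forall fun x => by
        rw [Real.norm_of_nonneg (hp0 N x)]; exact hp1 N x)
  set I : ℕ → ℝ := fun j => ∫ x, w x ^ 2 ^ j ∂torusMeas with hI
  have hI0 : I 0 ≤ 1 := by
    calc I 0 ≤ ∫ _, (1 : ℝ) ∂torusMeas :=
          integral_mono (hintegrable _) (integrable_const _) (hp1 _)
      _ = 1 := by simp
  have hIJ : 0 ≤ I J := integral_nonneg (hp0 _)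
  obtain ⟨j, hj, hjI⟩ : ∃ j ∈ Finset.range J, I j - I (j + 1) ≤ 1 / J := by
    refine Finset.exists_le_of_sum_le (Finset.nonempty_range_iff.mpr hJ.ne') ?_
    rw [Finset.sum_range_sub', Finset.sum_const, Finset.card_range, nsmul_eq_mul,
      mul_one_div_cancel (by positivity)]
    linarith
  rw [Finset.mem_range] at hj
  have hN : ∀ n : ℤ, |n| ≤ (2 ^ j : ℕ) →
      CircleBound K fun t => Complex.exp (Complex.I * n * ψ t) := by
    intro n hn
    refine h n (hn.trans ?_)
    push_cast
    exact pow_le_pow_right₀ one_le_two hj.le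
  obtain ⟨⟨ι, _, c, l, hexp, hL⟩, hm⟩ := cos_pow_secondDiff hK hN
  refine ⟨I j, hm, integral_mono (hintegrable _) (by simpa using hintegrable 1) fun x => ?_, ?_⟩
  · exact pow_le_of_le_one (hw0 x) (hw1 x) (by positivity)
  · refine (hexp.sin_integral_le hL (hp0 _) (hp1 _)).trans ?_
    refine mul_le_mul_of_nonneg_left ?_ (Real.exp_pos _).le
    have hsub : Integrable (fun x => w x ^ 2 ^ j - w x ^ 2 ^ (j + 1)) torusMeas :=
      (hintegrable _).sub (hintegrable _)
    calc ∫ x, Real.sin (π * w x ^ 2 ^ j) ∂torusMeas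
        ≤ ∫ x, 2 * π * (w x ^ 2 ^ j - w x ^ 2 ^ (j + 1)) ∂torusMeas := by
          refine integral_mono ?_ (hsub.const_mul _) fun x => ?_
          · refine Integrable.of_bound (C := 1) ?_ (Eventually.of_forall fun x => ?_)
            · exact Continuous.aestronglyMeasurable (by fun_prop)
            · exact Real.abs_sin_le_one _
          · have := sin_pi_mul_le (hp0 (2 ^ j) x) (hp1 _ x)
            rwa [← pow_mul, ← pow_succ] at this
      _ = 2 * π * (I j - I (j + 1)) := by
          rw [integral_const_mul, integral_sub (hintegrable _) (hintegrable _)]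
      _ ≤ 2 * π * (1 / J) := mul_le_mul_of_nonneg_left hjI (by positivity)
      _ = 2 * π / J := by ring

/-- A continuous periodic function with absolutely convergent Fourier series is the sum of this
series. -/
lemma hasSum_fourierCoeffT {u : ℝ → ℂ} (hu : Continuous u) (hp : ∀ t, u (t + 2 * π) = u t)
    (hs : Summable fun k => ‖fourierCoeffT u k‖) (t : ℝ) :
    HasSum (fun k : ℤ => fourierCoeffT u k * Complex.exp (Complex.I * (k * t))) (u t) := by
  have : Fact (0 < 2 * π) := ⟨by positivity⟩
  have hper : Function.Periodic u (2 * π) := hp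
  set v : C(AddCircle (2 * π), ℂ) := ⟨hper.lift, continuous_coinduced_dom.mpr hu⟩ with hv
  have hvc : ∀ s : ℝ, v (s : AddCircle (2 * π)) = u s := fun s => hper.lift_coe s
  have hcoeff : ∀ k, fourierCoeff v k = fourierCoeffT u k := by
    intro k
    rw [fourierCoeff_eq_intervalIntegral _ _ 0, fourierCoeffT, zero_add, Complex.real_smul]
    push_cast
    congr 1
    refine intervalIntegral.integral_congr fun s _ => ?_
    simp only [smul_eq_mul]
    rw [hvc, fourier_coe_apply, mul_comm]
    congr 2
    push_cast
    field_simp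
  have hsv : Summable (fourierCoeff v) := by
    simp_rw [funext hcoeff]
    exact hs.of_norm
  have := has_pointwise_sum_fourier_series_of_summable hsv (t : AddCircle (2 * π))
  rw [hvc] at this
  convert! this using 2 with k
  rw [hcoeff, fourier_coe_apply, smul_eq_mul]
  congr 2
  push_cast
  field_simp

lemma circleBound_of_normAT {u : ℝ → ℂ} (hu : Continuous u) (hp : ∀ t, u (t + 2 * π) = u t)
    (hnorm : ∀ t, ‖u t‖ = 1) (hs : Summable fun k => ‖fourierCoeffT u k‖) {K : ℝ} (hK : 0 < K)
    (hle : normAT u ≤ K) : CircleBound K u := by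
  have hsum := hasSum_fourierCoeffT hu hp hs
  refine ⟨fourierCoeffT u, hs, hle, ?_, hsum⟩
  by_contra! hlt
  -- Parseval's identity
  have hpars : ∑' k, ‖fourierCoeffT u k‖ ^ 2 = 1 := by
    have hcoeff : ∀ k, fourierCoeffOn Real.two_pi_pos u k = fourierCoeffT u k := by
      intro k
      rw [fourierCoeffOn_eq_integral, fourierCoeffT, Complex.real_smul]
      push_cast
      rw [sub_zero]
      congr 1
      refine intervalIntegral.integral_congr fun s _ => ?_
      simp only [smul_eq_mul]
      rw [fourier_coe_apply, mul_comm]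
      congr 2
      push_cast
      field_simp
      ring
    have h2 : MemLp u 2 (volume.restrict (Set.Ioc 0 (2 * π))) :=
      MemLp.of_bound hu.aestronglyMeasurable 1 (Eventually.of_forall fun t => (hnorm t).le)
    have := tsum_sq_fourierCoeffOn Real.two_pi_pos h2
    simp_rw [hcoeff, hnorm] at this
    rw [this]
    simp
    field_simp
  have hb : ∀ k, ‖fourierCoeffT u k‖ ^ 2 ≤ 1 / (2 * K) * ‖fourierCoeffT u k‖ := fun k => by
    rw [sq]
    exact mul_le_mul_of_nonneg_right (hlt k).le (norm_nonneg _)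
  have hs2 := hs.mul_left (1 / (2 * K))
  have := (hs2.of_nonneg_of_le (fun k => sq_nonneg _) hb).tsum_le_tsum hb hs2
  rw [hpars, tsum_mul_left] at this
  have h2 : 1 / (2 * K) * ∑' k, ‖fourierCoeffT u k‖ ≤ 1 / (2 * K) * K :=
    mul_le_mul_of_nonneg_left hle (by positivity)
  have h3 : 1 / (2 * K) * K = 1 / 2 := by field_simp
  linarith

lemma eqOn_one_of_integral_torusMeas {w : ℝ × ℝ × ℝ → ℝ} (hw : Continuous w) (h1 : ∀ x, w x ≤ 1)
    (h0 : ∀ x, 0 ≤ w x) (h : 1 ≤ ∫ x, w x ∂torusMeas) :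
    Set.EqOn w (fun _ => 1) (Set.Ioc 0 (2 * π) ×ˢ Set.Ioc 0 (2 * π) ×ˢ Set.Ioc 0 (2 * π)) := by
  have hintegrable : Integrable w torusMeas :=
    Integrable.of_bound hw.aestronglyMeasurable 1 (Eventually.of_forall fun x => by
      rw [Real.norm_of_nonneg (h0 x)]; exact h1 x)
  have hz : ∫ x, (1 - w x) ∂torusMeas = 0 := by
    refine le_antisymm ?_ (integral_nonneg fun x => sub_nonneg.mpr (h1 x))
    rw [integral_sub (integrable_const _) hintegrable]
    simpa using h
  rw [integral_eq_zero_iff_of_nonneg (fun x => sub_nonneg.mpr (h1 x))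
    ((integrable_const _).sub hintegrable)] at hz
  have hc : ENNReal.ofReal (1 / (2 * π)) ≠ 0 := by
    rw [ne_eq, ENNReal.ofReal_eq_zero, not_le]
    positivity
  have hae : w =ᵐ[volume.restrict
      (Set.Ioc 0 (2 * π) ×ˢ Set.Ioc 0 (2 * π) ×ˢ Set.Ioc 0 (2 * π))] fun _ => 1 := by
    simp only [torusMeas, circleMeas, Measure.prod_smul_left, Measure.prod_smul_right,
      Measure.prod_restrict] at hz
    rw [EventuallyEq, Measure.ae_ennreal_smul_measure_iff hc,
      Measure.ae_ennreal_smul_measure_iff hc, Measure.ae_ennreal_smul_measure_iff hc] at hz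
    filter_upwards [hz] with x hx
    have : 1 - w x = 0 := hx
    linarith
  refine Measure.eqOn_of_ae_eq hae hw.continuousOn continuousOn_const ?_
  have hne : (0 : ℝ) ≠ 2 * π := Real.two_pi_pos.ne
  simp only [interior_prod_eq, closure_prod_eq, interior_Ioc, closure_Ioo hne]
  exact Set.prod_mono Set.Ioc_subset_Icc_self
    (Set.prod_mono Set.Ioc_subset_Icc_self Set.Ioc_subset_Icc_self)

/-- If the second differences of `ψ` are almost everywhere multiples of `2π` and `ψ` induces a map
of the circle, then these second differences vanish. -/
lemma secondDiff_eq_zero {ψ : ℝ → ℝ} (hψ : Continuous ψ)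
    (hper : ∀ t : ℝ, ∃ m : ℤ, ψ (t + 2 * π) - ψ t = 2 * π * m)
    (h : 1 ≤ ∫ x, (1 + Real.cos (secondDiff ψ x)) / 2 ∂torusMeas) (x : ℝ × ℝ × ℝ) :
    secondDiff ψ x = 0 := by
  have hF := hψ.secondDiff
  have hbox := eqOn_one_of_integral_torusMeas (w := fun x => (1 + Real.cos (secondDiff ψ x)) / 2)
    (by fun_prop) (fun x => by linarith [Real.cos_le_one (secondDiff ψ x)])
    (fun x => by linarith [Real.neg_one_le_cos (secondDiff ψ x)]) h
  have hu : Function.Periodic (fun t => Complex.exp (Complex.I * (1 : ℤ) * ψ t)) (2 * π) := by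
    intro t
    obtain ⟨m, hm⟩ := hper t
    have : ψ (t + 2 * π) = ψ t + 2 * π * m := by linarith
    simp only [this]
    rw [Complex.exp_eq_exp_iff_exists_int]
    exact ⟨m, by push_cast; ring⟩
  have hmem : ∀ x, secondDiff ψ x ∈ AddSubgroup.zmultiples (2 * π) := by
    rintro ⟨a, b, c⟩
    have hp := Real.two_pi_pos
    obtain ⟨a', ha', hA⟩ : ∃ a' ∈ Set.Ioc 0 (2 * π), ∃ n : ℤ, a = a' + n * (2 * π) := by
      refine ⟨toIocMod hp 0 a, by simpa using toIocMod_mem_Ioc hp 0 a, toIocDiv hp 0 a, ?_⟩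
      have := toIocMod_add_toIocDiv_zsmul hp 0 a
      rw [zsmul_eq_mul] at this
      exact this.symm
    obtain ⟨b', hb', hB⟩ : ∃ a' ∈ Set.Ioc 0 (2 * π), ∃ n : ℤ, b = a' + n * (2 * π) := by
      refine ⟨toIocMod hp 0 b, by simpa using toIocMod_mem_Ioc hp 0 b, toIocDiv hp 0 b, ?_⟩
      have := toIocMod_add_toIocDiv_zsmul hp 0 b
      rw [zsmul_eq_mul] at this
      exact this.symm
    obtain ⟨c', hc', hC⟩ : ∃ a' ∈ Set.Ioc 0 (2 * π), ∃ n : ℤ, c = a' + n * (2 * π) := by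
      refine ⟨toIocMod hp 0 c, by simpa using toIocMod_mem_Ioc hp 0 c, toIocDiv hp 0 c, ?_⟩
      have := toIocMod_add_toIocDiv_zsmul hp 0 c
      rw [zsmul_eq_mul] at this
      exact this.symm
    obtain ⟨p, rfl⟩ := hA
    obtain ⟨q, rfl⟩ := hB
    obtain ⟨r, rfl⟩ := hC
    have h1 := hbox (Set.mk_mem_prod ha' (Set.mk_mem_prod hb' hc'))
    have h2 : Real.cos (secondDiff ψ (a', b', c')) = 1 := by
      simp only at h1
      linarith
    have shift : ∀ (t s : ℝ) (n : ℤ), s = t + n * (2 * π) →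
        Complex.exp (Complex.I * (1 : ℤ) * ψ s) = Complex.exp (Complex.I * (1 : ℤ) * ψ t) := by
      rintro t s n rfl
      exact hu.int_mul n t
    have h3 : Complex.exp (Complex.I * ((1 : ℤ) *
        secondDiff ψ (a' + p * (2 * π), b' + q * (2 * π), c' + r * (2 * π)))) =
        Complex.exp (Complex.I * ((1 : ℤ) * secondDiff ψ (a', b', c'))) := by
      simp only [exp_secondDiff]
      rw [shift a' (a' + p * (2 * π)) p rfl,
        shift (a' + b') (a' + p * (2 * π) + (b' + q * (2 * π))) (p + q) (by push_cast; ring),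
        shift (a' + c') (a' + p * (2 * π) + (c' + r * (2 * π))) (p + r) (by push_cast; ring),
        shift (a' + b' + c') (a' + p * (2 * π) + (b' + q * (2 * π)) + (c' + r * (2 * π)))
          (p + q + r) (by push_cast; ring)]
    obtain ⟨k, hk⟩ := (Real.cos_eq_one_iff _).mp h2
    rw [Complex.exp_eq_exp_iff_exists_int] at h3
    obtain ⟨n, hn⟩ := h3
    refine AddSubgroup.mem_zmultiples_iff.mpr ⟨k + n, ?_⟩
    rw [zsmul_eq_mul]
    push_cast
    rw [add_mul, hk]
    have h4 : Complex.I * (((1 : ℤ) *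
        secondDiff ψ (a' + p * (2 * π), b' + q * (2 * π), c' + r * (2 * π)) : ℂ)) =
        Complex.I * ((secondDiff ψ (a', b', c') + n * (2 * π) : ℝ) : ℂ) := by
      rw [hn]
      push_cast
      ring
    have h5 := mul_left_cancel₀ Complex.I_ne_zero h4
    rw [Int.cast_one, one_mul] at h5
    exact (Complex.ofReal_injective h5).symm
  have hconst : secondDiff ψ x = secondDiff ψ (x.1, 0, 0) :=
    isPreconnected_univ.constant_of_mapsTo
      (T := (AddSubgroup.zmultiples (2 * π) : Set ℝ)) 
      ⟨inferInstanceAs (DiscreteTopology (AddSubgroup.zmultiples (2 * π)))⟩ hF.continuousOn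
      (fun y _ => hmem y) (Set.mem_univ _) (Set.mem_univ _)
  rw [hconst]
  simp [secondDiff]

lemma exists_slope_of_secondDiff {φ : ℝ → ℝ} (hφ : Continuous φ)
    (hper : ∀ t : ℝ, ∃ m : ℤ, φ (t + 2 * π) - φ t = 2 * π * m)
    (h : ∀ x, secondDiff φ x = 0) : ∃ ν : ℤ, ∀ t : ℝ, φ t = ν * t + φ 0 := by
  let g : ℝ →+ ℝ := AddMonoidHom.mk' (fun t => φ t - φ 0) fun a b => by
    have := h (0, a, b)
    simp only [secondDiff, zero_add] at this
    linarith
  have hg : Continuous g := hφ.sub continuous_const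
  have hlin : ∀ t, φ t - φ 0 = t * (φ 1 - φ 0) := fun t => by
    have := map_real_smul g hg t 1
    simpa [g] using this
  obtain ⟨m, hm⟩ := hper 0
  refine ⟨m, fun t => ?_⟩
  have h1 := hlin (2 * π)
  rw [zero_add] at hm
  rw [hm] at h1
  have h2 : (m : ℝ) = φ 1 - φ 0 := mul_left_cancel₀ Real.two_pi_pos.ne' h1
  have := hlin t
  rw [h2]
  linarith

lemma exp_mul_div_lt {K J : ℝ} (hK : 3 ≤ K) (hJ : Real.exp (K ^ 12) / 2 ≤ J) :
    Real.exp (π * K ^ 4) * (2 * π / J) < 2 * (1 / (2 * K)) ^ 4 := by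
  set x := K ^ 4 with hx
  have hx81 : 81 ≤ x := by
    calc (81 : ℝ) = 3 ^ 4 := by norm_num
      _ ≤ K ^ 4 := pow_le_pow_left₀ (by norm_num) hK 4
  have hx3 : K ^ 12 = x ^ 3 := by rw [hx]; ring
  have hxpos : 0 < x := by linarith
  have hJpos : 0 < J := lt_of_lt_of_le (by positivity) hJ
  have hrhs : 2 * (1 / (2 * K)) ^ 4 = 1 / (8 * x) := by
    rw [hx]
    field_simp
    norm_num
  rw [hrhs, ← mul_div_assoc, div_lt_div_iff₀ hJpos (by positivity), one_mul]
  refine lt_of_lt_of_le ?_ hJ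
  rw [hx3]
  have hpi4 : π ≤ 4 := Real.pi_le_four
  have h1 : π * x + (x + 4 * x) ≤ x ^ 3 := by nlinarith [mul_pos hxpos hxpos]
  have h2 : Real.exp (π * x) * (Real.exp x * Real.exp (4 * x)) ≤ Real.exp (x ^ 3) := by
    rw [← Real.exp_add, ← Real.exp_add]
    exact Real.exp_le_exp.mpr h1
  have h3 := Real.add_one_le_exp x
  have h4 := Real.add_one_le_exp (4 * x)
  have h5 : x * (4 * x) < Real.exp x * Real.exp (4 * x) := by
    apply mul_lt_mul'' <;> linarith
  have h6 : 2 * π * (8 * x) * 2 ≤ x * (4 * x) := by nlinarith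
  have h7 := mul_lt_mul_of_pos_left (h6.trans_lt h5) (Real.exp_pos (π * x))
  linarith

lemma exists_normAT_bound {φ : ℝ → ℝ}
    (hsum : ∃ n₀ : ℤ, ∀ n : ℤ, n₀ ≤ |n| →
      Summable fun k : ℤ =>
        ‖fourierCoeffT (fun t : ℝ => Complex.exp (Complex.I * (n : ℂ) * (φ t : ℂ))) k‖)
    (hdecay : Tendsto
      (fun n : ℤ =>
        normAT (fun t : ℝ => Complex.exp (Complex.I * (n : ℂ) * (φ t : ℂ))) *
          (Real.log (Real.log (Real.log |(n : ℝ)|)) /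
            Real.log (Real.log |(n : ℝ)|)) ^ ((1 : ℝ) / 12))
      cofinite (nhds 0)) :
    ∃ q : ℕ, 2 ≤ q ∧ ∀ n : ℤ, (q : ℤ) ≤ |n| →
      (Summable fun k : ℤ =>
        ‖fourierCoeffT (fun t : ℝ => Complex.exp (Complex.I * (n : ℂ) * (φ t : ℂ))) k‖) ∧
      normAT (fun t : ℝ => Complex.exp (Complex.I * (n : ℂ) * (φ t : ℂ))) ^ 12 ≤
        Real.log (Real.log |(n : ℝ)|) := by
  obtain ⟨n₀, hn₀⟩ := hsum
  have hev := hdecay.eventually (gt_mem_nhds (zero_lt_one : (0 : ℝ) < 1))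
  rw [Int.cofinite_eq, eventually_sup, eventually_atBot, eventually_atTop] at hev
  obtain ⟨⟨A, hA⟩, B, hB⟩ := hev
  obtain ⟨T, hT⟩ := exists_nat_ge (Real.exp (Real.exp (Real.exp 1)))
  refine ⟨2 + n₀.natAbs + A.natAbs + B.natAbs + T, by omega, fun n hn => ⟨hn₀ n (by omega), ?_⟩⟩
  have hlt : normAT (fun t : ℝ => Complex.exp (Complex.I * (n : ℂ) * (φ t : ℂ))) *
      (Real.log (Real.log (Real.log |(n : ℝ)|)) /
        Real.log (Real.log |(n : ℝ)|)) ^ ((1 : ℝ) / 12) < 1 := by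
    rcases le_or_gt 0 n with h | h
    · rw [abs_of_nonneg h] at hn
      exact hB n (by omega)
    · rw [abs_of_neg h] at hn
      exact hA n (by omega)
  have hnT : Real.exp (Real.exp (Real.exp 1)) ≤ |(n : ℝ)| := by
    have h1 : (T : ℤ) ≤ |n| := by omega
    refine hT.trans ?_
    exact_mod_cast h1
  set Y := normAT (fun t : ℝ => Complex.exp (Complex.I * (n : ℂ) * (φ t : ℂ))) with hY
  have hY0 : 0 ≤ Y := tsum_nonneg fun _ => norm_nonneg _
  have l1 : Real.exp (Real.exp 1) ≤ Real.log |(n : ℝ)| :=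
    (Real.le_log_iff_exp_le ((Real.exp_pos _).trans_le hnT)).mpr hnT
  have l2 : Real.exp 1 ≤ Real.log (Real.log |(n : ℝ)|) :=
    (Real.le_log_iff_exp_le ((Real.exp_pos _).trans_le l1)).mpr l1
  have l3 : 1 ≤ Real.log (Real.log (Real.log |(n : ℝ)|)) :=
    (Real.le_log_iff_exp_le ((Real.exp_pos _).trans_le l2)).mpr l2
  set b := Real.log (Real.log |(n : ℝ)|) with hb
  have hb0 : 0 < b := (Real.exp_pos _).trans_le l2
  have h1 : Y * (1 / b) ^ ((1 : ℝ) / 12) < 1 := by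
    refine lt_of_le_of_lt (mul_le_mul_of_nonneg_left ?_ hY0) hlt
    refine Real.rpow_le_rpow (by positivity) ?_ (by norm_num)
    exact div_le_div_of_nonneg_right l3 hb0.le
  have h2 : (Y * (1 / b) ^ ((1 : ℝ) / 12)) ^ 12 ≤ 1 :=
    pow_le_one₀ (mul_nonneg hY0 (Real.rpow_nonneg (by positivity) _)) h1.le
  rw [mul_pow, ← Real.rpow_natCast ((1 / b) ^ ((1 : ℝ) / 12)) 12,
    ← Real.rpow_mul (by positivity)] at h2
  norm_num at h2
  rwa [← div_eq_mul_inv, div_le_one hb0] at h2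

theorem beurling_helson_improvement
    (φ : ℝ → ℝ) (hcont : Continuous φ)
    (hper : ∀ t : ℝ, ∃ m : ℤ, φ (t + 2 * π) - φ t = 2 * π * m)
    (hsum : ∃ n₀ : ℤ, ∀ n : ℤ, n₀ ≤ |n| →
      Summable fun k : ℤ =>
        ‖fourierCoeffT (fun t : ℝ => Complex.exp (Complex.I * (n : ℂ) * (φ t : ℂ))) k‖)
    (hdecay : Tendsto
      (fun n : ℤ =>
        normAT (fun t : ℝ => Complex.exp (Complex.I * (n : ℂ) * (φ t : ℂ))) *
          (Real.log (Real.log (Real.log |(n : ℝ)|)) /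
            Real.log (Real.log |(n : ℝ)|)) ^ ((1 : ℝ) / 12))
      cofinite (nhds 0)) :
    ∃ ν : ℤ, ∀ t : ℝ, φ t = ν * t + φ 0 := by
  obtain ⟨q, hq2, hq⟩ := exists_normAT_bound hsum hdecay
  have hq0 : (0 : ℝ) < q := by positivity
  set ψ : ℝ → ℝ := fun t => q * φ t with hψ
  have hψc : Continuous ψ := continuous_const.mul hcont
  have hψper : ∀ t : ℝ, ∃ m : ℤ, ψ (t + 2 * π) - ψ t = 2 * π * m := fun t => by
    obtain ⟨m, hm⟩ := hper t
    refine ⟨q * m, ?_⟩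
    simp only [hψ]
    rw [← mul_sub, hm]
    push_cast
    ring
  have hψφ : ∀ x, secondDiff ψ x = q * secondDiff φ x := fun x => by
    simp only [secondDiff, hψ]
    ring
  set W := ∫ x, (1 + Real.cos (secondDiff ψ x)) / 2 ∂torusMeas with hW
  -- The mean of `(1 + cos (secondDiff ψ)) / 2` is close to `1`.
  have hbound : ∀ᶠ K : ℕ in atTop, 1 - (1 / (2 * (K : ℝ))) ^ 4 ≤ W := by
    have h12 : Tendsto (fun K : ℕ => Real.exp ((K : ℝ) ^ 12)) atTop atTop :=
      Real.tendsto_exp_atTop.comp ((tendsto_pow_atTop (by norm_num)).comp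
        tendsto_natCast_atTop_atTop)
    filter_upwards [eventually_ge_atTop 3, h12.eventually_ge_atTop (Real.log q / 0.3),
      h12.eventually_ge_atTop 2] with K hK3 hKq hKe
    have hK3' : (3 : ℝ) ≤ K := by exact_mod_cast hK3
    set J : ℕ := ⌊Real.exp ((K : ℝ) ^ 12)⌋₊ with hJ
    have hJle : (J : ℝ) ≤ Real.exp ((K : ℝ) ^ 12) := Nat.floor_le (Real.exp_pos _).le
    have hJge : Real.exp ((K : ℝ) ^ 12) / 2 ≤ J := by
      have := Nat.lt_floor_add_one (Real.exp ((K : ℝ) ^ 12))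
      linarith
    have hJpos : 0 < J := by
      have : (0 : ℝ) < J := by linarith
      exact_mod_cast this
    have hcirc : ∀ n : ℤ, |n| ≤ 2 ^ J →
        CircleBound K fun t => Complex.exp (Complex.I * n * ψ t) := by
      intro n hn
      rcases eq_or_ne n 0 with rfl | hn0
      · simpa using circleBound_one (K := K) (by linarith)
      have he : (fun t => Complex.exp (Complex.I * n * ψ t)) =
          fun t => Complex.exp (Complex.I * ((q * n : ℤ) : ℂ) * φ t) := by
        funext t
        congr 1
        simp only [hψ]
        push_cast
        ring
      have habs : |(q * n : ℤ)| = q * |n| := by rw [abs_mul, Nat.abs_cast]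
      have hqn : (q : ℤ) ≤ |(q * n : ℤ)| := by
        rw [habs]
        exact le_mul_of_one_le_right (by positivity) (Int.one_le_abs hn0)
      obtain ⟨hs, hnorm⟩ := hq _ hqn
      rw [he]
      have hqn' : (q : ℝ) ≤ |((q * n : ℤ) : ℝ)| := by exact_mod_cast hqn
      have hup : |((q * n : ℤ) : ℝ)| ≤ q * 2 ^ J := by
        have : |(q * n : ℤ)| ≤ q * 2 ^ J := by
          rw [habs]
          exact mul_le_mul_of_nonneg_left hn (by positivity)
        exact_mod_cast this
      have hq1 : (1 : ℝ) < q := by exact_mod_cast hq2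
      have hlog : Real.log |((q * n : ℤ) : ℝ)| ≤ Real.exp ((K : ℝ) ^ 12) := by
        refine (Real.log_le_log (hq0.trans_le hqn') hup).trans ?_
        rw [Real.log_mul hq0.ne' (by positivity), Real.log_pow]
        have h2 := Real.log_two_lt_d9
        rw [div_le_iff₀ (by norm_num)] at hKq
        nlinarith [Real.log_pos one_lt_two]
      have hll : Real.log (Real.log |((q * n : ℤ) : ℝ)|) ≤ (K : ℝ) ^ 12 :=
        (Real.log_le_iff_le_exp (Real.log_pos (hq1.trans_le hqn'))).mpr hlog
      refine circleBound_of_normAT (by fun_prop) (fun t => ?_) (fun t => ?_) hs (by linarith)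
        (le_of_pow_le_pow_left₀ (by norm_num) (by linarith) (hnorm.trans hll))
      · obtain ⟨m, hm⟩ := hper t
        have : φ (t + 2 * π) = φ t + 2 * π * m := by linarith
        rw [this, Complex.exp_eq_exp_iff_exists_int]
        exact ⟨q * n * m, by push_cast; ring⟩
      · have : Complex.I * ((q * n : ℤ) : ℂ) * φ t = (((q * n : ℤ) * φ t : ℝ) : ℂ) * Complex.I := by
          push_cast
          ring
        rw [this, Complex.norm_exp_ofReal_mul_I]
    obtain ⟨m, hm, hmW, hsin⟩ := exists_mean_bound hψc (by linarith) hJpos hcirc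
    have hW1 : W ≤ 1 := by
      have hF := hψc.secondDiff
      have hc : Integrable (fun x => (1 + Real.cos (secondDiff ψ x)) / 2) torusMeas :=
        Integrable.of_bound (Continuous.aestronglyMeasurable (by fun_prop)) 1
          (Eventually.of_forall fun x => by
            have h1 := Real.cos_le_one (secondDiff ψ x)
            have h2 := Real.neg_one_le_cos (secondDiff ψ x)
            rw [Real.norm_eq_abs, abs_le]
            constructor <;> linarith)
      calc W ≤ ∫ _, (1 : ℝ) ∂torusMeas := integral_mono hc (integrable_const _) fun x => by
            linarith [Real.cos_le_one (secondDiff ψ x)]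
        _ = 1 := by simp
    have hm0 : 0 ≤ m := le_trans (by positivity) hm
    have h1 := (le_sin_pi_mul hm0 (hmW.trans hW1)).trans_lt
      (hsin.trans_lt (exp_mul_div_lt hK3' hJge))
    rcases min_lt_iff.mp (lt_of_mul_lt_mul_left h1 zero_le_two) with h2 | h2
    · exact absurd h2 (not_lt.mpr hm)
    · linarith
  have hlim : Tendsto (fun K : ℕ => 1 - (1 / (2 * (K : ℝ))) ^ 4) atTop (nhds 1) := by
    have h1 : Tendsto (fun K : ℕ => 1 / (2 * (K : ℝ))) atTop (nhds 0) :=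
      tendsto_const_nhds.div_atTop (tendsto_natCast_atTop_atTop.const_mul_atTop two_pos)
    simpa using (h1.pow 4).const_sub 1
  have hW1 : 1 ≤ W := le_of_tendsto hlim hbound
  refine exists_slope_of_secondDiff hcont hper fun x => ?_
  have := secondDiff_eq_zero hψc hψper hW1 x
  rw [hψφ] at this
  exact (mul_eq_zero.mp this).resolve_left hq0.ne'
end

section
/- Let S: l¹(ℤ) → l¹(ℤ) denote the shift operator (Sx)_k = x_{k−1}. Let U: l¹(ℤ) → l¹(ℤ) be an invertible bounded linear operator that commutes with S (i.e., U is translation invariant), and suppose that ‖Uⁿ‖_{l¹→l¹} · (log log log |n| / log log |n|)^{1/12} → 0 as |n| → ∞, n ∈ ℤ (where Uⁿ for negative n means powers of U⁻¹). Then there exist ξ ∈ ℂ with |ξ| = 1 and ν ∈ ℤ such that U = ξ Sᵛ, i.e., U is a unimodular scalar multiple of a translation. -/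
open Complex Filter
open scoped ENNReal

lemma memℓp_shift (x : lp (fun _ : ℤ => ℂ) 1) :
    Memℓp (fun k : ℤ => x (k - 1)) (1 : ℝ≥0∞) := by
  apply memℓp_gen
  have hx : Summable fun k : ℤ => ‖x k‖ ^ (1 : ℝ≥0∞).toReal := by
    rw [← memℓp_gen_iff (by norm_num : (0:ℝ) < (1 : ℝ≥0∞).toReal)]
    exact lp.memℓp x
  have h := (Equiv.summable_iff (Equiv.subRight (1 : ℤ))
    (f := fun k : ℤ => ‖x k‖ ^ (1 : ℝ≥0∞).toReal)).2 hx
  simpa [Function.comp_def] using h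

/-- The shift operator `(Sx)ₖ = x_{k-1}` on `ℓ¹(ℤ)`. -/
noncomputable def shiftL1 : lp (fun _ : ℤ => ℂ) 1 →L[ℂ] lp (fun _ : ℤ => ℂ) 1 :=
  LinearMap.mkContinuous
    { toFun := fun x => (⟨fun k => x (k - 1), memℓp_shift x⟩ : lp (fun _ : ℤ => ℂ) 1)
      map_add' := fun x y => by ext k; rfl
      map_smul' := fun c x => by ext k; rfl }
    1
    (fun x => by
      have h1 : (0:ℝ) < (1 : ℝ≥0∞).toReal := by norm_num
      rw [lp.norm_eq_tsum_rpow h1, lp.norm_eq_tsum_rpow h1, one_mul]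
      have h := Equiv.tsum_eq (Equiv.subRight (1 : ℤ))
        (f := fun k : ℤ => ‖x k‖ ^ (1 : ℝ≥0∞).toReal)
      simp only [Equiv.subRight_apply] at h
      apply le_of_eq
      congr 1)

namespace BeurlingHelson

section Gibbs

variable {G : Type*} [AddCommGroup G]

/-- The total deviation from `1` at `y` of a finite set of characters. -/
noncomputable def dev (Γ : Finset (AddChar G Circle)) (y : G) : ℝ :=
  ∑ γ ∈ Γ, ‖1 - (γ y : ℂ)‖

lemma dev_nonneg (Γ : Finset (AddChar G Circle)) (y : G) : 0 ≤ dev Γ y :=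
  Finset.sum_nonneg fun _ _ => norm_nonneg _

lemma norm_one_sub_add_le (γ : AddChar G Circle) (y z : G) :
    ‖1 - (γ (y + z) : ℂ)‖ ≤ ‖1 - (γ y : ℂ)‖ + ‖1 - (γ z : ℂ)‖ := by
  have h : (1 : ℂ) - γ (y + z) = (1 - γ y) + γ y * (1 - γ z) := by
    rw [AddChar.map_add_eq_mul]; push_cast; ring
  rw [h]
  refine (norm_add_le _ _).trans ?_
  rw [norm_mul, Circle.norm_coe, one_mul]

lemma norm_one_sub_inv (z : Circle) : ‖(1 : ℂ) - ((z⁻¹ : Circle) : ℂ)‖ = ‖1 - (z : ℂ)‖ := by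
  have h : (1 : ℂ) - ((z⁻¹ : Circle) : ℂ) = -(((z⁻¹ : Circle) : ℂ) * (1 - z)) := by
    rw [mul_sub, ← Circle.coe_mul]; simp
  rw [h, norm_neg, norm_mul, Circle.norm_coe, one_mul]

lemma norm_one_sub_div_le (z w : Circle) :
    ‖(1 : ℂ) - ((z / w : Circle) : ℂ)‖ ≤ ‖1 - (z : ℂ)‖ + ‖1 - (w : ℂ)‖ := by
  have h : (1 : ℂ) - ((z / w : Circle) : ℂ) =
      (1 - (z : ℂ)) + z * (1 - ((w⁻¹ : Circle) : ℂ)) := by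
    rw [div_eq_mul_inv]; push_cast; ring
  rw [h]
  refine (norm_add_le _ _).trans ?_
  rw [norm_mul, norm_one_sub_inv, Circle.norm_coe, one_mul]

lemma dev_add_le (Γ : Finset (AddChar G Circle)) (y z : G) :
    dev Γ (y + z) ≤ dev Γ y + dev Γ z := by
  unfold dev
  rw [← Finset.sum_add_distrib]
  exact Finset.sum_le_sum fun γ _ => norm_one_sub_add_le γ y z

lemma dev_neg (Γ : Finset (AddChar G Circle)) (y : G) : dev Γ (-y) = dev Γ y := by
  unfold dev
  refine Finset.sum_congr rfl fun γ _ => ?_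
  rw [AddChar.map_neg_eq_inv, norm_one_sub_inv]

variable [Fintype G]

/-- The Gibbs probability weight on `G` with energy `dev Γ` at inverse temperature `b`. -/
noncomputable def gibbs (Γ : Finset (AddChar G Circle)) (b : ℝ) (y : G) : ℝ :=
  Real.exp (-(b * dev Γ y)) / ∑ z, Real.exp (-(b * dev Γ z))

lemma partition_pos (Γ : Finset (AddChar G Circle)) (b : ℝ) :
    0 < ∑ z : G, Real.exp (-(b * dev Γ z)) :=
  Finset.sum_pos (fun _ _ => Real.exp_pos _) Finset.univ_nonempty

lemma gibbs_nonneg (Γ : Finset (AddChar G Circle)) (b : ℝ) (y : G) : 0 ≤ gibbs Γ b y :=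
  div_nonneg (Real.exp_pos _).le (partition_pos Γ b).le

lemma sum_gibbs (Γ : Finset (AddChar G Circle)) (b : ℝ) : ∑ y : G, gibbs Γ b y = 1 := by
  unfold gibbs
  rw [← Finset.sum_div, div_self (partition_pos Γ b).ne']

lemma gibbs_add_le (Γ : Finset (AddChar G Circle)) {b : ℝ} (hb : 0 ≤ b) (y z : G) :
    gibbs Γ b (y + z) ≤ Real.exp (b * dev Γ z) * gibbs Γ b y := by
  unfold gibbs
  rw [← mul_div_assoc, ← Real.exp_add]
  refine div_le_div_of_nonneg_right ?_ (partition_pos Γ b).le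
  apply Real.exp_le_exp.2
  have := dev_add_le Γ (y + z) (-z)
  rw [dev_neg, add_neg_cancel_right] at this
  nlinarith

lemma sum_abs_gibbs_sub_le (Γ : Finset (AddChar G Circle)) {b : ℝ} (hb : 0 ≤ b) (z : G) :
    ∑ y, |gibbs Γ b (y + z) - gibbs Γ b y| ≤ Real.exp (b * dev Γ z) - 1 := by
  have key : ∀ y, |gibbs Γ b (y + z) - gibbs Γ b y| ≤
      (Real.exp (b * dev Γ z) - 1) * gibbs Γ b y := by
    intro y
    have h1 := gibbs_add_le Γ hb y z
    have h2 := gibbs_add_le Γ hb (y + z) (-z)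
    rw [dev_neg, add_neg_cancel_right] at h2
    have h0 := gibbs_nonneg Γ b y
    have ht : 1 ≤ Real.exp (b * dev Γ z) := Real.one_le_exp (mul_nonneg hb (dev_nonneg Γ z))
    set t := Real.exp (b * dev Γ z)
    rw [abs_le]
    refine ⟨?_, by linarith⟩
    by_cases h : gibbs Γ b y ≤ gibbs Γ b (y + z)
    · nlinarith
    · nlinarith
  calc _ ≤ ∑ y, (Real.exp (b * dev Γ z) - 1) * gibbs Γ b y := Finset.sum_le_sum fun y _ => key y
    _ = _ := by rw [← Finset.mul_sum, sum_gibbs, mul_one]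

/-- The Fourier coefficient of a real weight at a character. -/
noncomputable def coef (β : G → ℝ) (χ : AddChar G Circle) : ℂ := ∑ y, (β y : ℂ) * χ y

lemma norm_one_sub_mul_coef_le (Γ : Finset (AddChar G Circle)) {b : ℝ} (hb : 0 ≤ b)
    (χ : AddChar G Circle) (z : G) :
    ‖1 - (χ z : ℂ)‖ * ‖coef (gibbs Γ b) χ‖ ≤ Real.exp (b * dev Γ z) - 1 := by
  have h : (1 - (χ z : ℂ)) * coef (gibbs Γ b) χ =
      ∑ y, ((gibbs Γ b (y + z) - gibbs Γ b y : ℝ) : ℂ) * χ (y + z) := by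
    have h1 : coef (gibbs Γ b) χ = ∑ y, (gibbs Γ b (y + z) : ℂ) * χ (y + z) :=
      (Equiv.sum_comp (Equiv.addRight z) fun y => (gibbs Γ b y : ℂ) * χ y).symm
    rw [sub_mul, one_mul]
    nth_rewrite 1 [h1]
    rw [coef, Finset.mul_sum, ← Finset.sum_sub_distrib]
    refine Finset.sum_congr rfl fun y _ => ?_
    rw [AddChar.map_add_eq_mul]; push_cast; ring
  rw [← norm_mul, h]
  refine (norm_sum_le _ _).trans (le_trans (le_of_eq ?_) (sum_abs_gibbs_sub_le Γ hb z))
  refine Finset.sum_congr rfl fun y _ => ?_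
  rw [norm_mul, Complex.norm_real, Circle.norm_coe, mul_one, Real.norm_eq_abs]

lemma norm_coef_le_one (Γ : Finset (AddChar G Circle)) (b : ℝ) (χ : AddChar G Circle) :
    ‖coef (gibbs Γ b) χ‖ ≤ 1 := by
  refine (norm_sum_le _ _).trans (le_of_eq ?_)
  rw [← sum_gibbs Γ b]
  refine Finset.sum_congr rfl fun y _ => ?_
  rw [norm_mul, Complex.norm_real, Circle.norm_coe, mul_one, Real.norm_eq_abs,
    abs_of_nonneg (gibbs_nonneg Γ b y)]

/-- Many points of `G` are close to the common kernel of a finite set of characters. -/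
lemma card_le_mul_card_near (Γ : Finset (AddChar G Circle)) {n : ℕ} (hn : 0 < n) :
    Fintype.card G ≤ ((2 * n + 1) ^ 2) ^ Γ.card *
      (Finset.univ.filter fun y : G => ∀ γ ∈ Γ, ‖1 - (γ y : ℂ)‖ ≤ 2 / n).card := by
  classical
  set B := Finset.univ.filter fun y : G => ∀ γ ∈ Γ, ‖1 - (γ y : ℂ)‖ ≤ 2 / n with hB
  let cell : G → (Γ → ℤ × ℤ) := fun y γ => (⌊(n : ℝ) * (γ.1 y : ℂ).re⌋, ⌊(n : ℝ) * (γ.1 y : ℂ).im⌋)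
  let T : Finset (Γ → ℤ × ℤ) := Fintype.piFinset fun _ =>
    Finset.Icc (-(n : ℤ)) n ×ˢ Finset.Icc (-(n : ℤ)) n
  have hT : T.card = ((2 * n + 1) ^ 2) ^ Γ.card := by
    simp only [T, Fintype.card_piFinset, Finset.card_product, Int.card_Icc, Finset.prod_const,
      Finset.card_univ, Fintype.card_coe]
    have : ((n : ℤ) + 1 - -(n : ℤ)).toNat = 2 * n + 1 := by omega
    rw [this, sq]
  have hn' : (0 : ℝ) < n := by exact_mod_cast hn
  have hfl : ∀ t : ℝ, |t| ≤ 1 → ⌊(n : ℝ) * t⌋ ∈ Finset.Icc (-(n : ℤ)) n := by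
    intro t ht
    rw [abs_le] at ht
    rw [Finset.mem_Icc]
    constructor
    · apply Int.le_floor.2; push_cast; nlinarith
    · have := Int.floor_le ((n : ℝ) * t)
      have h2 : (⌊(n : ℝ) * t⌋ : ℝ) ≤ ((n : ℤ) : ℝ) := by push_cast; nlinarith
      exact_mod_cast h2
  have hmaps : ∀ y ∈ (Finset.univ : Finset G), cell y ∈ T := by
    intro y _
    simp only [T, Fintype.mem_piFinset, Finset.mem_product, cell]
    intro γ
    exact ⟨hfl _ ((Complex.abs_re_le_norm _).trans (Circle.norm_coe _).le),
      hfl _ ((Complex.abs_im_le_norm _).trans (Circle.norm_coe _).le)⟩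
  have hclose : ∀ s t : ℝ, ⌊(n : ℝ) * s⌋ = ⌊(n : ℝ) * t⌋ → |s - t| ≤ 1 / n := by
    intro s t h
    have := Int.abs_sub_lt_one_of_floor_eq_floor h
    rw [← mul_sub, abs_mul, abs_of_pos hn'] at this
    rw [le_div_iff₀ hn']; linarith
  rw [← hT, ← Finset.card_univ]
  refine Finset.card_le_mul_card_image_of_maps_to hmaps B.card ?_ |>.trans (le_of_eq (mul_comm _ _))
  intro a _
  rcases (Finset.univ.filter fun y => cell y = a).eq_empty_or_nonempty with h | ⟨y₀, hy₀⟩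
  · simp [h]
  · apply Finset.card_le_card_of_injOn (fun y => y - y₀)
    · intro y hy
      simp only [Finset.coe_filter, Finset.mem_univ, true_and, Set.mem_ofPred_eq,
        Finset.mem_filter] at hy hy₀
      simp only [hB, Finset.coe_filter, Finset.mem_univ, true_and, Set.mem_ofPred_eq]
      intro γ hγ
      have h : cell y ⟨γ, hγ⟩ = cell y₀ ⟨γ, hγ⟩ := by rw [hy, hy₀]
      simp only [cell, Prod.mk.injEq] at h
      have e : (1 : ℂ) - γ (y - y₀) = ((γ y₀)⁻¹ : Circle) * ((γ y₀ : ℂ) - γ y) := by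
        rw [AddChar.map_sub_eq_div, div_eq_mul_inv, mul_sub, ← Circle.coe_mul]
        push_cast
        simp [mul_comm]
      rw [e, norm_mul, Circle.norm_coe, one_mul, norm_sub_rev]
      refine (Complex.norm_le_abs_re_add_abs_im _).trans ?_
      rw [Complex.sub_re, Complex.sub_im]
      have h1 := hclose _ _ h.1
      have h2 := hclose _ _ h.2
      calc _ ≤ 1 / (n : ℝ) + 1 / n := add_le_add h1 h2
        _ = 2 / n := by ring
    · intro x _ y _ h
      simpa using h

/-- At low temperature the Gibbs weight is concentrated on points of small energy. -/
lemma sum_gibbs_filter_le (Γ : Finset (AddChar G Circle)) {b R : ℝ} (hb : 0 ≤ b)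
    {d n : ℕ} (hd : Γ.card ≤ d) (hn : 0 < n) (hR : 4 * d ≤ R * n) :
    ∑ y with R < dev Γ y, gibbs Γ b y ≤ (2 * n + 1) ^ (2 * d) * Real.exp (-(b * R / 2)) := by
  classical
  have hn' : (0 : ℝ) < n := by exact_mod_cast hn
  set B := Finset.univ.filter fun y : G => ∀ γ ∈ Γ, ‖1 - (γ y : ℂ)‖ ≤ 2 / n with hB
  have hBdev : ∀ y ∈ B, dev Γ y ≤ R / 2 := by
    intro y hy
    simp only [hB, Finset.mem_filter, Finset.mem_univ, true_and] at hy
    calc dev Γ y ≤ ∑ γ ∈ Γ, 2 / (n : ℝ) := Finset.sum_le_sum hy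
      _ = Γ.card * (2 / n) := by simp
      _ ≤ d * (2 / n) := by gcongr
      _ ≤ R / 2 := by rw [← mul_div_assoc, div_le_iff₀ hn']; linarith
  have hcard := card_le_mul_card_near Γ hn
  rw [← hB] at hcard
  have hM : (Fintype.card G : ℝ) ≤ (2 * n + 1) ^ (2 * d) * B.card := by
    calc (Fintype.card G : ℝ) ≤ ((2 * n + 1) ^ 2) ^ Γ.card * B.card := by exact_mod_cast hcard
      _ ≤ ((2 * n + 1) ^ 2) ^ d * B.card := by
        gcongr
        nlinarith
      _ = _ := by rw [pow_mul]
  have hZ : (B.card : ℝ) * Real.exp (-(b * R / 2)) ≤ ∑ z : G, Real.exp (-(b * dev Γ z)) := by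
    calc (B.card : ℝ) * Real.exp (-(b * R / 2)) = ∑ z ∈ B, Real.exp (-(b * R / 2)) := by simp
      _ ≤ ∑ z ∈ B, Real.exp (-(b * dev Γ z)) := by
        refine Finset.sum_le_sum fun z hz => Real.exp_le_exp.2 ?_
        have := hBdev z hz
        nlinarith
      _ ≤ _ := Finset.sum_le_sum_of_subset_of_nonneg (Finset.subset_univ _)
        fun _ _ _ => (Real.exp_pos _).le
  have hnum : ∑ y with R < dev Γ y, Real.exp (-(b * dev Γ y)) ≤
      Fintype.card G * Real.exp (-(b * R)) := by
    calc _ ≤ ∑ y : G with R < dev Γ y, Real.exp (-(b * R)) := by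
          refine Finset.sum_le_sum fun y hy => Real.exp_le_exp.2 ?_
          have := (Finset.mem_filter.1 hy).2
          nlinarith
      _ ≤ ∑ y : G, Real.exp (-(b * R)) :=
          Finset.sum_le_sum_of_subset_of_nonneg (Finset.subset_univ _)
            fun _ _ _ => (Real.exp_pos _).le
      _ = _ := by simp
  unfold gibbs
  rw [← Finset.sum_div, div_le_iff₀ (partition_pos Γ b)]
  have e : Real.exp (-(b * R)) = Real.exp (-(b * R / 2)) * Real.exp (-(b * R / 2)) := by
    rw [← Real.exp_add]; ring_nf
  calc _ ≤ _ := hnum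
    _ ≤ ((2 * n + 1) ^ (2 * d) * B.card) * Real.exp (-(b * R)) := by gcongr
    _ = ((2 * n + 1) ^ (2 * d) * Real.exp (-(b * R / 2))) *
        (B.card * Real.exp (-(b * R / 2))) := by rw [e]; ring
    _ ≤ _ := by gcongr

end Gibbs

section Increment

variable {G ι : Type*} [AddCommGroup G] [Fintype G]

lemma one_sub_le_re_coef {Γ : Finset (AddChar G Circle)} {b R t : ℝ} {ψ : AddChar G Circle}
    (ht : 0 ≤ t) (hmass : ∑ y with R < dev Γ y, gibbs Γ b y ≤ t / 4)
    (hψ : ∀ y, dev Γ y ≤ R → ‖1 - (ψ y : ℂ)‖ ≤ t / 2) :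
    1 - t ≤ (coef (gibbs Γ b) ψ).re := by
  classical
  have e : 1 - coef (gibbs Γ b) ψ = ∑ y, (gibbs Γ b y : ℂ) * (1 - ψ y) := by
    simp only [mul_sub, mul_one, Finset.sum_sub_distrib, coef]
    rw [← Complex.ofReal_sum, sum_gibbs, Complex.ofReal_one]
  have h : ‖1 - coef (gibbs Γ b) ψ‖ ≤ t := by
    rw [e]
    calc _ ≤ ∑ y, gibbs Γ b y * ‖1 - (ψ y : ℂ)‖ := by
          refine (norm_sum_le _ _).trans (le_of_eq (Finset.sum_congr rfl fun y _ => ?_))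
          rw [norm_mul, Complex.norm_real, Real.norm_eq_abs, abs_of_nonneg (gibbs_nonneg Γ b y)]
      _ ≤ ∑ y, (gibbs Γ b y * (t / 2) + if R < dev Γ y then gibbs Γ b y * 2 else 0) := by
          refine Finset.sum_le_sum fun y _ => ?_
          have h0 := gibbs_nonneg Γ b y
          split_ifs with hy
          · have : ‖1 - (ψ y : ℂ)‖ ≤ 2 := by
              refine (norm_sub_le _ _).trans ?_
              rw [Circle.norm_coe, norm_one]; norm_num
            nlinarith [mul_le_mul_of_nonneg_left this h0]
          · rw [add_zero]
            exact mul_le_mul_of_nonneg_left (hψ y (not_lt.1 hy)) h0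
      _ = t / 2 + (∑ y with R < dev Γ y, gibbs Γ b y) * 2 := by
          rw [Finset.sum_add_distrib, ← Finset.sum_mul, sum_gibbs, one_mul, ← Finset.sum_filter,
            Finset.sum_mul]
      _ ≤ t := by linarith
  have := (Complex.abs_re_le_norm (1 - coef (gibbs Γ b) ψ)).trans h
  rw [Complex.sub_re, Complex.one_re, abs_le] at this
  linarith [this.2]

/-- The covariance of two characters with respect to a Gibbs weight. -/
noncomputable def cov (β : G → ℝ) (χ ψ : AddChar G Circle) : ℂ :=
  ∑ y, (β y : ℂ) * ((χ y - coef β χ) * (starRingEnd ℂ) (ψ y - coef β ψ))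

lemma sum_mul_sub_coef (Γ : Finset (AddChar G Circle)) (b : ℝ) (ψ : AddChar G Circle) :
    ∑ y, (gibbs Γ b y : ℂ) * (starRingEnd ℂ) (ψ y - coef (gibbs Γ b) ψ) = 0 := by
  have h : ∑ y, (gibbs Γ b y : ℂ) * (ψ y - coef (gibbs Γ b) ψ) = 0 := by
    simp only [mul_sub, Finset.sum_sub_distrib]
    rw [← Finset.sum_mul, ← Complex.ofReal_sum, sum_gibbs, Complex.ofReal_one, one_mul, coef,
      sub_self]
  have h2 := congrArg (starRingEnd ℂ) h
  rw [map_zero, map_sum] at h2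
  simpa only [map_mul, Complex.conj_ofReal] using h2

lemma cov_eq_sum (Γ : Finset (AddChar G Circle)) (b : ℝ) (χ ψ : AddChar G Circle) :
    cov (gibbs Γ b) χ ψ =
      ∑ y, (gibbs Γ b y : ℂ) * (χ y * (starRingEnd ℂ) (ψ y - coef (gibbs Γ b) ψ)) := by
  rw [← sub_eq_zero, cov, ← Finset.sum_sub_distrib]
  calc _ = -coef (gibbs Γ b) χ *
        ∑ y, (gibbs Γ b y : ℂ) * (starRingEnd ℂ) (ψ y - coef (gibbs Γ b) ψ) := by
        rw [Finset.mul_sum]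
        exact Finset.sum_congr rfl fun y _ => by ring
    _ = 0 := by rw [sum_mul_sub_coef, mul_zero]

lemma cov_eq (Γ : Finset (AddChar G Circle)) (b : ℝ) (χ ψ : AddChar G Circle) :
    cov (gibbs Γ b) χ ψ = coef (gibbs Γ b) (χ / ψ) -
      coef (gibbs Γ b) χ * (starRingEnd ℂ) (coef (gibbs Γ b) ψ) := by
  rw [cov_eq_sum, coef.eq_1 _ (χ / ψ), coef.eq_1 _ χ, Finset.sum_mul, ← Finset.sum_sub_distrib]
  refine Finset.sum_congr rfl fun y _ => ?_
  have : (((χ / ψ) y : Circle) : ℂ) = χ y * (starRingEnd ℂ) (ψ y : ℂ) := by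
    rw [AddChar.div_apply', div_eq_mul_inv, Circle.coe_mul, Circle.coe_inv_eq_conj]
  rw [this, map_sub]; ring

lemma norm_cov_sq_le (Γ : Finset (AddChar G Circle)) (b : ℝ) (χ ψ : AddChar G Circle) :
    ‖cov (gibbs Γ b) χ ψ‖ ^ 2 ≤ 1 - ‖coef (gibbs Γ b) ψ‖ ^ 2 := by
  have h1 : ‖cov (gibbs Γ b) χ ψ‖ ≤
      ∑ y, gibbs Γ b y * ‖(ψ y : ℂ) - coef (gibbs Γ b) ψ‖ := by
    rw [cov_eq_sum]
    refine (norm_sum_le _ _).trans (le_of_eq (Finset.sum_congr rfl fun y _ => ?_))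
    rw [norm_mul, norm_mul, Circle.norm_coe, one_mul, Complex.norm_real, Real.norm_eq_abs,
      abs_of_nonneg (gibbs_nonneg Γ b y), RCLike.norm_conj]
  have h2 : ∑ y, gibbs Γ b y * ‖(ψ y : ℂ) - coef (gibbs Γ b) ψ‖ ^ 2 =
      1 - ‖coef (gibbs Γ b) ψ‖ ^ 2 := by
    have e : cov (gibbs Γ b) ψ ψ =
        ((∑ y, gibbs Γ b y * ‖(ψ y : ℂ) - coef (gibbs Γ b) ψ‖ ^ 2 : ℝ) : ℂ) := by
      rw [cov, Complex.ofReal_sum]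
      refine Finset.sum_congr rfl fun y _ => ?_
      rw [Complex.mul_conj']; push_cast; ring
    have e2 : cov (gibbs Γ b) ψ ψ = ((1 - ‖coef (gibbs Γ b) ψ‖ ^ 2 : ℝ) : ℂ) := by
      rw [cov_eq, Complex.mul_conj', div_self', coef]
      simp only [AddChar.one_apply, Circle.coe_one, mul_one]
      rw [← Complex.ofReal_sum, sum_gibbs]
      push_cast; rfl
    exact_mod_cast e.symm.trans e2
  rw [← h2]
  refine (pow_le_pow_left₀ (norm_nonneg _) h1 2).trans ?_
  exact Real.pow_arith_mean_le_arith_mean_pow _ _ _ (fun y _ => gibbs_nonneg Γ b y)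
    (sum_gibbs Γ b) (fun y _ => norm_nonneg _) 2

/-- Trigonometric polynomial on `G`. -/
noncomputable def trig (s : Finset ι) (c : ι → ℂ) (χ : ι → AddChar G Circle) (x : G) : ℂ :=
  ∑ i ∈ s, c i * χ i x

/-- Local average of a function against a weight. -/
noncomputable def avg (β : G → ℝ) (h : G → ℂ) (x : G) : ℂ := ∑ y, (β y : ℂ) * h (x + y)

lemma trig_add_sub_avg (Γ : Finset (AddChar G Circle)) (b : ℝ) (s : Finset ι) (c : ι → ℂ)
    (χ : ι → AddChar G Circle) (x y : G) :
    trig s c χ (x + y) - avg (gibbs Γ b) (trig s c χ) x =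
      ∑ i ∈ s, c i * χ i x * (χ i y - coef (gibbs Γ b) (χ i)) := by
  have h : avg (gibbs Γ b) (trig s c χ) x =
      ∑ i ∈ s, c i * χ i x * coef (gibbs Γ b) (χ i) := by
    simp only [avg, trig, coef, Finset.mul_sum]
    rw [Finset.sum_comm]
    refine Finset.sum_congr rfl fun i _ => Finset.sum_congr rfl fun z _ => ?_
    rw [AddChar.map_add_eq_mul]; push_cast; ring
  rw [h, trig, ← Finset.sum_sub_distrib]
  refine Finset.sum_congr rfl fun i _ => ?_
  rw [AddChar.map_add_eq_mul]; push_cast; ring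

lemma variance_le (Γ : Finset (AddChar G Circle)) (b : ℝ) (s : Finset ι) (c : ι → ℂ)
    (χ : ι → AddChar G Circle) (x : G) :
    ∑ y, gibbs Γ b y * ‖trig s c χ (x + y) - avg (gibbs Γ b) (trig s c χ) x‖ ^ 2 ≤
      ∑ i ∈ s, ‖c i‖ * ∑ j ∈ s, ‖c j‖ * ‖cov (gibbs Γ b) (χ i) (χ j)‖ := by
  have e : ((∑ y, gibbs Γ b y *
      ‖trig s c χ (x + y) - avg (gibbs Γ b) (trig s c χ) x‖ ^ 2 : ℝ) : ℂ) =
      ∑ i ∈ s, ∑ j ∈ s, (c i * χ i x) * (starRingEnd ℂ) (c j * χ j x) *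
        cov (gibbs Γ b) (χ i) (χ j) := by
    have h : ∀ y, ((gibbs Γ b y *
        ‖trig s c χ (x + y) - avg (gibbs Γ b) (trig s c χ) x‖ ^ 2 : ℝ) : ℂ) =
        ∑ i ∈ s, ∑ j ∈ s, (c i * χ i x) * (starRingEnd ℂ) (c j * χ j x) *
          ((gibbs Γ b y : ℂ) * ((χ i y - coef (gibbs Γ b) (χ i)) *
            (starRingEnd ℂ) (χ j y - coef (gibbs Γ b) (χ j)))) := by
      intro y
      rw [Complex.ofReal_mul, Complex.ofReal_pow, ← Complex.mul_conj', trig_add_sub_avg, map_sum,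
        Finset.sum_mul_sum, Finset.mul_sum]
      refine Finset.sum_congr rfl fun i _ => ?_
      rw [Finset.mul_sum]
      refine Finset.sum_congr rfl fun j _ => ?_
      simp only [map_mul]; ring
    rw [Complex.ofReal_sum]
    simp only [h]
    rw [Finset.sum_comm]
    refine Finset.sum_congr rfl fun i _ => ?_
    rw [Finset.sum_comm]
    refine Finset.sum_congr rfl fun j _ => ?_
    rw [cov, Finset.mul_sum]
  refine (le_abs_self _).trans ?_
  rw [← Real.norm_eq_abs, ← Complex.norm_real, e]
  refine (norm_sum_le _ _).trans (Finset.sum_le_sum fun i _ => ?_)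
  rw [Finset.mul_sum]
  refine (norm_sum_le _ _).trans (Finset.sum_le_sum fun j _ => le_of_eq ?_)
  simp only [norm_mul, RCLike.norm_conj, Circle.norm_coe, mul_one, one_mul, mul_assoc]

/-- The part of the frequencies nearly annihilated by a weight. -/
noncomputable def lowFreq (t : ℝ) (s : Finset ι) (χ : ι → AddChar G Circle) (β : G → ℝ) :
    Finset ι :=
  s.filter fun j => 1 - t ≤ (coef β (χ j)).re

/-- If the local variance is not small, one new frequency captures noticeable extra mass. -/
lemma exists_increment {Γ : Finset (AddChar G Circle)} {b K ε δ t R : ℝ} (hb : 1 ≤ b)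
    (hK : 1 ≤ K) (hε : 0 < ε) (hε1 : ε ≤ 1) (hδ : δ = ε / (2 * K ^ 2)) (ht : t = δ ^ 2 / 4)
    (hR : R = t * δ / (16 * b)) {s : Finset ι} {c : ι → ℂ} {χ : ι → AddChar G Circle}
    (hc : ∑ i ∈ s, ‖c i‖ ≤ K) {x : G}
    (hx : ε < ∑ y, gibbs Γ b y *
      ‖trig s c χ (x + y) - avg (gibbs Γ b) (trig s c χ) x‖ ^ 2) :
    ∃ ψ : AddChar G Circle, ∀ Γ' : Finset (AddChar G Circle), Γ ⊆ Γ' → ψ ∈ Γ' → ∀ b' : ℝ,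
      ∑ y with R < dev Γ' y, gibbs Γ' b' y ≤ t / 4 →
      ∑ j ∈ lowFreq t s χ (gibbs Γ b), ‖c j‖ + ε / (4 * K) ≤
        ∑ j ∈ lowFreq t s χ (gibbs Γ' b'), ‖c j‖ := by
  classical
  have hδ0 : 0 < δ := by rw [hδ]; positivity
  have hδ1 : δ ≤ 1 / 2 := by
    rw [hδ, div_le_iff₀ (by positivity)]; nlinarith
  have ht0 : 0 < t := by rw [ht]; positivity
  have ht1 : t ≤ 1 / 16 := by rw [ht]; nlinarith
  have hR0 : 0 < R := by rw [hR]; positivity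
  have hbR : b * R = t * δ / 16 := by rw [hR]; field_simp
  have hRt : R ≤ t / 8 := by
    rw [hR, div_le_iff₀ (by positivity)]; nlinarith
  obtain ⟨r, hr, hrlt⟩ : ∃ r ∈ s, ε / K < ∑ j ∈ s, ‖c j‖ * ‖cov (gibbs Γ b) (χ r) (χ j)‖ := by
    by_contra! hcon
    have : ∑ i ∈ s, ‖c i‖ * ∑ j ∈ s, ‖c j‖ * ‖cov (gibbs Γ b) (χ i) (χ j)‖ ≤ ε := by
      calc _ ≤ ∑ i ∈ s, ‖c i‖ * (ε / K) :=
            Finset.sum_le_sum fun i hi => mul_le_mul_of_nonneg_left (hcon i hi) (norm_nonneg _)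
        _ = (∑ i ∈ s, ‖c i‖) * (ε / K) := by rw [Finset.sum_mul]
        _ ≤ K * (ε / K) := by gcongr
        _ = ε := by field_simp
    exact absurd (hx.trans_le ((variance_le Γ b s c χ x).trans this)) (lt_irrefl _)
  refine ⟨χ r, fun Γ' hsub hψ b' hmass => ?_⟩
  have hdev : ∀ y, dev Γ y ≤ dev Γ' y := fun y =>
    Finset.sum_le_sum_of_subset_of_nonneg hsub fun _ _ _ => norm_nonneg _
  have hdevr : ∀ y, ‖1 - (χ r y : ℂ)‖ ≤ dev Γ' y := fun y =>
    Finset.single_le_sum (f := fun γ : AddChar G Circle => ‖1 - (γ y : ℂ)‖)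
      (fun _ _ => norm_nonneg _) hψ
  have hnear : ∀ φ : AddChar G Circle, δ / 2 ≤ ‖coef (gibbs Γ b) φ‖ → ∀ y, dev Γ' y ≤ R →
      ‖1 - (φ y : ℂ)‖ ≤ t / 4 := by
    intro φ hφ y hy
    have h1 := norm_one_sub_mul_coef_le Γ (zero_le_one.trans hb) φ y
    have h2 : b * dev Γ y ≤ t * δ / 16 := by
      rw [← hbR]
      exact mul_le_mul_of_nonneg_left ((hdev y).trans hy) (by linarith)
    have h3 : Real.exp (b * dev Γ y) - 1 ≤ t * δ / 8 := by
      have h4 : Real.exp (b * dev Γ y) ≤ Real.exp (t * δ / 16) := Real.exp_le_exp.2 h2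
      have h5 := Real.abs_exp_sub_one_le (x := t * δ / 16) (by
        rw [abs_of_pos (by positivity)]; nlinarith)
      rw [abs_of_pos (show (0 : ℝ) < t * δ / 16 by positivity), abs_le] at h5
      linarith [h5.2]
    have h6 : ‖1 - (φ y : ℂ)‖ * (δ / 2) ≤ t * δ / 8 :=
      (mul_le_mul_of_nonneg_left hφ (norm_nonneg _)).trans (h1.trans h3)
    have h7 : ‖1 - (φ y : ℂ)‖ * (δ / 2) ≤ (t / 4) * (δ / 2) := by linarith
    exact le_of_mul_le_mul_right h7 (by positivity)
  have hlarge : ∀ φ : AddChar G Circle, δ / 2 ≤ ‖coef (gibbs Γ b) φ‖ →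
      1 - t ≤ (coef (gibbs Γ' b') φ).re := fun φ hφ =>
    one_sub_le_re_coef ht0.le hmass fun y hy => (hnear φ hφ y hy).trans (by linarith)
  set hit := s.filter fun j => δ ≤ ‖cov (gibbs Γ b) (χ r) (χ j)‖ with hhit
  have hhit_in : hit ⊆ lowFreq t s χ (gibbs Γ' b') := by
    intro j hj
    simp only [hhit, Finset.mem_filter] at hj
    simp only [lowFreq, Finset.mem_filter]
    refine ⟨hj.1, ?_⟩
    by_cases h : δ / 2 ≤ ‖coef (gibbs Γ b) (χ j)‖
    · exact hlarge _ h
    · have h2 : δ / 2 ≤ ‖coef (gibbs Γ b) (χ r / χ j)‖ := by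
        have h3 := hj.2
        rw [cov_eq] at h3
        have h4 := norm_sub_le (coef (gibbs Γ b) (χ r / χ j))
          (coef (gibbs Γ b) (χ r) * (starRingEnd ℂ) (coef (gibbs Γ b) (χ j)))
        rw [norm_mul, RCLike.norm_conj] at h4
        have h5 := norm_coef_le_one Γ b (χ r)
        have h6 := norm_nonneg (coef (gibbs Γ b) (χ j))
        nlinarith
      refine one_sub_le_re_coef ht0.le hmass fun y hy => ?_
      have h3 := hnear _ h2 y hy
      have h4 := (hdevr y).trans (hy.trans hRt)
      have h5 : χ j y = χ r y / (χ r / χ j) y := by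
        rw [AddChar.div_apply']; simp
      rw [h5]
      exact (norm_one_sub_div_le _ _).trans (by linarith)
  have hdisj : Disjoint (lowFreq t s χ (gibbs Γ b)) hit := by
    rw [Finset.disjoint_left]
    intro j hj1 hj2
    simp only [lowFreq, Finset.mem_filter] at hj1
    simp only [hhit, Finset.mem_filter] at hj2
    have h1 := norm_cov_sq_le Γ b (χ r) (χ j)
    have h2 := Complex.re_le_norm (coef (gibbs Γ b) (χ j))
    have h3 := hj1.2
    have h4 := pow_le_pow_left₀ hδ0.le hj2.2 2
    nlinarith
  have hin : lowFreq t s χ (gibbs Γ b) ⊆ lowFreq t s χ (gibbs Γ' b') := by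
    intro j hj
    simp only [lowFreq, Finset.mem_filter] at hj ⊢
    refine ⟨hj.1, hlarge _ ?_⟩
    have h2 := Complex.re_le_norm (coef (gibbs Γ b) (χ j))
    linarith [hj.2]
  have hmasshit : ε / (4 * K) ≤ ∑ j ∈ hit, ‖c j‖ := by
    have h1 : ∑ j ∈ s, ‖c j‖ * ‖cov (gibbs Γ b) (χ r) (χ j)‖ ≤
        ∑ j ∈ s, (‖c j‖ * δ + if δ ≤ ‖cov (gibbs Γ b) (χ r) (χ j)‖ then ‖c j‖ else 0) := by
      refine Finset.sum_le_sum fun j _ => ?_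
      have h0 := norm_nonneg (c j)
      split_ifs with h
      · have h5 : ‖cov (gibbs Γ b) (χ r) (χ j)‖ ≤ 1 := by
          have := norm_cov_sq_le Γ b (χ r) (χ j)
          nlinarith [norm_nonneg (cov (gibbs Γ b) (χ r) (χ j)), sq_nonneg ‖coef (gibbs Γ b) (χ j)‖]
        nlinarith
      · rw [add_zero]
        exact mul_le_mul_of_nonneg_left (not_le.1 h).le h0
    rw [Finset.sum_add_distrib, ← Finset.sum_mul, ← Finset.sum_filter] at h1
    have h2 : (∑ j ∈ s, ‖c j‖) * δ ≤ ε / (2 * K) := by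
      calc _ ≤ K * δ := by gcongr
        _ = ε / (2 * K) := by rw [hδ]; field_simp
    have h3 : ε / K = ε / (2 * K) + ε / (4 * K) + ε / (4 * K) := by field_simp; ring
    have h4 : 0 < ε / (4 * K) := by positivity
    linarith
  calc _ ≤ ∑ j ∈ lowFreq t s χ (gibbs Γ b), ‖c j‖ + ∑ j ∈ hit, ‖c j‖ := by gcongr
    _ = ∑ j ∈ lowFreq t s χ (gibbs Γ b) ∪ hit, ‖c j‖ := (Finset.sum_union hdisj).symm
    _ ≤ _ := Finset.sum_le_sum_of_subset_of_nonneg (Finset.union_subset hin hhit_in)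
      fun _ _ _ => norm_nonneg _

end Increment

section Littlewood

lemma gibbs_mass_bound {t δ Q q b R : ℝ} {d i : ℕ} (hd : 1 ≤ d) (ht : 0 < t) (ht1 : t ≤ 1)
    (hδ : 0 < δ) (hδ1 : δ ≤ 1) (hq : q = 320 * d ^ 2 / (t * δ)) (hQ : Q = q ^ 2) (hi : i < d)
    (hb : b = Q ^ (i + 1)) (hR : R = t * δ / (16 * b)) :
    ∃ n : ℕ, 0 < n ∧ 4 * d ≤ R * n ∧
      (2 * (n : ℝ) + 1) ^ (2 * d) * Real.exp (-(Q ^ (i + 2) * R / 2)) ≤ t / 4 := by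
  have hd' : (1 : ℝ) ≤ d := by exact_mod_cast hd
  have htδ : 0 < t * δ := by positivity
  have htδ1 : t * δ ≤ 1 := by nlinarith
  have hq0 : 320 * (d : ℝ) ^ 2 ≤ q := by
    rw [hq, le_div_iff₀ htδ]; nlinarith [sq_nonneg (d : ℝ)]
  have hqt : q * (t * δ) = 320 * d ^ 2 := by rw [hq]; field_simp
  have hq1 : 320 ≤ q := by nlinarith
  have hQq : q ≤ Q := by rw [hQ]; nlinarith
  have hQ1 : 1 ≤ Q := by linarith
  have hb1 : 1 ≤ b := by rw [hb]; exact one_le_pow₀ hQ1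
  have hR0 : 0 < R := by rw [hR]; positivity
  have hRb : R * (16 * b) = t * δ := by rw [hR]; field_simp
  refine ⟨⌈4 * d / R⌉₊, Nat.ceil_pos.2 (by positivity), ?_, ?_⟩
  · have := Nat.le_ceil (4 * d / R)
    rw [div_le_iff₀ hR0] at this; linarith
  set n := ⌈4 * d / R⌉₊
  have hn : (n : ℝ) < 4 * d / R + 1 := Nat.ceil_lt_add_one (by positivity)
  have hdR : (d : ℝ) / R * (t * δ) = 16 * b * d := by
    rw [← hRb]; field_simp
  have hdR3 : 3 ≤ (d : ℝ) / R := by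
    rw [le_div_iff₀ hR0]
    have : R ≤ 1 / 16 := by
      rw [hR, div_le_iff₀ (by positivity)]; nlinarith
    linarith
  have h1 : 2 * (n : ℝ) + 1 ≤ Q * b := by
    have h2 : 2 * (n : ℝ) + 1 ≤ 9 * (d / R) := by
      have : 4 * (d : ℝ) / R = 4 * (d / R) := by ring
      linarith
    refine h2.trans ?_
    have h3 : 9 * ((d : ℝ) / R) * (t * δ) ≤ Q * b * (t * δ) := by
      have : Q * (t * δ) ≥ 320 * d ^ 2 := by rw [← hqt]; gcongr
      calc 9 * ((d : ℝ) / R) * (t * δ) = 144 * d * b := by linarith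
        _ ≤ (320 * d ^ 2) * b := by gcongr ?_ * b; nlinarith
        _ ≤ Q * (t * δ) * b := by gcongr
        _ = _ := by ring
    exact le_of_mul_le_mul_right h3 htδ
  have h2 : Q * b ≤ Q ^ (d + 1) := by
    rw [hb, ← pow_succ']
    exact pow_le_pow_right₀ hQ1 (by omega)
  have h3 : 4 / t ≤ Q := by
    refine le_trans ?_ hQq
    rw [hq]
    apply div_le_div₀ (by positivity) (by nlinarith) (by positivity) (by nlinarith)
  have h4 : Q ^ (i + 2) * R / 2 = 10 * d ^ 2 * q := by
    have : Q ^ (i + 2) = Q * b := by rw [hb]; ring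
    rw [this]
    have : Q * b * R = Q * (t * δ) / 16 := by rw [← hRb]; ring
    rw [this, hQ]
    calc q ^ 2 * (t * δ) / 16 / 2 = q * (q * (t * δ)) / 32 := by ring
      _ = _ := by rw [hqt]; ring
  have h5 : Q ^ (5 * d ^ 2) ≤ Real.exp (10 * d ^ 2 * q) := by
    rw [hQ, ← pow_mul]
    calc q ^ (2 * (5 * d ^ 2)) ≤ (Real.exp q) ^ (2 * (5 * d ^ 2)) := by
          gcongr; linarith [Real.add_one_le_exp q]
      _ = Real.exp (10 * d ^ 2 * q) := by
          rw [← Real.exp_nat_mul]; push_cast; ring_nf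
  have h6 : (2 * (n : ℝ) + 1) ^ (2 * d) * (4 / t) ≤ Real.exp (10 * d ^ 2 * q) := by
    calc (2 * (n : ℝ) + 1) ^ (2 * d) * (4 / t) ≤ (Q ^ (d + 1)) ^ (2 * d) * Q := by
          gcongr; exact h1.trans h2
      _ = Q ^ ((d + 1) * (2 * d) + 1) := by rw [← pow_mul, pow_succ]
      _ ≤ Q ^ (5 * d ^ 2) := pow_le_pow_right₀ hQ1 (by nlinarith)
      _ ≤ _ := h5
  rw [h4, Real.exp_neg, ← div_eq_mul_inv, div_le_iff₀ (Real.exp_pos _)]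
  rw [← le_div_iff₀ (by positivity)] at h6
  refine h6.trans (le_of_eq ?_)
  field_simp

variable {G ι : Type*} [AddCommGroup G] [Fintype G]

/-- A trigonometric polynomial with small coefficient sum has small local variance with respect
to some Gibbs weight of controlled rank and temperature. -/
lemma exists_small_variance {K ε δ t Q q : ℝ} {d : ℕ} (hK : 1 ≤ K) (hε : 0 < ε) (hε1 : ε ≤ 1)
    (hδ : δ = ε / (2 * K ^ 2)) (ht : t = δ ^ 2 / 4) (hd : d = ⌊4 * K ^ 2 / ε⌋₊ + 1)
    (hq : q = 320 * d ^ 2 / (t * δ)) (hQ : Q = q ^ 2) (hQ1 : 1 ≤ Q)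
    {s : Finset ι} {c : ι → ℂ} {χ : ι → AddChar G Circle} (hc : ∑ i ∈ s, ‖c i‖ ≤ K) :
    ∃ (Γ : Finset (AddChar G Circle)) (b : ℝ), Γ.card ≤ d ∧ 1 ≤ b ∧ b ≤ Q ^ (d + 1) ∧
      ∀ x, ∑ y, gibbs Γ b y *
        ‖trig s c χ (x + y) - avg (gibbs Γ b) (trig s c χ) x‖ ^ 2 ≤ ε := by
  classical
  by_contra! hcon
  have hδ0 : 0 < δ := by rw [hδ]; positivity
  have hδ1 : δ ≤ 1 / 2 := by
    rw [hδ, div_le_iff₀ (by positivity)]; nlinarith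
  have ht0 : 0 < t := by rw [ht]; positivity
  have ht1 : t ≤ 1 := by rw [ht]; nlinarith
  have main : ∀ i : ℕ, i ≤ d → ∃ Γ : Finset (AddChar G Circle), Γ.card ≤ i ∧
      i * (ε / (4 * K)) ≤ ∑ j ∈ lowFreq t s χ (gibbs Γ (Q ^ (i + 1))), ‖c j‖ := by
    intro i
    induction i with
    | zero =>
      intro _
      exact ⟨∅, by simp, by
        simpa using Finset.sum_nonneg fun j _ => norm_nonneg (c j)⟩
    | succ i ih =>
      intro hi
      obtain ⟨Γ, hΓ, hm⟩ := ih (by omega)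
      have hb1 : 1 ≤ Q ^ (i + 1) := one_le_pow₀ hQ1
      obtain ⟨x, hx⟩ := hcon Γ (Q ^ (i + 1)) (by omega) hb1
        (pow_le_pow_right₀ hQ1 (by omega))
      obtain ⟨ψ, hψ⟩ := exists_increment hb1 hK hε hε1 hδ ht rfl hc hx
      obtain ⟨n, hn, hRn, hmass⟩ := gibbs_mass_bound (b := Q ^ (i + 1)) (by omega) ht0 ht1 hδ0
        (by linarith) hq hQ (show i < d by omega) rfl rfl
      have hcard : (insert ψ Γ).card ≤ i + 1 := (Finset.card_insert_le _ _).trans (by omega)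
      refine ⟨insert ψ Γ, hcard, ?_⟩
      have h2 := hψ (insert ψ Γ) (Finset.subset_insert _ _) (Finset.mem_insert_self _ _)
        (Q ^ (i + 2)) ((sum_gibbs_filter_le _ (by positivity) (hcard.trans hi) hn hRn).trans hmass)
      push_cast
      linarith
  obtain ⟨Γ, -, hm⟩ := main d le_rfl
  have h1 : ∑ j ∈ lowFreq t s χ (gibbs Γ (Q ^ (d + 1))), ‖c j‖ ≤ K :=
    (Finset.sum_le_sum_of_subset_of_nonneg (Finset.filter_subset _ _)
      fun _ _ _ => norm_nonneg _).trans hc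
  have h2 : 4 * K ^ 2 / ε < d := by
    rw [hd]; push_cast; exact Nat.lt_floor_add_one _
  have h3 : K < d * (ε / (4 * K)) := by
    rw [div_lt_iff₀ hε] at h2
    rw [← mul_div_assoc, lt_div_iff₀ (by positivity)]; nlinarith
  linarith

lemma gibbs_pos (Γ : Finset (AddChar G Circle)) (b : ℝ) (y : G) : 0 < gibbs Γ b y :=
  div_pos (Real.exp_pos _) (partition_pos Γ b)

lemma exists_norm_sub_avg_le {Γ : Finset (AddChar G Circle)} {b ε : ℝ} (hε : 0 ≤ ε) {h : G → ℂ}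
    {x : G} (hx : ∑ y, gibbs Γ b y * ‖h (x + y) - avg (gibbs Γ b) h x‖ ^ 2 ≤ ε ^ 2) :
    ∃ y, ‖h y - avg (gibbs Γ b) h x‖ ≤ ε := by
  by_contra! hcon
  have h1 : 0 < ∑ y, gibbs Γ b y * (‖h (x + y) - avg (gibbs Γ b) h x‖ ^ 2 - ε ^ 2) :=
    Finset.sum_pos (fun y _ => mul_pos (gibbs_pos Γ b y)
      (sub_pos.2 (pow_lt_pow_left₀ (hcon _) hε two_ne_zero))) Finset.univ_nonempty
  simp only [mul_sub, Finset.sum_sub_distrib] at h1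
  rw [← Finset.sum_mul, sum_gibbs] at h1
  linarith

lemma norm_avg_add_sub_le (Γ : Finset (AddChar G Circle)) {b C : ℝ} (hb : 0 ≤ b) {h : G → ℂ}
    (hh : ∀ x, ‖h x‖ ≤ C) (x z : G) :
    ‖avg (gibbs Γ b) h (x + z) - avg (gibbs Γ b) h x‖ ≤ C * (Real.exp (b * dev Γ z) - 1) := by
  have h1 : avg (gibbs Γ b) h (x + z) = ∑ y, (gibbs Γ b (y + -z) : ℂ) * h (x + y) := by
    rw [avg, ← Equiv.sum_comp (Equiv.addRight z) fun y => (gibbs Γ b (y + -z) : ℂ) * h (x + y)]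
    refine Finset.sum_congr rfl fun y _ => ?_
    simp only [Equiv.coe_addRight, add_neg_cancel_right]
    congr 2; abel
  rw [h1, avg, ← Finset.sum_sub_distrib]
  have hC : 0 ≤ C := (norm_nonneg _).trans (hh 0)
  calc _ ≤ ∑ y, |gibbs Γ b (y + -z) - gibbs Γ b y| * C := by
        refine (norm_sum_le _ _).trans (Finset.sum_le_sum fun y _ => ?_)
        rw [← sub_mul, ← Complex.ofReal_sub, norm_mul, Complex.norm_real, Real.norm_eq_abs]
        exact mul_le_mul_of_nonneg_left (hh _) (abs_nonneg _)
    _ ≤ (Real.exp (b * dev Γ (-z)) - 1) * C := by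
        rw [← Finset.sum_mul]; gcongr; exact sum_abs_gibbs_sub_le Γ hb (-z)
    _ = _ := by rw [dev_neg, mul_comm]

lemma sum_avg (Γ : Finset (AddChar G Circle)) (b : ℝ) (h : G → ℂ) :
    ∑ x, avg (gibbs Γ b) h x = ∑ x, h x := by
  simp only [avg]
  rw [Finset.sum_comm]
  have : ∀ y : G, ∑ x, (gibbs Γ b y : ℂ) * h (x + y) = gibbs Γ b y * ∑ x, h x := by
    intro y
    rw [← Finset.mul_sum, ← Equiv.sum_comp (Equiv.addRight y) h]
    rfl
  simp only [this]
  rw [← Finset.sum_mul, ← Complex.ofReal_sum, sum_gibbs, Complex.ofReal_one, one_mul]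

lemma exists_ne_zero_dev_le {Γ : Finset (AddChar G Circle)} {d n : ℕ} (hn : 0 < n)
    (hd : Γ.card ≤ d) (hG : (2 * n + 1) ^ (2 * d) < Fintype.card G) :
    ∃ z : G, z ≠ 0 ∧ dev Γ z ≤ d * (2 / n) := by
  classical
  have h := card_le_mul_card_near Γ hn
  set B := Finset.univ.filter fun y : G => ∀ γ ∈ Γ, ‖1 - (γ y : ℂ)‖ ≤ 2 / n with hB
  have hB1 : 1 < B.card := by
    by_contra! hcon
    have : ((2 * n + 1) ^ 2) ^ Γ.card * B.card ≤ (2 * n + 1) ^ (2 * d) := by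
      calc _ ≤ ((2 * n + 1) ^ 2) ^ d * 1 :=
            Nat.mul_le_mul (Nat.pow_le_pow_right (by positivity) hd) hcon
        _ = _ := by rw [mul_one, pow_mul]
    omega
  obtain ⟨z, hz, hz0⟩ := Finset.exists_mem_ne hB1 0
  refine ⟨z, hz0, ?_⟩
  simp only [hB, Finset.mem_filter, Finset.mem_univ, true_and] at hz
  calc dev Γ z ≤ ∑ γ ∈ Γ, 2 / (n : ℝ) := Finset.sum_le_sum hz
    _ = Γ.card * (2 / n) := by simp
    _ ≤ d * (2 / n) := by gcongr

/-- A function on `ZMod p` whose local averages are nearly `0` or `1` and are almost invariant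
under a nonzero translation has mean close to `0` or `1`. -/
lemma avg_near_const {p : ℕ} [Fact p.Prime] {u : ZMod p → ℂ} {κ : ℝ} (hκ : κ ≤ 1 / 8)
    {z : ZMod p} (hz : z ≠ 0) (hu : ∀ x, ‖u x‖ ≤ κ ∨ ‖u x - 1‖ ≤ κ)
    (hinv : ∀ x, ‖u (x + z) - u x‖ ≤ 1 / 4) :
    ∃ a : ℂ, (a = 0 ∨ a = 1) ∧ ∀ x, ‖u x - a‖ ≤ κ := by
  have hstep : ∀ a : ℂ, (a = 0 ∨ a = 1) → ‖u 0 - a‖ ≤ κ → ∀ x, ‖u x - a‖ ≤ κ := by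
    intro a ha h0
    have hn : ∀ n : ℕ, ‖u (n * z) - a‖ ≤ κ := by
      intro n
      induction n with
      | zero => simpa using h0
      | succ n ih =>
        have e : ((n + 1 : ℕ) : ZMod p) * z = n * z + z := by push_cast; ring
        rw [e]
        set w : ZMod p := n * z
        have h1 := hinv w
        have h2 : ‖u (w + z) - a‖ ≤ 3 / 8 := by
          have := norm_add_le (u (w + z) - u w) (u w - a)
          rw [sub_add_sub_cancel] at this
          linarith
        by_contra hcon
        have h3 : ∃ a' : ℂ, ‖a - a'‖ = 1 ∧ ‖u (w + z) - a'‖ ≤ κ := by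
          rcases ha with rfl | rfl
          · rcases hu (w + z) with h | h
            · exact absurd (by simpa using h) hcon
            · exact ⟨1, by simp, h⟩
          · rcases hu (w + z) with h | h
            · exact ⟨0, by simp, by simpa using h⟩
            · exact absurd h hcon
        obtain ⟨a', ha', h4⟩ := h3
        have h5 := norm_sub_le (u (w + z) - a') (u (w + z) - a)
        rw [sub_sub_sub_cancel_left, ha'] at h5
        linarith
    intro x
    have := hn (x / z).val
    rwa [ZMod.natCast_zmod_val, div_mul_cancel₀ _ hz] at this
  rcases hu 0 with h | h
  · exact ⟨0, Or.inl rfl, hstep 0 (Or.inl rfl) (by simpa using h)⟩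
  · exact ⟨1, Or.inr rfl, hstep 1 (Or.inr rfl) h⟩

lemma card_le_of_near_indicator {p : ℕ} [Fact p.Prime] {K η δ t Q q : ℝ} {d : ℕ} (hK : 1 ≤ K)
    (hη : 0 < η) (hη1 : η ≤ 1 / 3)
    (hδ : δ = (η / 4) ^ 2 / (2 * K ^ 2)) (ht : t = δ ^ 2 / 4)
    (hd : d = ⌊4 * K ^ 2 / (η / 4) ^ 2⌋₊ + 1)
    (hq : q = 320 * d ^ 2 / (t * δ)) (hQ : Q = q ^ 2)
    {s : Finset ι} {c : ι → ℂ} {χ : ι → AddChar (ZMod p) Circle} (hc : ∑ i ∈ s, ‖c i‖ ≤ K)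
    (A : Finset (ZMod p)) (hA : ∀ x, ‖trig s c χ x - if x ∈ A then 1 else 0‖ ≤ η / 8)
    (hA1 : η * p ≤ A.card) (hA2 : A.card ≤ (1 - η) * p) :
    (p : ℝ) ≤ Q ^ (2 * d * (d + 2)) := by
  have hδ0 : 0 < δ := by rw [hδ]; positivity
  have hδ1 : δ ≤ 1 / 2 := by
    rw [hδ, div_le_iff₀ (by positivity)]; nlinarith
  have ht0 : 0 < t := by rw [ht]; positivity
  have ht1 : t ≤ 1 := by rw [ht]; nlinarith
  have hd1 : 1 ≤ d := by omega
  have hd' : (1 : ℝ) ≤ d := by exact_mod_cast hd1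
  have hq1 : 320 * (d : ℝ) ^ 2 ≤ q := by
    rw [hq, le_div_iff₀ (by positivity)]
    have : t * δ ≤ 1 := by nlinarith
    nlinarith [sq_nonneg (d : ℝ)]
  have hQ1 : 320 * (d : ℝ) ≤ Q := by
    have h1 : 320 * (d : ℝ) ≤ q := by nlinarith
    have h2 : 1 ≤ q := by linarith
    rw [hQ]; nlinarith
  have hQ2 : 1 ≤ Q := by linarith
  have hp0 : (0 : ℝ) < p := by exact_mod_cast (Fact.out : p.Prime).pos
  by_contra! hp
  obtain ⟨Γ, b, hΓ, hb1, hb, hvar⟩ := exists_small_variance (χ := χ) hK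
    (by positivity : 0 < (η / 4) ^ 2) (by nlinarith) hδ ht hd hq hQ hQ2 hc
  set h := trig s c χ
  set u := avg (gibbs Γ b) h with hu_def
  have hQp : 0 < Q ^ (d + 1) := by positivity
  set n := ⌈32 * d * Q ^ (d + 1)⌉₊ with hn_def
  have hn0 : 0 < n := Nat.ceil_pos.2 (by positivity)
  have hn0' : (0 : ℝ) < n := by exact_mod_cast hn0
  have hn1 := Nat.le_ceil (32 * d * Q ^ (d + 1))
  have hn2 : (n : ℝ) < 32 * d * Q ^ (d + 1) + 1 := Nat.ceil_lt_add_one (by positivity)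
  have hn3 : 2 * (n : ℝ) + 1 ≤ Q ^ (d + 2) := by
    have : 1 ≤ d * Q ^ (d + 1) := by nlinarith [one_le_pow₀ hQ2 (n := d + 1)]
    calc 2 * (n : ℝ) + 1 ≤ 320 * d * Q ^ (d + 1) := by nlinarith
      _ ≤ Q * Q ^ (d + 1) := by gcongr
      _ = _ := by rw [← pow_succ']
  obtain ⟨z, hz0, hz⟩ := exists_ne_zero_dev_le (Γ := Γ) hn0 hΓ (by
    rw [ZMod.card]
    have : (((2 * n + 1) ^ (2 * d) : ℕ) : ℝ) < p := by
      push_cast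
      calc (2 * (n : ℝ) + 1) ^ (2 * d) ≤ (Q ^ (d + 2)) ^ (2 * d) := by gcongr
        _ = Q ^ (2 * d * (d + 2)) := by rw [← pow_mul, mul_comm]
        _ < p := hp
    exact_mod_cast this)
  have hbz : b * dev Γ z ≤ 1 / 16 := by
    calc b * dev Γ z ≤ Q ^ (d + 1) * (d * (2 / n)) :=
          mul_le_mul hb hz (dev_nonneg _ _) hQp.le
      _ = 2 * d * Q ^ (d + 1) / n := by ring
      _ ≤ 1 / 16 := by rw [div_le_iff₀ hn0']; linarith
  have hexp : Real.exp (b * dev Γ z) - 1 ≤ 1 / 8 := by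
    have h0 : 0 ≤ b * dev Γ z := mul_nonneg (by linarith) (dev_nonneg _ _)
    have h5 := Real.abs_exp_sub_one_le (x := b * dev Γ z) (by rw [abs_of_nonneg h0]; linarith)
    rw [abs_of_nonneg h0, abs_le] at h5
    linarith [h5.2]
  have hbound : ∀ x, ‖h x‖ ≤ 2 := by
    intro x
    have h1 := hA x
    have h2 := norm_add_le (h x - if x ∈ A then 1 else 0) (if x ∈ A then (1 : ℂ) else 0)
    rw [sub_add_cancel] at h2
    have h3 : ‖(if x ∈ A then (1 : ℂ) else 0)‖ ≤ 1 := by split_ifs <;> simp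
    linarith
  have hnear : ∀ x, ‖u x‖ ≤ 3 * η / 8 ∨ ‖u x - 1‖ ≤ 3 * η / 8 := by
    intro x
    obtain ⟨y, hy⟩ := exists_norm_sub_avg_le (by positivity) (hvar x)
    have h1 := hA y
    rw [norm_sub_rev] at hy
    change ‖u x - h y‖ ≤ _ at hy
    have h2 := norm_add_le (u x - h y) (h y - if y ∈ A then 1 else 0)
    rw [sub_add_sub_cancel] at h2
    split_ifs at h1 h2
    · right; linarith
    · left; simp only [sub_zero] at h1 h2; linarith
  obtain ⟨a, ha, hua⟩ := avg_near_const (κ := 3 * η / 8) (by linarith) hz0 hnear fun x =>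
    (norm_avg_add_sub_le Γ (by linarith) hbound x z).trans (by linarith)
  have hs1 : ‖∑ x, h x - p * a‖ ≤ 3 * η / 8 * p := by
    have e : ∑ x, h x - p * a = ∑ x, (u x - a) := by
      rw [Finset.sum_sub_distrib, hu_def, sum_avg]; simp [ZMod.card]
    rw [e]
    refine (norm_sum_le_of_le _ fun x _ => hua x).trans (le_of_eq ?_)
    simp [ZMod.card, mul_comm]
  have hs2 : ‖∑ x, h x - A.card‖ ≤ η / 8 * p := by
    have e : ∑ x, h x - A.card = ∑ x, (h x - if x ∈ A then 1 else 0) := by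
      rw [Finset.sum_sub_distrib]; simp
    rw [e]
    refine (norm_sum_le_of_le _ fun x _ => hA x).trans (le_of_eq ?_)
    simp [ZMod.card, mul_comm]
  have hs3 : ‖(A.card : ℂ) - p * a‖ ≤ η / 2 * p := by
    have h2 := norm_sub_le (∑ x, h x - p * a) (∑ x, h x - A.card)
    rw [sub_sub_sub_cancel_left] at h2
    linarith
  have hηp : 0 < η * p := by positivity
  rcases ha with rfl | rfl
  · rw [mul_zero, sub_zero, Complex.norm_natCast] at hs3
    linarith
  · have e : (A.card : ℂ) - p * 1 = (((A.card : ℝ) - p : ℝ) : ℂ) := by push_cast; ring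
    rw [e, Complex.norm_real, Real.norm_eq_abs, abs_le] at hs3
    linarith [hs3.1]

/-- Quantitative Littlewood-type bound modulo a prime: a set of intermediate density cannot have
an indicator function with small Wiener norm. -/
theorem log_le_of_near_indicator {η : ℝ} (hη : 0 < η) (hη1 : η ≤ 1 / 3) :
    ∃ C : ℝ, 0 < C ∧ ∀ (p : ℕ) [Fact p.Prime] (K : ℝ), 1 ≤ K → ∀ (s : Finset ι) (c : ι → ℂ)
      (χ : ι → AddChar (ZMod p) Circle), ∑ i ∈ s, ‖c i‖ ≤ K → ∀ A : Finset (ZMod p),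
      (∀ x, ‖trig s c χ x - if x ∈ A then 1 else 0‖ ≤ η / 8) →
      η * p ≤ A.card → A.card ≤ (1 - η) * p → Real.log p ≤ C * K ^ 12 := by
  set ε := (η / 4) ^ 2 with hε
  have hε0 : 0 < ε := by positivity
  have hε1 : ε ≤ 1 := by rw [hε]; nlinarith
  set B := 320 * 25 * 32 / ε ^ 5 with hB
  have hB0 : 0 < B := by positivity
  refine ⟨6 * 25 / ε ^ 2 * (2 * (B + 10)), by positivity, ?_⟩
  intro p _ K hK s c χ hc A hA hA1 hA2
  have hmain := card_le_of_near_indicator hK hη hη1 rfl rfl rfl rfl rfl hc A hA hA1 hA2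
  rw [← hε] at hmain
  set d := ⌊4 * K ^ 2 / ε⌋₊ + 1 with hd
  have hK2 : 1 ≤ K ^ 2 / ε := by rw [le_div_iff₀ hε0]; nlinarith
  have hd1 : (d : ℝ) ≤ 5 * K ^ 2 / ε := by
    have := Nat.floor_le (show 0 ≤ 4 * K ^ 2 / ε by positivity)
    rw [hd]; push_cast
    calc _ ≤ 4 * K ^ 2 / ε + K ^ 2 / ε := by linarith
      _ = _ := by ring
  have hd2 : (1 : ℝ) ≤ d := by rw [hd]; push_cast; linarith [Nat.cast_nonneg (α := ℝ) ⌊4 * K ^ 2 / ε⌋₊]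
  set q := 320 * (d : ℝ) ^ 2 / ((ε / (2 * K ^ 2)) ^ 2 / 4 * (ε / (2 * K ^ 2))) with hq
  have hq0 : 0 < q := by positivity
  have hqB : q ≤ B * K ^ 10 := by
    calc q = 320 * 32 * (d : ℝ) ^ 2 * K ^ 6 / ε ^ 3 := by rw [hq]; field_simp; ring
      _ ≤ 320 * 32 * (5 * K ^ 2 / ε) ^ 2 * K ^ 6 / ε ^ 3 := by gcongr
      _ = B * K ^ 10 := by rw [hB]; field_simp; ring
  have hlogq : Real.log q ≤ (B + 10) * K := by
    calc Real.log q ≤ Real.log (B * K ^ 10) := Real.log_le_log hq0 hqB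
      _ = Real.log B + 10 * Real.log K := by
          rw [Real.log_mul hB0.ne' (by positivity), Real.log_pow]; norm_num
      _ ≤ B + 10 * K := by
          have h1 := Real.log_le_sub_one_of_pos hB0
          have h2 := Real.log_le_sub_one_of_pos (show 0 < K by linarith)
          linarith
      _ ≤ _ := by nlinarith
  have hp0 : (0 : ℝ) < p := by exact_mod_cast (Fact.out : p.Prime).pos
  have hBK : 0 ≤ 2 * (B + 10) * K := by positivity
  calc Real.log p ≤ Real.log ((q ^ 2) ^ (2 * d * (d + 2))) := Real.log_le_log hp0 hmain
    _ = (2 * d * (d + 2)) * (2 * Real.log q) := by rw [Real.log_pow, Real.log_pow]; push_cast; ring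
    _ ≤ (2 * d * (d + 2)) * (2 * (B + 10) * K) := by
        apply mul_le_mul_of_nonneg_left _ (by positivity); linarith
    _ ≤ (6 * (5 * K ^ 2 / ε) ^ 2) * (2 * (B + 10) * K) := by
        apply mul_le_mul_of_nonneg_right _ hBK
        calc 2 * (d : ℝ) * (d + 2) ≤ 6 * (d : ℝ) ^ 2 := by nlinarith
          _ ≤ _ := by gcongr
    _ = 6 * 25 / ε ^ 2 * (2 * (B + 10)) * K ^ 5 := by field_simp; ring
    _ ≤ _ := mul_le_mul_of_nonneg_left (pow_le_pow_right₀ hK (by norm_num)) (by positivity)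

end Littlewood

section Translations

/-- The Banach space `ℓ¹(ℤ)`. -/
abbrev L1 : Type := lp (fun _ : ℤ => ℂ) 1

lemma summable_norm (v : L1) : Summable fun k => ‖v k‖ := by
  simpa using (lp.memℓp v).summable (by norm_num)

lemma norm_eq_tsum (v : L1) : ‖v‖ = ∑' k, ‖v k‖ := by
  simp [lp.norm_eq_tsum_rpow (show 0 < (1 : ℝ≥0∞).toReal by norm_num)]

/-- Translation by `j` on `ℓ¹(ℤ)`. -/
noncomputable def transl (j : ℤ) : L1 →L[ℂ] L1 :=
  LinearMap.mkContinuous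
    { toFun := fun x => (⟨fun k => x (k - j), by
        apply memℓp_gen
        simpa [Function.comp_def] using
          (Equiv.subRight j).summable_iff.2 (summable_norm x)⟩ : L1)
      map_add' := fun x y => by ext k; rfl
      map_smul' := fun c x => by ext k; rfl }
    1 fun x => by
      rw [norm_eq_tsum, norm_eq_tsum, one_mul]
      exact ((Equiv.subRight j).tsum_eq fun k => ‖x k‖).le

@[simp] lemma transl_apply (j : ℤ) (x : L1) (k : ℤ) : transl j x k = x (k - j) := rfl

lemma norm_transl_le (j : ℤ) : ‖transl j‖ ≤ 1 := LinearMap.mkContinuous_norm_le _ zero_le_one _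

lemma shiftL1_eq_transl : shiftL1 = transl 1 := rfl

lemma transl_zero : transl 0 = 1 := by
  ext x k; simp

lemma transl_mul (i j : ℤ) : transl i * transl j = transl (i + j) := by
  ext x k; simp [sub_sub]

lemma transl_pow (j : ℤ) (n : ℕ) : transl j ^ n = transl (n * j) := by
  induction n with
  | zero => simp [transl_zero]
  | succ n ih => rw [pow_succ, ih, transl_mul]; push_cast; ring_nf

lemma transl_single (j k : ℤ) (a : ℂ) : transl j (lp.single 1 k a) = lp.single 1 (k + j) a := by
  ext i
  simp [lp.single_apply, Pi.single_apply, sub_eq_iff_eq_add]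

lemma commute_transl {T : L1 →L[ℂ] L1} (hT : Commute T shiftL1) (j : ℤ) :
    Commute T (transl j) := by
  have hneg : Commute T (transl (-1)) := by
    have h : transl (-1) * transl 1 = 1 := by rw [transl_mul, ← transl_zero]; norm_num
    have h' : transl 1 * transl (-1) = 1 := by rw [transl_mul, ← transl_zero]; norm_num
    have hT' : T * transl 1 = transl 1 * T := hT
    calc T * transl (-1) = transl (-1) * transl 1 * T * transl (-1) := by rw [h, one_mul]
      _ = transl (-1) * (T * transl 1) * transl (-1) := by rw [hT']; simp only [mul_assoc]
      _ = transl (-1) * T * (transl 1 * transl (-1)) := by simp only [mul_assoc]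
      _ = transl (-1) * T := by rw [h', mul_one]
  obtain ⟨n, rfl | rfl⟩ := j.eq_nat_or_neg
  · simpa [transl_pow] using (show Commute T (transl 1) from hT).pow_right n
  · simpa [transl_pow] using hneg.pow_right n

lemma commute_transl_shift (j : ℤ) : Commute (transl j) shiftL1 := by
  rw [shiftL1_eq_transl, Commute, SemiconjBy, transl_mul, transl_mul, add_comm]

/-- The unit mass at the origin. -/
noncomputable def delta : L1 := lp.single 1 0 1

lemma norm_delta : ‖delta‖ = 1 := by
  rw [delta, lp.norm_single (by norm_num), norm_one]

lemma single_eq_smul (k : ℤ) (a : ℂ) : (lp.single 1 k a : L1) = a • transl k delta := by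
  rw [delta, transl_single, zero_add, ← lp.single_smul, smul_eq_mul, mul_one]

lemma hasSum_smul_transl_delta (v : L1) : HasSum (fun k => v k • transl k delta) v := by
  simpa only [single_eq_smul] using lp.hasSum_single (by norm_num) v

lemma eq_of_apply_delta {T R : L1 →L[ℂ] L1} (hT : Commute T shiftL1) (hR : Commute R shiftL1)
    (h : T delta = R delta) : T = R := by
  have key : ∀ k, T (transl k delta) = R (transl k delta) := fun k => by
    have h1 := DFunLike.congr_fun (commute_transl hT k) delta
    have h2 := DFunLike.congr_fun (commute_transl hR k) delta
    simp only [mul_apply_eq_comp] at h1 h2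
    rw [h1, h2, h]
  refine ContinuousLinearMap.ext fun v => ?_
  have h1 := (hasSum_smul_transl_delta v).mapL T
  have h2 := (hasSum_smul_transl_delta v).mapL R
  simp only [map_smul, key] at h1 h2
  exact h1.unique h2

lemma summable_smul_transl (v : L1) : Summable fun k => v k • transl k :=
  .of_norm_bounded (summable_norm v) fun k => by
    rw [norm_smul]
    exact mul_le_of_le_one_right (norm_nonneg _) (norm_transl_le k)

lemma commute_of_hasSum {ι : Type*} {F : ι → L1 →L[ℂ] L1} {T X : L1 →L[ℂ] L1} (h : HasSum F T)
    (hF : ∀ i, Commute (F i) X) : Commute T X := by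
  have h1 := h.mul_right X
  have h2 := h.mul_left X
  simp only [fun i => (hF i).eq] at h1
  exact h1.unique h2

lemma hasSum_transl {T : L1 →L[ℂ] L1} (hT : Commute T shiftL1) :
    HasSum (fun k => (T delta : L1) k • transl k) T := by
  have hs := (summable_smul_transl (T delta)).hasSum
  convert hs
  refine eq_of_apply_delta hT
    (commute_of_hasSum hs fun k => (commute_transl_shift k).smul_left _) ?_
  exact (hasSum_smul_transl_delta (T delta)).unique
    (hs.mapL (ContinuousLinearMap.apply ℂ L1 delta))

end Translations

section Symbols

/-- The value at `z` of the Fourier series with coefficient sequence `v`. -/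
noncomputable def evalL (z : Circle) : L1 →L[ℂ] ℂ :=
  LinearMap.mkContinuous
    { toFun := fun v => ∑' k, v k * (z : ℂ) ^ k
      map_add' := fun v w => by
        have hs : ∀ v : L1, Summable fun k => v k * (z : ℂ) ^ k := fun v =>
          .of_norm (by simpa [Circle.norm_coe] using summable_norm v)
        rw [← (hs v).tsum_add (hs w)]
        simp [add_mul]
      map_smul' := fun c v => by
        simp [mul_assoc, tsum_mul_left] }
    1 fun v => by
      rw [one_mul, norm_eq_tsum]
      refine (norm_tsum_le_tsum_norm ?_).trans_eq ?_
      · simpa [Circle.norm_coe] using summable_norm v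
      · simp [Circle.norm_coe]

lemma hasSum_evalL (z : Circle) (v : L1) : HasSum (fun k => v k * (z : ℂ) ^ k) (evalL z v) :=
  Summable.hasSum (.of_norm (by simpa [Circle.norm_coe] using summable_norm v))

lemma norm_evalL_le (z : Circle) (v : L1) : ‖evalL z v‖ ≤ ‖v‖ := by
  have h : ‖evalL z‖ ≤ 1 := LinearMap.mkContinuous_norm_le _ zero_le_one _
  simpa only [one_mul] using (evalL z).le_of_opNorm_le h v

lemma continuous_evalL (v : L1) : Continuous fun z => evalL z v := by
  have h : (fun z => evalL z v) = fun z : Circle => ∑' k, v k * (z : ℂ) ^ k :=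
    funext fun z => (hasSum_evalL z v).tsum_eq.symm
  rw [h]
  refine continuous_tsum (fun k => ?_) (summable_norm v) fun k z => ?_
  · exact continuous_const.mul
      (continuous_subtype_val.zpow₀ k fun z => Or.inl (Circle.coe_ne_zero z))
  · simp [Circle.norm_coe]

lemma evalL_transl_delta (z : Circle) (k : ℤ) : evalL z (transl k delta) = (z : ℂ) ^ k := by
  refine (hasSum_evalL z _).unique ?_
  convert hasSum_single k fun j hj => ?_
  · simp [delta]
  · have : j - k ≠ 0 := sub_ne_zero.2 hj
    simp [delta, lp.single_apply, this]

lemma evalL_transl (z : Circle) (k : ℤ) (v : L1) :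
    evalL z (transl k v) = (z : ℂ) ^ k * evalL z v := by
  refine (hasSum_evalL z _).unique ?_
  have h := (Equiv.subRight k).hasSum_iff.2 ((hasSum_evalL z v).mul_left ((z : ℂ) ^ k))
  have e : (fun j => transl k v j * (z : ℂ) ^ j) =
      (fun i => (z : ℂ) ^ k * (v i * (z : ℂ) ^ i)) ∘ Equiv.subRight k := by
    funext j
    have : (z : ℂ) ^ j = z ^ k * z ^ (j - k) := by
      rw [← zpow_add₀ (Circle.coe_ne_zero z), add_sub_cancel]
    simp only [Function.comp_apply, transl_apply, Equiv.subRight_apply, this]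
    ring
  rwa [e]

/-- The symbol at `z` of an operator. -/
noncomputable def sym (z : Circle) : (L1 →L[ℂ] L1) →L[ℂ] ℂ :=
  (evalL z).comp (ContinuousLinearMap.apply ℂ L1 delta)

lemma sym_apply (z : Circle) (T : L1 →L[ℂ] L1) : sym z T = evalL z (T delta) := rfl

lemma norm_apply_delta_le (T : L1 →L[ℂ] L1) : ‖T delta‖ ≤ ‖T‖ := by
  simpa [norm_delta] using T.le_opNorm delta

lemma norm_sym_le (z : Circle) (T : L1 →L[ℂ] L1) : ‖sym z T‖ ≤ ‖T‖ :=
  (norm_evalL_le _ _).trans (norm_apply_delta_le T)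

lemma continuous_sym (T : L1 →L[ℂ] L1) : Continuous fun z => sym z T := continuous_evalL _

lemma sym_transl (z : Circle) (k : ℤ) : sym z (transl k) = (z : ℂ) ^ k := evalL_transl_delta z k

lemma sym_one (z : Circle) : sym z 1 = 1 := by
  rw [← transl_zero, sym_transl, zpow_zero]

lemma evalL_apply {T : L1 →L[ℂ] L1} (hT : Commute T shiftL1) (z : Circle) (v : L1) :
    evalL z (T v) = sym z T * evalL z v := by
  have h := ((hasSum_smul_transl_delta v).mapL T).mapL (evalL z)
  have e : (fun k => evalL z (T (v k • transl k delta))) =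
      fun k => sym z T * (v k * (z : ℂ) ^ k) := by
    funext k
    have h1 := DFunLike.congr_fun (commute_transl hT k) delta
    simp only [mul_apply_eq_comp] at h1
    rw [map_smul, map_smul, h1, evalL_transl, sym_apply, smul_eq_mul]
    ring
  rw [e] at h
  exact h.unique ((hasSum_evalL z v).mul_left (sym z T))

lemma sym_mul {T : L1 →L[ℂ] L1} (hT : Commute T shiftL1) (R : L1 →L[ℂ] L1) (z : Circle) :
    sym z (T * R) = sym z T * sym z R := evalL_apply hT z _

lemma sym_pow {T : L1 →L[ℂ] L1} (hT : Commute T shiftL1) (n : ℕ) (z : Circle) :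
    sym z (T ^ n) = sym z T ^ n := by
  induction n with
  | zero => simp [sym_one]
  | succ n ih => rw [pow_succ, sym_mul (hT.pow_left n), ih, pow_succ]

lemma sym_exp {T : L1 →L[ℂ] L1} (hT : Commute T shiftL1) (z : Circle) :
    sym z (NormedSpace.exp T) = exp (sym z T) := by
  have h1 := (NormedSpace.exp_series_hasSum_exp' (𝕂 := ℂ) T).mapL (sym z)
  have h2 := NormedSpace.exp_series_hasSum_exp' (𝕂 := ℂ) (sym z T)
  rw [Complex.exp_eq_exp_ℂ]
  refine h1.unique ?_
  simpa only [map_smul, sym_pow hT] using h2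

lemma integral_evalL (v : L1) :
    ∫ x in (0 : ℝ)..2 * Real.pi, evalL (Circle.exp x) v = 2 * Real.pi * v 0 := by
  have key := intervalIntegral.hasSum_integral_of_dominated_convergence (μ := MeasureTheory.volume)
    (a := 0) (b := 2 * Real.pi)
    (F := fun (k : ℤ) (x : ℝ) => v k * (Circle.exp x : ℂ) ^ k)
    (f := fun x => evalL (Circle.exp x) v) (bound := fun k _ => ‖v k‖)
    (fun k => by
      refine Continuous.aestronglyMeasurable ?_
      simp only [Circle.coe_exp, ← Complex.exp_int_mul]
      fun_prop)
    (fun k => .of_forall fun x _ => by simp)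
    (.of_forall fun x _ => summable_norm v) (by simp)
    (.of_forall fun x _ => hasSum_evalL _ _)
  refine key.unique ?_
  convert hasSum_single (0 : ℤ) fun k hk => ?_ using 1
  · simp
  · have hk' : (k : ℂ) * I ≠ 0 := mul_ne_zero (by exact_mod_cast hk) I_ne_zero
    have e : ∀ x : ℝ, (Circle.exp x : ℂ) ^ k = exp (k * I * x) := fun x => by
      rw [Circle.coe_exp, ← Complex.exp_int_mul]; ring_nf
    simp only [e, intervalIntegral.integral_const_mul]
    rw [integral_exp_mul_complex hk']
    have e2 : (k : ℂ) * I * (2 * Real.pi : ℝ) = k * (2 * Real.pi * I) := by push_cast; ring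
    rw [e2, Complex.exp_int_mul_two_pi_mul_I]
    simp

/-- An element of `ℓ¹(ℤ)` is determined by its Fourier series. -/
lemma eq_of_evalL_eq {v w : L1} (h : ∀ z, evalL z v = evalL z w) : v = w := by
  ext k
  have h1 := integral_evalL (transl (-k) v)
  have h2 := integral_evalL (transl (-k) w)
  simp only [evalL_transl, h] at h1 h2
  rw [h1] at h2
  have h0 : (2 * Real.pi : ℂ) ≠ 0 := by exact_mod_cast Real.two_pi_pos.ne'
  simpa using mul_left_cancel₀ h0 h2

end Symbols

section Logarithm

/-- A function on the circle of the form `z ↦ z ^ ν * exp (ℓ z)`, where `ℓ` is an absolutely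
convergent Fourier series. -/
def Liftable (g : Circle → ℂ) : Prop :=
  ∃ (ν : ℤ) (L : L1 →L[ℂ] L1), Commute L shiftL1 ∧ ∀ z, g z = (z : ℂ) ^ ν * exp (sym z L)

lemma Liftable.mul {g h : Circle → ℂ} (hg : Liftable g) (hh : Liftable h) :
    Liftable fun z => g z * h z := by
  obtain ⟨ν, L, hL, hg⟩ := hg
  obtain ⟨μ, M, hM, hh⟩ := hh
  refine ⟨ν + μ, L + M, hL.add_left hM, fun z => ?_⟩
  simp only [hg, hh]
  rw [map_add, exp_add, zpow_add₀ (Circle.coe_ne_zero z)]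
  ring

lemma Liftable.inv {g : Circle → ℂ} (hg : Liftable g) : Liftable fun z => (g z)⁻¹ := by
  obtain ⟨ν, L, hL, hg⟩ := hg
  refine ⟨-ν, -L, hL.neg_left, fun z => ?_⟩
  simp only [hg]
  rw [map_neg, exp_neg, zpow_neg, mul_inv]

lemma liftable_zpow (ν : ℤ) : Liftable fun z => (z : ℂ) ^ ν :=
  ⟨ν, 0, Commute.zero_left _, fun z => by simp⟩

lemma liftable_const {a : ℂ} (ha : a ≠ 0) : Liftable fun _ => a :=
  ⟨0, log a • 1, (Commute.one_left _).smul_left _, fun z => by simp [sym_one, exp_log ha]⟩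

lemma liftable_one_sub {R : L1 →L[ℂ] L1} (hR : Commute R shiftL1) (hR1 : ‖R‖ < 1) :
    Liftable fun z => 1 - sym z R := by
  have hs : Summable fun n : ℕ => (n : ℂ)⁻¹ • R ^ n := by
    rw [← summable_nat_add_iff 1]
    refine .of_norm_bounded ((summable_nat_add_iff 1).2
      (summable_geometric_of_lt_one (norm_nonneg R) hR1)) fun n => ?_
    rw [norm_smul]
    refine (mul_le_of_le_one_left (norm_nonneg _) ?_).trans (norm_pow_le' R n.succ_pos)
    rw [norm_inv, Complex.norm_natCast]
    exact inv_le_one_of_one_le₀ (by exact_mod_cast n.succ_pos)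
  refine ⟨0, -∑' n : ℕ, (n : ℂ)⁻¹ • R ^ n,
    (commute_of_hasSum hs.hasSum fun n => (hR.pow_left n).smul_left _).neg_left, fun z => ?_⟩
  have hz : ‖sym z R‖ < 1 := (norm_sym_le z R).trans_lt hR1
  have h1 := hs.hasSum.mapL (sym z)
  have h2 := Complex.hasSum_taylorSeries_neg_log hz
  have e : (fun n : ℕ => sym z ((n : ℂ)⁻¹ • R ^ n)) = fun n : ℕ => sym z R ^ n / n := by
    funext n
    rw [map_smul, sym_pow hR, smul_eq_mul, div_eq_inv_mul]
  rw [e] at h1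
  have hne : 1 - sym z R ≠ 0 := fun h => by
    rw [sub_eq_zero] at h
    rw [← h, norm_one] at hz
    exact lt_irrefl _ hz
  rw [map_neg, h1.unique h2, neg_neg, exp_log hne, zpow_zero, one_mul]

lemma liftable_sub_const {a : ℂ} (ha : ‖a‖ ≠ 1) : Liftable fun z => (z : ℂ) - a := by
  rcases lt_or_gt_of_ne ha with h | h
  · have hR : ‖a • transl (-1)‖ < 1 := by
      rw [norm_smul]
      exact (mul_le_of_le_one_right (norm_nonneg a) (norm_transl_le _)).trans_lt h
    convert (liftable_zpow 1).mul
      (liftable_one_sub ((commute_transl_shift (-1)).smul_left a) hR) using 2 with z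
    have := Circle.coe_ne_zero z
    rw [map_smul, sym_transl, smul_eq_mul, zpow_one, zpow_neg_one]
    field_simp
  · have ha0 : a ≠ 0 := norm_pos_iff.1 (by linarith)
    have hR : ‖a⁻¹ • transl 1‖ < 1 := by
      rw [norm_smul, norm_inv]
      exact (mul_le_of_le_one_right (by positivity) (norm_transl_le _)).trans_lt
        (inv_lt_one_of_one_lt₀ h)
    convert (liftable_const (neg_ne_zero.2 ha0)).mul
      (liftable_one_sub ((commute_transl_shift 1).smul_left a⁻¹) hR) using 2 with z
    rw [map_smul, sym_transl, smul_eq_mul, zpow_one]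
    field_simp
    ring

lemma liftable_eval (Q : Polynomial ℂ) (hQ : ∀ z : Circle, Q.eval (z : ℂ) ≠ 0) :
    Liftable fun z => Q.eval (z : ℂ) := by
  have hQ0 : Q ≠ 0 := by
    rintro rfl
    exact hQ 1 (by simp)
  have hfac : ∀ z : ℂ, Q.eval z = Q.leadingCoeff * (Q.roots.map fun a => z - a).prod := fun z => by
    conv_lhs => rw [(IsAlgClosed.splits Q).eq_prod_roots]
    simp [Polynomial.eval_multiset_prod, Multiset.map_map]
  have hroots : ∀ a ∈ Q.roots, ‖a‖ ≠ 1 := fun a ha h1 => by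
    refine hQ ⟨a, mem_sphere_zero_iff_norm.2 h1⟩ ?_
    exact (Polynomial.mem_roots hQ0).1 ha
  have hprod : ∀ s : Multiset ℂ, (∀ a ∈ s, ‖a‖ ≠ 1) →
      Liftable fun z => (s.map fun a => (z : ℂ) - a).prod := fun s => by
    induction s using Multiset.induction_on with
    | empty => simpa using liftable_const one_ne_zero
    | cons a s ih =>
      intro h
      simp only [Multiset.map_cons, Multiset.prod_cons]
      exact (liftable_sub_const (h a (by simp))).mul (ih fun b hb => h b (by simp [hb]))
  simp only [hfac]
  exact (liftable_const (Polynomial.leadingCoeff_ne_zero.2 hQ0)).mul (hprod _ hroots)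

lemma liftable_sum_zpow (F : Finset ℤ) (c : ℤ → ℂ)
    (h : ∀ z : Circle, ∑ k ∈ F, c k * (z : ℂ) ^ k ≠ 0) :
    Liftable fun z => ∑ k ∈ F, c k * (z : ℂ) ^ k := by
  obtain ⟨N, hN⟩ : ∃ N : ℤ, ∀ k ∈ F, 0 ≤ k + N := by
    refine ⟨∑ k ∈ F, |k|, fun k hk => ?_⟩
    have h1 := Finset.single_le_sum (f := fun k : ℤ => |k|) (fun i _ => abs_nonneg i) hk
    have h2 := neg_abs_le k
    linarith
  set Q : Polynomial ℂ := ∑ k ∈ F, Polynomial.C (c k) * Polynomial.X ^ (k + N).toNat with hQ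
  have e : ∀ z : Circle, ∑ k ∈ F, c k * (z : ℂ) ^ k = (z : ℂ) ^ (-N) * Q.eval (z : ℂ) := fun z => by
    rw [hQ, Polynomial.eval_finsetSum, Finset.mul_sum]
    refine Finset.sum_congr rfl fun k hk => ?_
    have h1 : (z : ℂ) ^ k = z ^ (-N) * z ^ ((k + N).toNat) := by
      rw [← zpow_natCast, Int.toNat_of_nonneg (hN k hk), ← zpow_add₀ (Circle.coe_ne_zero z)]
      ring_nf
    simp [h1]
    ring
  simp only [e] at h ⊢
  exact (liftable_zpow _).mul (liftable_eval Q fun z => right_ne_zero_of_mul (h z))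

/-- Symbols of invertible translation-invariant operators have a logarithm up to a monomial. -/
theorem liftable_sym (U : (L1 →L[ℂ] L1)ˣ) (hU : Commute (U : L1 →L[ℂ] L1) shiftL1) :
    Liftable fun z => sym z U := by
  have hU' : Commute ((U⁻¹ : (L1 →L[ℂ] L1)ˣ) : L1 →L[ℂ] L1) shiftL1 := hU.units_inv_left
  set V : L1 →L[ℂ] L1 := ((U⁻¹ : (L1 →L[ℂ] L1)ˣ) : L1 →L[ℂ] L1) with hV
  have hVU : V * U = 1 := U.inv_mul
  have hδ : 0 < 1 / (‖V‖ + 1) := by positivity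
  obtain ⟨F, hF⟩ := ((hasSum_transl hU).eventually (Metric.ball_mem_nhds _ hδ)).exists
  set P : L1 →L[ℂ] L1 := ∑ k ∈ F, ((U : L1 →L[ℂ] L1) delta : L1) k • transl k with hP
  have hPc : Commute P shiftL1 :=
    Commute.sum_left _ _ _ fun k _ => (commute_transl_shift k).smul_left _
  have hR : Commute (1 - V * P) shiftL1 := (Commute.one_left _).sub_left (hU'.mul_left hPc)
  have hR1 : ‖1 - V * P‖ < 1 := by
    rw [← hVU, ← mul_sub]
    rw [dist_eq_norm, norm_sub_rev] at hF
    calc ‖V * (U - P)‖ ≤ ‖V‖ * (1 / (‖V‖ + 1)) :=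
          (norm_mul_le _ _).trans (mul_le_mul_of_nonneg_left hF.le (norm_nonneg V))
      _ < 1 := by rw [mul_one_div, div_lt_one (by positivity)]; linarith
  have hsymV : ∀ z, sym z V * sym z U = 1 := fun z => by rw [← sym_mul hU', hVU, sym_one]
  have hsym : ∀ z, 1 - sym z (1 - V * P) = sym z V * sym z P := fun z => by
    rw [map_sub, sym_one, sym_mul hU', sub_sub_cancel]
  have hPz : ∀ z, sym z P = ∑ k ∈ F, ((U : L1 →L[ℂ] L1) delta : L1) k * (z : ℂ) ^ k := fun z => by
    simp [hP, sym_transl]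
  have hne : ∀ z, sym z P ≠ 0 := fun z h0 => by
    have h1 := hsym z
    rw [h0, mul_zero, sub_eq_zero] at h1
    have h2 := (norm_sym_le z _).trans_lt hR1
    rw [← h1, norm_one] at h2
    exact lt_irrefl _ h2
  have h1 := liftable_sum_zpow F (fun k => ((U : L1 →L[ℂ] L1) delta : L1) k)
    fun z => by rw [← hPz]; exact hne z
  convert h1.mul (liftable_one_sub hR hR1).inv using 2 with z
  rw [hsym, ← hPz, mul_inv, mul_comm, mul_assoc, inv_mul_cancel₀ (hne z), mul_one]
  exact eq_inv_of_mul_eq_one_right (hsymV z)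

end Logarithm

section Balanced

/-- If an integer-valued function is not nearly constant, then some residue class modulo a power
of two is attained on a set of intermediate density. -/
lemma exists_balanced_residue_class {ι : Type*} [Fintype ι] {η : ℝ} (hη : η ≤ 1 / 3) (a : ι → ℤ)
    (h : ∀ M : Finset ι, (∀ i ∈ M, ∀ j ∈ M, a i = a j) →
      (M.card : ℝ) ≤ (1 - η) * Fintype.card ι) :
    ∃ (r : ℕ) (c : ℤ) (A : Finset ι), (∀ j, j ∈ A ↔ (2 : ℤ) ^ r ∣ a j - c) ∧
      η * Fintype.card ι ≤ A.card ∧ (A.card : ℝ) ≤ (1 - η) * Fintype.card ι := by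
  by_contra! hcon
  have key : ∀ (r : ℕ), ∃ (c : ℤ) (A : Finset ι), (∀ j, j ∈ A ↔ (2 : ℤ) ^ r ∣ a j - c) ∧
      (1 - η) * Fintype.card ι < A.card := by
    intro r
    induction r with
    | zero =>
      refine ⟨0, Finset.univ, fun j => by simp, hcon 0 0 Finset.univ (fun j => by simp) ?_⟩
      rw [Finset.card_univ]
      nlinarith [Nat.cast_nonneg (α := ℝ) (Fintype.card ι)]
    | succ r ih =>
      obtain ⟨c, A, hA, hcard⟩ := ih
      set A₁ := A.filter fun j => (2 : ℤ) ^ (r + 1) ∣ a j - c with hA₁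
      set A₂ := A.filter fun j => ¬ (2 : ℤ) ^ (r + 1) ∣ a j - c with hA₂
      have hsum : (A₁.card : ℝ) + A₂.card = A.card := by
        exact_mod_cast Finset.card_filter_add_card_filter_not _
      have h₁ : ∀ j, j ∈ A₁ ↔ (2 : ℤ) ^ (r + 1) ∣ a j - c := fun j => by
        rw [hA₁, Finset.mem_filter, hA]
        exact and_iff_right_of_imp fun h => (pow_dvd_pow 2 r.le_succ).trans h
      have h₂ : ∀ j, j ∈ A₂ ↔ (2 : ℤ) ^ (r + 1) ∣ a j - (c + 2 ^ r) := fun j => by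
        rw [hA₂, Finset.mem_filter, hA, pow_succ]
        constructor
        · rintro ⟨⟨k, hk⟩, hn⟩
          rcases Int.even_or_odd' k with ⟨l, rfl | rfl⟩
          · exact absurd ⟨l, by rw [hk]; ring⟩ hn
          · exact ⟨l, by rw [← sub_sub, hk]; ring⟩
        · rintro ⟨k, hk⟩
          have hk' : a j - c = 2 ^ r * (2 * k + 1) := by linear_combination hk
          refine ⟨⟨_, hk'⟩, ?_⟩
          rw [hk']
          intro hd
          have := (mul_dvd_mul_iff_left (pow_ne_zero r (two_ne_zero (α := ℤ)))).1 hd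
          omega
      have hn := Nat.cast_nonneg (α := ℝ) (Fintype.card ι)
      rcases le_total A₁.card A₂.card with hle | hle
      · have hle' : (A₁.card : ℝ) ≤ A₂.card := by exact_mod_cast hle
        exact ⟨_, A₂, h₂, hcon _ _ _ h₂ (by nlinarith)⟩
      · have hle' : (A₂.card : ℝ) ≤ A₁.card := by exact_mod_cast hle
        exact ⟨_, A₁, h₁, hcon _ _ _ h₁ (by nlinarith)⟩
  set B := ∑ j, (a j).natAbs with hB
  obtain ⟨c, A, hA, hcard⟩ := key (2 * B + 1)
  refine absurd (h A fun i hi j hj => ?_) (not_le.2 hcard)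
  have hdvd := dvd_sub ((hA i).1 hi) ((hA j).1 hj)
  rw [sub_sub_sub_cancel_right] at hdvd
  have hle : ∀ i, (a i).natAbs ≤ B := fun i =>
    Finset.single_le_sum (f := fun j => (a j).natAbs) (fun _ _ => Nat.zero_le _) (Finset.mem_univ i)
  have hlt : (2 * B + 1 : ℤ) < 2 ^ (2 * B + 1) := by exact_mod_cast Nat.lt_two_pow_self
  refine sub_eq_zero.1 (Int.eq_zero_of_abs_lt_dvd hdvd (lt_of_le_of_lt ?_ hlt))
  have h1 := hle i
  have h2 := hle j
  rw [abs_le]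
  omega

/-- Simultaneous Diophantine approximation. -/
lemma exists_simultaneous_approx {ι : Type*} [Fintype ι] (φ : ι → ℝ) {q : ℕ} (hq : 0 < q) :
    ∃ m : ℕ, 1 ≤ m ∧ m ≤ q ^ Fintype.card ι ∧ ∃ a : ι → ℤ, ∀ j, |m * φ j - a j| ≤ 1 / q := by
  classical
  have hq' : (0 : ℝ) < q := by exact_mod_cast hq
  have hlt : ∀ x : ℝ, ⌊q * Int.fract x⌋₊ < q := fun x => by
    rw [Nat.floor_lt (by positivity)]
    exact mul_lt_of_lt_one_right hq' (Int.fract_lt_one x)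
  obtain ⟨m₁, m₂, hne, heq⟩ := Fintype.exists_ne_map_eq_of_card_lt
    (fun (m : Fin (q ^ Fintype.card ι + 1)) (j : ι) =>
      (⟨⌊q * Int.fract (m * φ j)⌋₊, hlt _⟩ : Fin q)) (by simp)
  wlog h : m₁ < m₂ generalizing m₁ m₂
  · exact this m₂ m₁ hne.symm heq.symm (lt_of_le_of_ne (not_lt.1 h) hne.symm)
  have h' : (m₁ : ℕ) < m₂ := h
  refine ⟨m₂ - m₁, by omega, by omega, fun j => ⌊m₂ * φ j⌋ - ⌊m₁ * φ j⌋, fun j => ?_⟩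
  have hj : ⌊q * Int.fract (m₁ * φ j)⌋₊ = ⌊q * Int.fract (m₂ * φ j)⌋₊ := by
    simpa using congrFun heq j
  have e : ((m₂ - m₁ : ℕ) : ℝ) * φ j - ((⌊m₂ * φ j⌋ - ⌊m₁ * φ j⌋ : ℤ) : ℝ) =
      Int.fract (m₂ * φ j) - Int.fract (m₁ * φ j) := by
    rw [Nat.cast_sub h'.le, Int.fract, Int.fract]
    push_cast
    ring
  rw [e, le_div_iff₀ hq', ← abs_of_pos hq', ← abs_mul, abs_le]
  have a1 := Nat.floor_le (show 0 ≤ q * Int.fract (m₁ * φ j) by positivity)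
  have a2 := Nat.lt_floor_add_one (q * Int.fract (m₁ * φ j))
  have b1 := Nat.floor_le (show 0 ≤ q * Int.fract (m₂ * φ j) by positivity)
  have b2 := Nat.lt_floor_add_one (q * Int.fract (m₂ * φ j))
  rw [hj] at a1 a2
  constructor <;> nlinarith

lemma norm_exp_I_sub_exp_I_le (x y : ℝ) : ‖exp (I * x) - exp (I * y)‖ ≤ |x - y| := by
  have e : exp (I * x) - exp (I * y) = exp (I * y) * (exp (I * (x - y : ℝ)) - 1) := by
    rw [mul_sub, ← exp_add]; push_cast; ring_nf
  rw [e, norm_mul, mul_comm I (y : ℂ), norm_exp_ofReal_mul_I, one_mul, ← Real.norm_eq_abs]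
  exact Real.norm_exp_I_mul_ofReal_sub_one_le

/-- Detecting divisibility by averaging characters. -/
lemma average_exp_eq_ite {R : ℕ} (hR : 0 < R) (b : ℤ) :
    (R : ℂ)⁻¹ * ∑ n ∈ Finset.range R, exp (I * (2 * Real.pi * (n / R) * b : ℝ)) =
      if (R : ℤ) ∣ b then 1 else 0 := by
  have hR' : (R : ℂ) ≠ 0 := by exact_mod_cast hR.ne'
  set ω := exp (I * (2 * Real.pi * b / R : ℝ)) with hω
  have e : ∀ n : ℕ, exp (I * (2 * Real.pi * (n / R) * b : ℝ)) = ω ^ n := fun n => by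
    rw [hω, ← exp_nat_mul]; push_cast; ring_nf
  have hpow : ω ^ R = 1 := by
    rw [hω, ← exp_nat_mul, exp_eq_one_iff]
    refine ⟨b, ?_⟩
    push_cast
    field_simp
  have hω1 : ω = 1 ↔ (R : ℤ) ∣ b := by
    rw [hω, exp_eq_one_iff]
    have hpi : (Real.pi : ℂ) ≠ 0 := by exact_mod_cast Real.pi_ne_zero
    constructor
    · rintro ⟨k, hk⟩
      refine ⟨k, ?_⟩
      push_cast at hk
      field_simp at hk
      have : (b : ℂ) = R * k := by linear_combination hk
      exact_mod_cast this
    · rintro ⟨k, rfl⟩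
      refine ⟨k, ?_⟩
      push_cast
      field_simp
  simp only [e]
  split_ifs with h
  · simp [hω1.2 h, hR']
  · rw [geom_sum_eq (mt hω1.1 h), hpow]; simp

/-- Near any point of the circle there is a positive proportion of `p`-th roots of unity. -/
lemma exists_card_near_ge {θ : Circle → ℝ} (hθ : Continuous θ) (z : Circle) {κ : ℝ} (hκ : 0 < κ) :
    ∃ η : ℝ, 0 < η ∧ ∃ p₀ : ℕ, ∀ (p : ℕ) [NeZero p], p₀ ≤ p →
      η * p ≤ (Finset.univ.filter fun j : ZMod p => |θ (ZMod.toCircle j) - θ z| < κ).card := by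
  obtain ⟨x, rfl⟩ : ∃ x : ℝ, Circle.exp (2 * Real.pi * x) = z := by
    refine ⟨arg z / (2 * Real.pi), ?_⟩
    rw [mul_div_cancel₀ _ Real.two_pi_pos.ne', Circle.exp_arg]
  have hc : Continuous fun y : ℝ => θ (Circle.exp (2 * Real.pi * y)) := by fun_prop
  obtain ⟨δ', hδ', hball'⟩ := Metric.continuous_iff.1 hc x κ hκ
  obtain ⟨δ, hδ, hδ1, hball⟩ : ∃ δ : ℝ, 0 < δ ∧ δ ≤ 1 ∧ ∀ y, |y - x| < δ →
      |θ (Circle.exp (2 * Real.pi * y)) - θ (Circle.exp (2 * Real.pi * x))| < κ := by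
    refine ⟨min δ' 1, by positivity, min_le_right _ _, fun y hy => ?_⟩
    exact hball' y (hy.trans_le (min_le_left _ _))
  refine ⟨δ / 4, by positivity, ⌈4 / δ⌉₊, fun p _ hp => ?_⟩
  have hp1 : 4 / δ ≤ p := Nat.ceil_le.1 hp
  have hp0 : (0 : ℝ) < p := lt_of_lt_of_le (by positivity) hp1
  rw [div_le_iff₀ hδ] at hp1
  set K := ⌊δ * p / 2⌋₊ with hK
  have hK1 := Nat.floor_le (show 0 ≤ δ * p / 2 by positivity)
  have hK2 := Nat.lt_floor_add_one (δ * p / 2)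
  have hKp : (K : ℝ) < p := by nlinarith
  have hKp' : K < p := by exact_mod_cast hKp
  have hcard : K ≤ (Finset.univ.filter fun j : ZMod p =>
      |θ (ZMod.toCircle j) - θ (Circle.exp (2 * Real.pi * x))| < κ).card := by
    rw [← Finset.card_range K]
    refine Finset.card_le_card_of_injOn (fun k => ((⌈p * x⌉ + k : ℤ) : ZMod p)) ?_ ?_
    · intro k hk
      have hk' : (k : ℝ) < K := by exact_mod_cast Finset.mem_range.1 hk
      simp only [Finset.coe_filter, Finset.mem_univ, true_and, Set.mem_ofPred_eq]
      have e : ZMod.toCircle ((⌈p * x⌉ + k : ℤ) : ZMod p) =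
          Circle.exp (2 * Real.pi * ((⌈p * x⌉ + k : ℤ) / p : ℝ)) := by
        ext
        rw [ZMod.toCircle_intCast, Circle.coe_exp]
        push_cast
        ring_nf
      rw [e]
      refine hball _ ?_
      have h1 := Int.le_ceil (p * x)
      have h2 := Int.ceil_lt_add_one (p * x)
      have e2 : ((⌈p * x⌉ + k : ℤ) / p : ℝ) - x = ((⌈p * x⌉ : ℝ) + k - p * x) / p := by
        push_cast; field_simp
      have hk0 := Nat.cast_nonneg (α := ℝ) k
      rw [e2, abs_of_nonneg (div_nonneg (by linarith) hp0.le), div_lt_iff₀ hp0]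
      linarith
    · intro k hk l hl hkl
      have hk' := Finset.mem_range.1 hk
      have hl' := Finset.mem_range.1 hl
      push_cast at hkl
      have h1 := add_left_cancel hkl
      rw [ZMod.natCast_eq_natCast_iff] at h1
      exact Nat.ModEq.eq_of_lt_of_lt h1 (by omega) (by omega)
  have hcard' : (K : ℝ) ≤ _ := Nat.cast_le.2 hcard
  linarith

/-- A nonconstant continuous function is not nearly constant on almost all `p`-th roots of
unity. -/
lemma exists_card_le_of_osc_lt {θ : Circle → ℝ} (hθ : Continuous θ) {z w : Circle}
    (hzw : θ z ≠ θ w) :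
    ∃ κ : ℝ, 0 < κ ∧ ∃ η : ℝ, 0 < η ∧ η ≤ 1 / 3 ∧ ∃ p₀ : ℕ, ∀ (p : ℕ) [NeZero p], p₀ ≤ p →
      ∀ M : Finset (ZMod p),
        (∀ i ∈ M, ∀ j ∈ M, |θ (ZMod.toCircle i) - θ (ZMod.toCircle j)| < κ) →
        (M.card : ℝ) ≤ (1 - η) * p := by
  have hκ : 0 < |θ z - θ w| / 3 := by
    have := abs_pos.2 (sub_ne_zero.2 hzw)
    positivity
  set κ := |θ z - θ w| / 3 with hκd
  obtain ⟨η₁, hη₁, p₁, h₁⟩ := exists_card_near_ge hθ z hκ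
  obtain ⟨η₂, hη₂, p₂, h₂⟩ := exists_card_near_ge hθ w hκ
  refine ⟨κ, hκ, min (min η₁ η₂) (1 / 3), by positivity, min_le_right _ _, max p₁ p₂, ?_⟩
  intro p _ hp M hM
  have hp0 := Nat.cast_nonneg (α := ℝ) p
  have main : ∀ (y : Circle) (η : ℝ), min (min η₁ η₂) (1 / 3) ≤ η →
      η * p ≤ (Finset.univ.filter fun j : ZMod p => |θ (ZMod.toCircle j) - θ y| < κ).card →
      (∀ j ∈ M, ¬ |θ (ZMod.toCircle j) - θ y| < κ) →
      (M.card : ℝ) ≤ (1 - min (min η₁ η₂) (1 / 3)) * p := by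
    intro y η hle hcard hdisj
    have h1 : M.card + (Finset.univ.filter fun j : ZMod p =>
        |θ (ZMod.toCircle j) - θ y| < κ).card ≤ p := by
      rw [← Finset.card_union_of_disjoint]
      · exact (Finset.card_le_univ _).trans_eq (ZMod.card p)
      · exact Finset.disjoint_left.2 fun j hj hj' => hdisj j hj (Finset.mem_filter.1 hj').2
    have h2 : (M.card : ℝ) + ((Finset.univ.filter fun j : ZMod p =>
        |θ (ZMod.toCircle j) - θ y| < κ).card : ℝ) ≤ p := by exact_mod_cast h1
    have h3 := mul_le_mul_of_nonneg_right hle hp0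
    linarith
  by_cases hz : ∀ j ∈ M, ¬ |θ (ZMod.toCircle j) - θ z| < κ
  · exact main z η₁ ((min_le_left _ _).trans (min_le_left _ _))
      (h₁ p ((le_max_left _ _).trans hp)) hz
  · push Not at hz
    obtain ⟨i, hi, hi'⟩ := hz
    refine main w η₂ ((min_le_left _ _).trans (min_le_right _ _))
      (h₂ p ((le_max_right _ _).trans hp)) fun j hj hj' => ?_
    have h3 := hM i hi j hj
    have h4 : |θ z - θ w| = 3 * κ := by rw [hκd]; ring
    have h5 : |θ z - θ w| < 3 * κ := by
      rw [abs_lt] at hi' hj' h3 ⊢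
      constructor <;> linarith [hi'.1, hi'.2, hj'.1, hj'.2, h3.1, h3.2]
    linarith

end Balanced

section Growth

lemma exists_finset_norm_sub_le (v : L1) {ε : ℝ} (hε : 0 < ε) :
    ∃ s : Finset ℤ, ∀ z : Circle, ‖∑ k ∈ s, v k * (z : ℂ) ^ k - evalL z v‖ ≤ ε := by
  obtain ⟨s, hs⟩ := ((hasSum_smul_transl_delta v).eventually (Metric.ball_mem_nhds _ hε)).exists
  refine ⟨s, fun z => ?_⟩
  have e : ∑ k ∈ s, v k * (z : ℂ) ^ k = evalL z (∑ k ∈ s, v k • transl k delta) := by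
    simp [map_sum, evalL_transl_delta]
  rw [e, ← map_sub]
  refine (norm_evalL_le z _).trans ?_
  rw [← dist_eq_norm]
  exact le_of_lt hs

lemma sum_norm_le_norm (v : L1) (s : Finset ℤ) : ∑ k ∈ s, ‖v k‖ ≤ ‖v‖ := by
  rw [norm_eq_tsum]
  exact (summable_norm v).sum_le_tsum s fun _ _ => norm_nonneg _

/-- If `θ` is continuous and not constant, the Wiener norms of `exp (i t θ)` cannot be uniformly
small on a long range of `t`. -/
theorem log_le_of_norm_exp_le {θ : Circle → ℝ} (hθ : Continuous θ) {z w : Circle}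
    (hzw : θ z ≠ θ w) :
    ∃ C : ℝ, 0 < C ∧ ∃ q : ℕ, 2 ≤ q ∧ ∃ p₀ : ℕ, ∀ (p : ℕ) [Fact p.Prime], p₀ ≤ p →
      ∀ K : ℝ, 1 ≤ K →
      (∀ t : ℝ, 0 ≤ t → t ≤ (q : ℝ) ^ p →
        ∃ v : L1, (∀ z, evalL z v = exp (I * (t * θ z : ℝ))) ∧ ‖v‖ ≤ K) →
      Real.log p ≤ C * K ^ 12 := by
  obtain ⟨κ, hκ, η, hη, hη1, p₀, hosc⟩ := exists_card_le_of_osc_lt hθ hzw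
  obtain ⟨C, hC, hlog⟩ := log_le_of_near_indicator (ι := ℤ) hη hη1
  have hpi := Real.pi_pos
  obtain ⟨q, hq⟩ := exists_nat_gt (max 2 (max (32 * Real.pi / η) (4 * Real.pi / κ)))
  simp only [max_lt_iff] at hq
  obtain ⟨hq2, hqη, hqκ⟩ := hq
  have hq0 : (0 : ℝ) < q := by linarith
  rw [div_lt_iff₀ hη] at hqη
  rw [div_lt_iff₀ hκ] at hqκ
  refine ⟨C, hC, q, by exact_mod_cast hq2.le, p₀, fun p _ hp K hK hv => ?_⟩
  set φ : ZMod p → ℝ := fun j => θ (ZMod.toCircle j) / (2 * Real.pi) with hφ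
  have hθφ : ∀ j, θ (ZMod.toCircle j) = 2 * Real.pi * φ j := fun j => by
    rw [hφ]; field_simp
  obtain ⟨m, hm1, hm, a, ha⟩ := exists_simultaneous_approx φ (q := q) (by exact_mod_cast hq0)
  rw [ZMod.card] at hm
  have hm1' : (1 : ℝ) ≤ m := by exact_mod_cast hm1
  obtain ⟨r, c, A, hA, hA1, hA2⟩ := exists_balanced_residue_class hη1 a fun M hM => by
    rw [ZMod.card]
    refine hosc p hp M fun i hi j hj => ?_
    have h1 := ha i
    have h2 := ha j
    rw [hM i hi j hj] at h1
    have h3 : |φ i - φ j| ≤ 2 / q := by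
      calc |φ i - φ j| ≤ m * |φ i - φ j| := le_mul_of_one_le_left (abs_nonneg _) hm1'
        _ = |(m * φ i - a j) - (m * φ j - a j)| := by
            rw [sub_sub_sub_cancel_right, ← mul_sub, abs_mul, abs_of_pos (by linarith : 0 < (m : ℝ))]
        _ ≤ |m * φ i - a j| + |m * φ j - a j| := abs_sub _ _
        _ ≤ 1 / q + 1 / q := add_le_add h1 h2
        _ = 2 / q := by ring
    rw [hθφ, hθφ, ← mul_sub, abs_mul, abs_of_pos Real.two_pi_pos]
    calc 2 * Real.pi * |φ i - φ j| ≤ 2 * Real.pi * (2 / q) := by gcongr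
      _ = 4 * Real.pi / q := by ring
      _ < κ := by rw [div_lt_iff₀ hq0]; linarith
  rw [ZMod.card] at hA1 hA2
  set R : ℕ := 2 ^ r with hR
  have hR0 : 0 < R := by positivity
  have hR0' : (0 : ℝ) < R := by exact_mod_cast hR0
  have hfrac : ∀ n ∈ Finset.range R, (n : ℝ) / R ≤ 1 := fun n hn => by
    rw [div_le_one hR0']
    exact_mod_cast (Finset.mem_range.1 hn).le
  have hv' : ∀ n ∈ Finset.range R, ∃ v : L1,
      (∀ z, evalL z v = exp (I * (n / R * m * θ z : ℝ))) ∧ ‖v‖ ≤ K := fun n hn => by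
    refine hv _ (by positivity) ?_
    calc (n : ℝ) / R * m ≤ 1 * m := mul_le_mul_of_nonneg_right (hfrac n hn) (by positivity)
      _ ≤ (q : ℝ) ^ p := by rw [one_mul]; exact_mod_cast hm
  choose! v hv₁ hv₂ using hv'
  set h : L1 := (R : ℂ)⁻¹ •
    ∑ n ∈ Finset.range R, exp ((-(2 * Real.pi * (n / R) * c) : ℝ) * I) • v n with hh
  have hhnorm : ‖h‖ ≤ K := by
    rw [hh, norm_smul, norm_inv, Complex.norm_natCast, inv_mul_le_iff₀ hR0']
    refine (norm_sum_le_of_le _ fun n hn => ?_).trans_eq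
      (by rw [Finset.sum_const, Finset.card_range, nsmul_eq_mul])
    rw [norm_smul, norm_exp_ofReal_mul_I, one_mul]
    exact hv₂ n hn
  have hheval : ∀ j : ZMod p, ‖evalL (ZMod.toCircle j) h - if j ∈ A then 1 else 0‖ ≤ η / 16 := by
    intro j
    have e1 : (if j ∈ A then (1 : ℂ) else 0) = if (R : ℤ) ∣ a j - c then 1 else 0 := by
      refine if_congr ?_ rfl rfl
      rw [hA, hR]; push_cast; rfl
    have e2 : evalL (ZMod.toCircle j) h = (R : ℂ)⁻¹ *
        ∑ n ∈ Finset.range R, exp (I * (2 * Real.pi * (n / R) * (m * φ j - c) : ℝ)) := by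
      rw [hh, map_smul, map_sum, smul_eq_mul]
      congr 1
      refine Finset.sum_congr rfl fun n hn => ?_
      rw [map_smul, hv₁ n hn, smul_eq_mul, ← exp_add, hθφ]
      congr 1
      push_cast
      ring
    rw [e1, e2, ← average_exp_eq_ite hR0, ← mul_sub, ← Finset.sum_sub_distrib, norm_mul, norm_inv,
      Complex.norm_natCast, inv_mul_le_iff₀ hR0']
    refine (norm_sum_le_of_le (n := fun _ => η / 16) _ fun n hn => ?_).trans_eq
      (by rw [Finset.sum_const, Finset.card_range, nsmul_eq_mul])
    refine (norm_exp_I_sub_exp_I_le _ _).trans ?_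
    have e3 : 2 * Real.pi * (n / R) * (m * φ j - c) - 2 * Real.pi * (n / R) * ((a j - c : ℤ) : ℝ) =
        2 * Real.pi * (n / R) * (m * φ j - a j) := by push_cast; ring
    rw [e3, abs_mul, abs_of_nonneg (by positivity : 0 ≤ 2 * Real.pi * ((n : ℝ) / R))]
    calc 2 * Real.pi * ((n : ℝ) / R) * |m * φ j - a j| ≤ 2 * Real.pi * 1 * (1 / q) :=
          mul_le_mul (mul_le_mul_of_nonneg_left (hfrac n hn) (by positivity)) (ha j)
            (abs_nonneg _) (by positivity)
      _ = 2 * Real.pi / q := by ring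
      _ ≤ η / 16 := by rw [div_le_iff₀ hq0]; linarith
  obtain ⟨s, hs⟩ := exists_finset_norm_sub_le h (show 0 < η / 16 by positivity)
  refine hlog p K hK s (fun k => h k) (fun k => ZMod.toCircle ^ k)
    ((sum_norm_le_norm h s).trans hhnorm) A (fun j => ?_) hA1 hA2
  have e : trig s (fun k => h k) (fun k => (ZMod.toCircle : AddChar (ZMod p) Circle) ^ k) j =
      ∑ k ∈ s, h k * (ZMod.toCircle j : ℂ) ^ k := by
    simp [trig, AddChar.zpow_apply]
  rw [e, ← sub_add_sub_cancel _ (evalL (ZMod.toCircle j) h)]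
  exact (norm_add_le_of_le (hs _) (hheval j)).trans_eq (by ring)

/-- Slow growth of the Wiener norms of `exp (i t θ)` forces `θ` to be constant. -/
theorem eq_of_slow_growth {θ : Circle → ℝ} (hθ : Continuous θ) {N : ℕ → ℝ} {C : ℝ} (hC : 0 < C)
    (hN0 : ∀ n, 0 ≤ N n)
    (hN : ∀ ε : ℝ, 0 < ε → ∀ᶠ n : ℕ in atTop, N n ^ 12 ≤ ε * Real.log (Real.log n))
    (h : ∀ t : ℝ, 0 ≤ t → ∃ v : L1, (∀ z, evalL z v = exp (I * (t * θ z : ℝ))) ∧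
      ‖v‖ ≤ C * N ⌊t⌋₊) (z w : Circle) : θ z = θ w := by
  by_contra hzw
  obtain ⟨C₀, hC₀, q, hq, p₀, hmain⟩ := log_le_of_norm_exp_le hθ hzw
  have hq1 : (1 : ℝ) < q := by exact_mod_cast hq
  set ε := 1 / (4 * C₀ * C ^ 12) with hε
  have hε0 : 0 < ε := by positivity
  obtain ⟨n₀, hn₀⟩ := eventually_atTop.1 (hN ε hε0)
  set n₁ := max n₀ 3
  set B := 1 + 1 / C ^ 12 + ∑ n ∈ Finset.range n₁, N n ^ 12 with hB
  have hsum : 0 ≤ ∑ n ∈ Finset.range n₁, N n ^ 12 := Finset.sum_nonneg fun n _ => by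
    have := hN0 n; positivity
  have hB0 : 0 < B := by positivity
  have htend : Tendsto (fun p : ℕ => Real.log p) atTop atTop :=
    Real.tendsto_log_atTop.comp tendsto_natCast_atTop_atTop
  obtain ⟨p₁, hp₁⟩ := eventually_atTop.1 (htend.eventually_gt_atTop
    (max (Real.log (Real.log q)) (2 * (C₀ * C ^ 12 * B))))
  obtain ⟨p, hp, hprime⟩ := Nat.exists_infinite_primes (max (max p₀ p₁) n₁)
  have : Fact p.Prime := ⟨hprime⟩
  have hpp₀ : p₀ ≤ p := (le_max_left _ _).trans ((le_max_left _ _).trans hp)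
  have hpn₁ : n₁ ≤ p := (le_max_right _ _).trans hp
  obtain ⟨hlogq, hlogB⟩ := max_lt_iff.1
    (hp₁ p ((le_max_right _ _).trans ((le_max_left _ _).trans hp)))
  have hp3 : 3 ≤ p := (le_max_right _ _).trans hpn₁
  have hp3' : (3 : ℝ) ≤ p := by exact_mod_cast hp3
  have hlogp : 0 < Real.log p := Real.log_pos (by linarith)
  have hloglog3 : 1 < Real.log 3 := by
    rw [Real.lt_log_iff_exp_lt (by norm_num)]
    exact Real.exp_one_lt_d9.trans (by norm_num)
  have hLL : Real.log (Real.log ((q : ℝ) ^ p)) ≤ 2 * Real.log p := by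
    rw [Real.log_pow, Real.log_mul (by positivity) (Real.log_pos hq1).ne']
    linarith
  set S := B + 2 * ε * Real.log p with hS
  have hNS : ∀ n : ℕ, (n : ℝ) ≤ (q : ℝ) ^ p → N n ^ 12 ≤ S := fun n hn => by
    rcases lt_or_ge n n₁ with hlt | hge
    · have h1 := Finset.single_le_sum (f := fun n => N n ^ 12)
        (fun i _ => by have := hN0 i; positivity) (Finset.mem_range.2 hlt)
      have h2 : 0 < 1 / C ^ 12 := by positivity
      have h3 : 0 < 2 * ε * Real.log p := by positivity
      linarith
    · have h3n : (3 : ℝ) ≤ n := by exact_mod_cast (le_max_right _ _).trans hge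
      have hl : 1 < Real.log n := hloglog3.trans_le (Real.log_le_log (by norm_num) h3n)
      have hle : Real.log (Real.log n) ≤ Real.log (Real.log ((q : ℝ) ^ p)) :=
        Real.log_le_log (by linarith) (Real.log_le_log (by linarith) hn)
      have h1 := hn₀ n ((le_max_left _ _).trans hge)
      have h2 := mul_le_mul_of_nonneg_left (hle.trans hLL) hε0.le
      linarith
  have hS0 : 0 < S := by positivity
  obtain ⟨ρ, hρ0, hρ⟩ : ∃ ρ : ℝ, 0 ≤ ρ ∧ ρ ^ 12 = S := by
    refine ⟨S ^ ((1 : ℝ) / 12), Real.rpow_nonneg hS0.le _, ?_⟩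
    rw [← Real.rpow_natCast, ← Real.rpow_mul hS0.le]
    norm_num
  have hCS : 1 ≤ (C * ρ) ^ 12 := by
    rw [mul_pow, hρ]
    have h2 : 0 < 2 * ε * Real.log p := by positivity
    calc 1 = C ^ 12 * (1 / C ^ 12) := by field_simp
      _ ≤ C ^ 12 * S := mul_le_mul_of_nonneg_left (by linarith) (by positivity)
  have hK : 1 ≤ C * ρ := by
    by_contra! hlt
    exact absurd (pow_lt_one₀ (by positivity) hlt (by norm_num : (12 : ℕ) ≠ 0)) (not_lt.2 hCS)
  have hfinal := hmain p hpp₀ _ hK fun t ht0 ht => by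
    obtain ⟨v, hv, hvn⟩ := h t ht0
    refine ⟨v, hv, hvn.trans (mul_le_mul_of_nonneg_left ?_ hC.le)⟩
    refine le_of_pow_le_pow_left₀ (by norm_num : (12 : ℕ) ≠ 0) hρ0 ?_
    rw [hρ]
    exact hNS _ ((Nat.floor_le ht0).trans ht)
  rw [mul_pow, hρ, hS] at hfinal
  have e : C₀ * (C ^ 12 * (B + 2 * ε * Real.log p)) =
      C₀ * C ^ 12 * B + Real.log p / 2 := by
    rw [hε]; field_simp; ring
  rw [e] at hfinal
  linarith

end Growth

section Powers

lemma eventually_pow_le_mul_log_log {M : ℤ → ℝ} (hM : ∀ n, 0 ≤ M n)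
    (h : Tendsto (fun n : ℤ => M n * (Real.log (Real.log (Real.log |(n : ℝ)|)) /
      Real.log (Real.log |(n : ℝ)|)) ^ ((1 : ℝ) / 12)) cofinite (nhds 0))
    {ε : ℝ} (hε : 0 < ε) :
    ∀ᶠ n : ℤ in cofinite, M n ^ 12 ≤ ε * Real.log (Real.log |(n : ℝ)|) := by
  have habs : Tendsto (fun n : ℤ => |(n : ℝ)|) cofinite atTop := by
    simpa [Function.comp_def] using
      (tendsto_norm_cocompact_atTop (E := ℝ)).comp Int.tendsto_coe_cofinite
  have h2 := Real.tendsto_log_atTop.comp (Real.tendsto_log_atTop.comp habs)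
  have h3 := Real.tendsto_log_atTop.comp h2
  have hδ : 0 < ε ^ ((1 : ℝ) / 12) := by positivity
  filter_upwards [h.eventually_lt_const hδ, h2.eventually_ge_atTop 1, h3.eventually_ge_atTop 1]
    with n hn h2 h3
  simp only [Function.comp_apply] at h2 h3
  set A := Real.log (Real.log |(n : ℝ)|)
  set B := Real.log A
  have hpow : ∀ x : ℝ, 0 ≤ x → (x ^ ((1 : ℝ) / 12)) ^ 12 = x := fun x hx => by
    rw [← Real.rpow_natCast, ← Real.rpow_mul hx]
    norm_num
  have hr : 0 ≤ B / A := by positivity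
  have h4 := pow_le_pow_left₀ (mul_nonneg (hM n) (Real.rpow_nonneg hr _)) hn.le 12
  rw [mul_pow, hpow _ hr, hpow _ hε.le, ← mul_div_assoc, div_le_iff₀ (by linarith)] at h4
  exact (le_mul_of_one_le_right (pow_nonneg (hM n) 12) h3).trans h4

lemma le_one_of_eventually_pow_le {r : ℝ} (h : ∀ᶠ n : ℕ in atTop, r ^ n ≤ n) : r ≤ 1 := by
  by_contra! hr
  have h1 := (tendsto_pow_const_div_const_pow_of_one_lt 1 hr).eventually_lt_const one_pos
  obtain ⟨n, hn, hn'⟩ := (h.and h1).exists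
  rw [div_lt_one (by positivity), pow_one] at hn'
  linarith

lemma norm_sym_le_one {T : L1 →L[ℂ] L1} (hT : Commute T shiftL1)
    (h : ∀ᶠ n : ℕ in atTop, ‖T ^ n‖ ^ 12 ≤ Real.log (Real.log n)) (z : Circle) :
    ‖sym z T‖ ≤ 1 := by
  refine le_one_of_eventually_pow_le ?_
  filter_upwards [h, eventually_ge_atTop 3] with n hn hn3
  rw [← norm_pow, ← sym_pow hT]
  refine (norm_sym_le z _).trans ?_
  have hn3' : (3 : ℝ) ≤ n := by exact_mod_cast hn3
  have h1 : Real.log n ≤ n := Real.log_le_self (by linarith)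
  have h2 : Real.log (Real.log n) ≤ n :=
    (Real.log_le_self (Real.log_nonneg (by linarith))).trans h1
  rcases le_total ‖T ^ n‖ 1 with h3 | h3
  · linarith
  · exact (le_self_pow₀ h3 (by norm_num)).trans (hn.trans h2)

lemma norm_exp_le_exp_norm (T : L1 →L[ℂ] L1) : ‖NormedSpace.exp T‖ ≤ Real.exp ‖T‖ := by
  have h2 := NormedSpace.exp_series_hasSum_exp' (𝕂 := ℝ) ‖T‖
  rw [← Real.exp_eq_exp_ℝ] at h2
  refine (NormedSpace.exp_series_hasSum_exp' (𝕂 := ℂ) T).norm_le_of_bounded h2 fun n => ?_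
  rw [norm_smul, norm_inv, Complex.norm_natCast, smul_eq_mul]
  refine mul_le_mul_of_nonneg_left ?_ (by positivity)
  cases n with
  | zero =>
    rw [pow_zero, pow_zero]
    exact ContinuousLinearMap.norm_id_le
  | succ n => exact norm_pow_le' T n.succ_pos

/-- A unimodular symbol `z ^ ν * exp (ℓ z)` whose operator has slowly growing powers is a
monomial. -/
theorem exists_eq_smul_transl {U L : L1 →L[ℂ] L1} (hU : Commute U shiftL1)
    (hL : Commute L shiftL1) {ν : ℤ} (hUL : ∀ z, sym z U = (z : ℂ) ^ ν * exp (sym z L))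
    (hnorm : ∀ z, ‖sym z U‖ = 1)
    (hslow : ∀ ε : ℝ, 0 < ε → ∀ᶠ n : ℕ in atTop, ‖U ^ n‖ ^ 12 ≤ ε * Real.log (Real.log n)) :
    ∃ ξ : ℂ, ‖ξ‖ = 1 ∧ U = ξ • transl ν := by
  set θ : Circle → ℝ := fun z => (sym z L).im with hθ
  have hLθ : ∀ z, sym z L = I * θ z := fun z => by
    have h1 := hnorm z
    rw [hUL, norm_mul, norm_zpow, Circle.norm_coe, one_zpow, one_mul, norm_exp,
      Real.exp_eq_one_iff] at h1
    rw [mul_comm]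
    conv_lhs => rw [← re_add_im (sym z L), h1]
    simp [hθ]
  have hθc : Continuous θ := continuous_im.comp (continuous_sym L)
  set W := U * transl (-ν) with hWd
  have hcomm := commute_transl hU (-ν)
  have hW : Commute W shiftL1 := hU.mul_left (commute_transl_shift _)
  have hWsym : ∀ z, sym z W = exp (I * θ z) := fun z => by
    have hz := Circle.coe_ne_zero z
    rw [hWd, sym_mul hU, sym_transl, hUL, hLθ, zpow_neg]
    field_simp
  have hWpow : ∀ n, ‖W ^ n‖ ≤ ‖U ^ n‖ := fun n => by
    rw [hWd, hcomm.mul_pow, transl_pow]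
    exact (norm_mul_le _ _).trans (mul_le_of_le_one_right (norm_nonneg _) (norm_transl_le _))
  have hconst := eq_of_slow_growth hθc (Real.exp_pos ‖L‖) (fun n => norm_nonneg (U ^ n)) hslow
    fun t ht => by
      have hfl := Nat.floor_le ht
      have hfl' := Nat.lt_floor_add_one t
      set n := ⌊t⌋₊
      set s : ℂ := ((t - n : ℝ) : ℂ) with hs
      have hsL : Commute (s • L) shiftL1 := hL.smul_left s
      refine ⟨(W ^ n * NormedSpace.exp (s • L)) delta, fun z => ?_, ?_⟩
      · rw [← sym_apply, sym_mul (hW.pow_left n), sym_pow hW, sym_exp hsL, hWsym, map_smul, hLθ,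
          ← exp_nat_mul, ← exp_add, smul_eq_mul, hs]
        congr 1
        push_cast
        ring
      · refine (norm_apply_delta_le _).trans ((norm_mul_le _ _).trans ?_)
        rw [mul_comm]
        refine mul_le_mul ?_ (hWpow n) (norm_nonneg _) (Real.exp_pos _).le
        refine (norm_exp_le_exp_norm _).trans (Real.exp_le_exp.2 ?_)
        rw [norm_smul, hs, norm_real, Real.norm_eq_abs, abs_of_nonneg (by linarith)]
        exact mul_le_of_le_one_left (norm_nonneg _) (by linarith)
  refine ⟨exp (I * θ 1), by rw [mul_comm, norm_exp_ofReal_mul_I], ?_⟩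
  refine eq_of_apply_delta hU ((commute_transl_shift ν).smul_left _) (eq_of_evalL_eq fun z => ?_)
  rw [← sym_apply, ← sym_apply, map_smul, sym_transl, hUL, hLθ, hconst z 1, smul_eq_mul, mul_comm]

end Powers

end BeurlingHelson

theorem beurling_helson_improvement_operator_version
    (U : (lp (fun _ : ℤ => ℂ) 1 →L[ℂ] lp (fun _ : ℤ => ℂ) 1)ˣ)
    (hcomm : (U : lp (fun _ : ℤ => ℂ) 1 →L[ℂ] lp (fun _ : ℤ => ℂ) 1).comp shiftL1 =
      shiftL1.comp (U : lp (fun _ : ℤ => ℂ) 1 →L[ℂ] lp (fun _ : ℤ => ℂ) 1))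
    (hdecay : Tendsto
      (fun n : ℤ =>
        ‖((U ^ n : (lp (fun _ : ℤ => ℂ) 1 →L[ℂ] lp (fun _ : ℤ => ℂ) 1)ˣ) :
            lp (fun _ : ℤ => ℂ) 1 →L[ℂ] lp (fun _ : ℤ => ℂ) 1)‖ *
          (Real.log (Real.log (Real.log |(n : ℝ)|)) /
            Real.log (Real.log |(n : ℝ)|)) ^ ((1 : ℝ) / 12))
      cofinite (nhds 0)) :
    ∃ ξ : ℂ, ‖ξ‖ = 1 ∧ ∃ ν : ℤ,
      ∀ (x : lp (fun _ : ℤ => ℂ) 1) (k : ℤ),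
        (U : lp (fun _ : ℤ => ℂ) 1 →L[ℂ] lp (fun _ : ℤ => ℂ) 1) x k = ξ * x (k - ν) := by
  open BeurlingHelson in
  have hU : Commute (U : L1 →L[ℂ] L1) shiftL1 := hcomm
  have hU' : Commute ((U⁻¹ : (L1 →L[ℂ] L1)ˣ) : L1 →L[ℂ] L1) shiftL1 := hU.units_inv_left
  have hslow := fun (ε : ℝ) (hε : 0 < ε) =>
    eventually_pow_le_mul_log_log (fun n => norm_nonneg _) hdecay hε
  have hpos : ∀ ε : ℝ, 0 < ε → ∀ᶠ n : ℕ in atTop,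
      ‖(U : L1 →L[ℂ] L1) ^ n‖ ^ 12 ≤ ε * Real.log (Real.log n) := fun ε hε => by
    have h := (Nat.cast_injective (R := ℤ)).tendsto_cofinite.eventually (hslow ε hε)
    rw [Nat.cofinite_eq_atTop] at h
    simpa using h
  have hneg : ∀ᶠ n : ℕ in atTop,
      ‖((U⁻¹ : (L1 →L[ℂ] L1)ˣ) : L1 →L[ℂ] L1) ^ n‖ ^ 12 ≤ Real.log (Real.log n) := by
    have hinj : Function.Injective fun n : ℕ => -(n : ℤ) := fun a b h => by simpa using h
    have h := hinj.tendsto_cofinite.eventually (hslow 1 one_pos)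
    rw [Nat.cofinite_eq_atTop] at h
    simpa [zpow_neg, ← inv_pow] using h
  have hnorm : ∀ z, ‖sym z (U : L1 →L[ℂ] L1)‖ = 1 := fun z => by
    have h1 := norm_sym_le_one hU (by simpa using hpos 1 one_pos) z
    have h2 := norm_sym_le_one hU' hneg z
    have h3 : ‖sym z ((U⁻¹ : (L1 →L[ℂ] L1)ˣ) : L1 →L[ℂ] L1)‖ * ‖sym z (U : L1 →L[ℂ] L1)‖ = 1 := by
      rw [← norm_mul, ← sym_mul hU', U.inv_mul, sym_one, norm_one]
    nlinarith [norm_nonneg (sym z (U : L1 →L[ℂ] L1))]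
  obtain ⟨ν, L, hL, hUL⟩ := liftable_sym U hU
  obtain ⟨ξ, hξ, h⟩ := exists_eq_smul_transl hU hL hUL hnorm hpos
  exact ⟨ξ, hξ, ν, fun x k => by rw [h]; rfl⟩
end
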